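/- The bigraded Poincaré series of the pure trace algebra of two generic 4×4 matrices satisfies P(C_{4,2}; s,t) = N / D, where N = (1 − st + s²t²)·(1 − st² − s²t + s²t³ + s³t² + s²t⁴ + 2s³t³ + s⁴t² + s³t⁴ + s⁴t³ − s⁴t⁵ − s⁵t⁴ + s⁶t⁶) and D = (1−s)(1−t)·(1−s²)(1−st)²(1−t²)·(1−s³)(1−s²t)²(1−st²)²(1−t³)·(1−s⁴)(1−s³t)(1−s²t²)(1−st³)(1−t⁴). -/

import Mathlib

open MvPolynomial Matrix

noncomputable section

/-- Index type for the entries of a pair of generic `n × n` matrices: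
`Sum.inl (i,j)` indexes the `(i,j)` entry of `x`, `Sum.inr (i,j)` that of `y`. -/
abbrev MatVar (n : ℕ) := (Fin n × Fin n) ⊕ (Fin n × Fin n)

/-- The substitution sending the variables to the entries of the pair `(A, B)`. -/
def pairSub {K : Type*} [CommSemiring K] {n : ℕ} (A B : Matrix (Fin n) (Fin n) K) :
    MatVar n → K
  | Sum.inl ij => A ij.1 ij.2
  | Sum.inr ij => B ij.1 ij.2

/-- A polynomial function on pairs of `n × n` matrices is `GLₙ`-invariant (for the action
by simultaneous conjugation). -/
def IsMatInvariant {K : Type*} [Field K] {n : ℕ} (f : MvPolynomial (MatVar n) K) : Prop :=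
  ∀ (a : GL (Fin n) K) (A B : Matrix (Fin n) (Fin n) K),
    MvPolynomial.eval
        (pairSub ((a : Matrix (Fin n) (Fin n) K) * A * ((a⁻¹ : GL (Fin n) K) : Matrix (Fin n) (Fin n) K))
          ((a : Matrix (Fin n) (Fin n) K) * B * ((a⁻¹ : GL (Fin n) K) : Matrix (Fin n) (Fin n) K))) f =
      MvPolynomial.eval (pairSub A B) f

/-- The weight giving the bidegree: entries of `x` have weight `(1,0)`,
those of `y` have weight `(0,1)`. -/
def bideg (n : ℕ) : MatVar n → ℕ × ℕ
  | Sum.inl _ => (1, 0)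
  | Sum.inr _ => (0, 1)

/-- The bigraded component of bidegree `(p, q)` of the pure trace algebra `C_{n,2}`. -/
def pureComponent (K : Type*) [Field K] (n p q : ℕ) : Set (MvPolynomial (MatVar n) K) :=
  {f | IsMatInvariant f ∧ f.IsWeightedHomogeneous (bideg n) (p, q)}

/-- `dim_K C_{n,2}^{(p,q)}`. -/
def pureDim (K : Type*) [Field K] (n p q : ℕ) : ℕ :=
  Set.finrank K (pureComponent K n p q)

/-- The bigraded Poincaré series `P(C_{n,2}; s, t)`, with `s` the variable `X 0` and
`t` the variable `X 1`. -/
def purePS2 (K : Type*) [Field K] (n : ℕ) : MvPowerSeries (Fin 2) ℚ :=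
  fun d => (pureDim K n (d 0) (d 1) : ℚ)

/-- abbreviation for the power series variable `s`. -/
def ps : MvPowerSeries (Fin 2) ℚ := MvPowerSeries.X 0

/-- abbreviation for the power series variable `t`. -/
def pt : MvPowerSeries (Fin 2) ℚ := MvPowerSeries.X 1


set_option linter.all false

section PartAlg

structure Mon where
  s : ℤ
  t : ℤ
  a : ℤ
  b : ℤ
  c : ℤ
  d : ℤ
deriving DecidableEq

namespace Mon

def add (M N : Mon) : Mon := ⟨M.s + N.s, M.t + N.t, M.a + N.a, M.b + N.b, M.c + N.c, M.d + N.d⟩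
def neg (M : Mon) : Mon := ⟨-M.s, -M.t, -M.a, -M.b, -M.c, -M.d⟩
def smul (j : ℤ) (M : Mon) : Mon := ⟨j * M.s, j * M.t, j * M.a, j * M.b, j * M.c, j * M.d⟩
def zero : Mon := ⟨0, 0, 0, 0, 0, 0⟩

def pos (M : Mon) : Bool :=
  if M.s ≠ 0 then decide (0 < M.s) else
  if M.t ≠ 0 then decide (0 < M.t) else
  if M.a ≠ 0 then decide (0 < M.a) else
  if M.b ≠ 0 then decide (0 < M.b) else
  if M.c ≠ 0 then decide (0 < M.c) else decide (0 < M.d)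

def co (k : Fin 3) (M : Mon) : ℤ := match k with
  | 0 => M.a
  | 1 => M.b
  | 2 => M.c

def unit (k : Fin 3) : Mon := match k with
  | 0 => ⟨0, 0, 1, 0, 0, 0⟩
  | 1 => ⟨0, 0, 0, 1, 0, 0⟩
  | 2 => ⟨0, 0, 0, 0, 1, 0⟩

def subst (k : Fin 3) (p M : Mon) : Mon :=
  M.add (smul (M.co k) (p.add (unit k).neg))

end Mon

structure Term where
  c : ℤ
  m : Mon
  ns : List Mon
  ds : List Mon

namespace Term

def addD (M : Mon) (T : Term) : Term :=
  if M.pos then ⟨T.c, T.m, T.ns, M :: T.ds⟩ else ⟨-T.c, T.m.add M.neg, T.ns, M.neg :: T.ds⟩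

def addN' (M : Mon) (T : Term) : Term :=
  if M.pos && decide (M ∈ T.ds) then ⟨T.c, T.m, T.ns, T.ds.erase M⟩
  else ⟨T.c, T.m, M :: T.ns, T.ds⟩

def addN (M : Mon) (T : Term) : Term :=
  if M.pos then T.addN' M else addN' M.neg ⟨-T.c, T.m.add M, T.ns, T.ds⟩

def norm (T : Term) : List Term :=
  if Mon.zero ∈ T.ns then [] else
    [T.ns.foldr addN (T.ds.foldr addD ⟨T.c, T.m, [], []⟩)]

def splitDup : List Mon → List Mon × List Mon
  | [] => ([], [])
  | M :: l => match splitDup l with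
    | (h, ex) => if M ∈ h then (h, M :: ex) else (M :: h, ex)

def outs (k : Fin 3) (T : Term) (base h A B ab : List Mon) : List Term :=
  h.flatMap fun M =>
    if M.co k = -1 then
      norm ⟨T.c, Mon.subst k (M.add (Mon.unit k)) T.m,
        T.ns.map (Mon.subst k (M.add (Mon.unit k))),
        (h.erase M ++ B).map (Mon.subst k (M.add (Mon.unit k))) ++ base ++ ab⟩
    else match A with
      | [] => []
      | P :: _ =>
        norm ⟨T.c, (Mon.subst k ((Mon.unit k).add M.neg) T.m).add (P.add M),
          T.ns.map (Mon.subst k ((Mon.unit k).add M.neg)),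
          (h.erase M ++ A).map (Mon.subst k ((Mon.unit k).add M.neg)) ++ base ++ ab⟩

def expA (k : Fin 3) (T : Term) (h : List Mon) : ℤ :=
  T.m.co k + ((h.filter fun M => M.co k = -1).length : ℤ)
    - ((T.ns.filter fun M => M.co k = -1).length : ℤ) - 1

def step' (k : Fin 3) (T : Term) (base h A B : List Mon) : Option (List Term) :=
  if 0 ≤ expA k T h ∧
      expA k T h + ((T.ns.filter fun M => M.co k ≠ 0).length : ℤ) < (h.length : ℤ) then
    match A, B with
    | [], [] => some (outs k T base h [] [] [])
    | [P], [] => some (outs k T base h [P] [] [])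
    | [], [Q] => some (outs k T base h [] [Q] [])
    | [P], [Q] => some (outs k T base h [P] [Q] [P.add Q])
    | _, _ => none
  else none

def step (k : Fin 3) (T : Term) : Option (List Term) :=
  if (T.ds.all fun M => M.co k = 0 || (M.pos && (M.co k = 1 || M.co k = -1))) &&
     (T.ns.all fun M => M.co k = 0 || M.co k = 1 || M.co k = -1) then
    match splitDup (T.ds.filter fun M => M.co k ≠ 0) with
    | (h, ex) => step' k T (T.ds.filter fun M => M.co k = 0) h
        (ex.filter fun M => M.co k = -1) (ex.filter fun M => M.co k ≠ -1)
  else none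

def stepL (k : Fin 3) : List Term → Option (List Term)
  | [] => some []
  | T :: l => match step k T, stepL k l with
    | some a, some b => some (a ++ b)
    | _, _ => none

def start : Term :=
  ⟨1, Mon.zero,
   [⟨0,0,-1,1,0,0⟩, ⟨0,0,-1,0,1,0⟩, ⟨0,0,-1,0,0,1⟩, ⟨0,0,0,-1,1,0⟩, ⟨0,0,0,-1,0,1⟩, ⟨0,0,0,0,-1,1⟩],
   [⟨1,0,0,0,0,0⟩, ⟨1,0,0,0,0,0⟩, ⟨1,0,0,0,0,0⟩, ⟨1,0,0,0,0,0⟩,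
    ⟨0,1,0,0,0,0⟩, ⟨0,1,0,0,0,0⟩, ⟨0,1,0,0,0,0⟩, ⟨0,1,0,0,0,0⟩,
    ⟨1,0,1,-1,0,0⟩, ⟨1,0,1,0,-1,0⟩, ⟨1,0,1,0,0,-1⟩, ⟨1,0,0,1,-1,0⟩, ⟨1,0,0,1,0,-1⟩, ⟨1,0,0,0,1,-1⟩,
    ⟨1,0,-1,1,0,0⟩, ⟨1,0,-1,0,1,0⟩, ⟨1,0,-1,0,0,1⟩, ⟨1,0,0,-1,1,0⟩, ⟨1,0,0,-1,0,1⟩, ⟨1,0,0,0,-1,1⟩,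
    ⟨0,1,1,-1,0,0⟩, ⟨0,1,1,0,-1,0⟩, ⟨0,1,1,0,0,-1⟩, ⟨0,1,0,1,-1,0⟩, ⟨0,1,0,1,0,-1⟩, ⟨0,1,0,0,1,-1⟩,
    ⟨0,1,-1,1,0,0⟩, ⟨0,1,-1,0,1,0⟩, ⟨0,1,-1,0,0,1⟩, ⟨0,1,0,-1,1,0⟩, ⟨0,1,0,-1,0,1⟩, ⟨0,1,0,0,-1,1⟩]⟩

def runAll : Option (List Term) :=
  match norm start with
  | l => match stepL 0 l with
    | none => none
    | some l => match stepL 1 l with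
      | none => none
      | some l => stepL 2 l

end Term

end PartAlg

section PartHahn

abbrev Gm := Lex (Fin 6 → ℤ)
abbrev HF := HahnSeries Gm ℚ

/-- monomial -/
def xg (γ : Gm) : HF := HahnSeries.single γ 1

lemma xg_mul (a b : Gm) : xg a * xg b = xg (a + b) := by
  simp [xg, HahnSeries.single_mul_single]

lemma xg_zero : xg 0 = 1 := rfl

lemma xg_ne (a : Gm) : xg a ≠ 0 := by
  simp [xg]

lemma xg_inv (a : Gm) : (xg a)⁻¹ = xg (-a) := by
  rw [inv_eq_iff_eq_inv]
  apply eq_inv_of_mul_eq_one_left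
  rw [xg_mul, add_neg_cancel, xg_zero]

lemma xg_coeff (a γ : Gm) : (xg a).coeff γ = if γ = a then 1 else 0 := by
  unfold xg
  rw [HahnSeries.coeff_single]
  split_ifs <;> rfl

lemma xg_inj {a b : Gm} (h : xg a = xg b) : a = b := by
  by_contra hne
  have := congrArg (fun f => HahnSeries.coeff f a) h
  simp [xg_coeff, hne] at this

lemma one_sub_xg_ne {a : Gm} (h : a ≠ 0) : 1 - xg a ≠ 0 := by
  intro h0
  rw [sub_eq_zero, ← xg_zero] at h0
  exact h (xg_inj h0).symm

lemma mul_supp {f g : HF} {γ : Gm} (h : (f * g).coeff γ ≠ 0) :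
    ∃ a b, f.coeff a ≠ 0 ∧ g.coeff b ≠ 0 ∧ a + b = γ := by
  obtain ⟨a, ha, b, hb, e⟩ := HahnSeries.support_mul_subset (show γ ∈ (f*g).support from h)
  exact ⟨a, b, ha, hb, e⟩

lemma inv_supp {M : Gm} (hM : 0 < M) {γ : Gm} (h : (1 - xg M)⁻¹.coeff γ ≠ 0) :
    ∃ n : ℕ, γ = n • M := by
  set A := (1 - xg M)⁻¹ with hA
  have hrec : A = 1 + xg M * A := by
    have : (1 - xg M) * A = 1 := mul_inv_cancel₀ (one_sub_xg_ne hM.ne')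
    linear_combination this
  by_contra hn
  have hwf : A.support.IsWF := A.isWF_support
  let S : Set Gm := {γ | A.coeff γ ≠ 0 ∧ ¬ ∃ n : ℕ, γ = n • M}
  have hS : S.IsWF := hwf.mono (fun x hx => hx.1)
  have hne : S.Nonempty := ⟨γ, h, hn⟩
  have hmin := hS.min_mem hne
  set m := hS.min hne with hm
  have h0 : m ≠ 0 := fun e => hmin.2 ⟨0, by simp [e]⟩
  have h1 : A.coeff (m - M) ≠ 0 := by
    have h2 := hmin.1
    rw [hrec, HahnSeries.coeff_add, ← xg_zero, xg_coeff, if_neg h0, zero_add] at h2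
    unfold xg at h2
    rwa [HahnSeries.coeff_single_mul, one_mul] at h2
  have h3 : m - M ∈ S := by
    refine ⟨h1, ?_⟩
    rintro ⟨n, hn⟩
    exact hmin.2 ⟨n + 1, by rw [add_smul, ← hn]; simp⟩
  have := hS.min_le hne h3
  rw [← hm] at this
  have h4 : m - M < m := sub_lt_self _ hM
  exact absurd this (not_le.mpr h4)

variable (l : Gm →+ ℤ)

def Nn (f : HF) : Prop := ∀ γ, f.coeff γ ≠ 0 → 0 ≤ l γ
def Fr (f : HF) : Prop := ∀ γ, f.coeff γ ≠ 0 → l γ = 0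
def Ps (f : HF) : Prop := ∀ γ, f.coeff γ ≠ 0 → 0 < l γ

def prj (f : HF) : HF where
  coeff γ := if l γ = 0 then f.coeff γ else 0
  isPWO_support' := f.isPWO_support.mono (by
    intro γ hγ
    simp only [Function.mem_support] at hγ
    simp only [HahnSeries.mem_support]
    intro h
    simp [h] at hγ)

lemma prj_coeff (f : HF) (γ : Gm) : (prj l f).coeff γ = if l γ = 0 then f.coeff γ else 0 := rfl

lemma prj_add (f g : HF) : prj l (f + g) = prj l f + prj l g := by
  ext γ; simp only [prj_coeff, HahnSeries.coeff_add]; split_ifs <;> simp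

lemma prj_sub (f g : HF) : prj l (f - g) = prj l f - prj l g := by
  ext γ; simp only [prj_coeff, HahnSeries.coeff_sub]; split_ifs <;> simp

lemma prj_zero : prj l 0 = 0 := by
  ext γ; simp [prj_coeff]

variable {l}

lemma Fr.prj {f : HF} (h : Fr l f) : prj l f = f := by
  ext γ; rw [prj_coeff]; split_ifs with h1
  · rfl
  · by_contra h2; exact h1 (h γ (Ne.symm h2))

lemma Ps.prj {f : HF} (h : Ps l f) : prj l f = 0 := by
  ext γ; rw [prj_coeff]; split_ifs with h1
  · by_contra h2; exact (h γ h2).ne' h1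
  · rfl

lemma Fr.nn {f : HF} (h : Fr l f) : Nn l f := fun γ h1 => (h γ h1).ge

lemma Fr.neg_l {f : HF} (h : Fr l f) : Fr (-l) f := fun γ h1 => by simp [h γ h1]
lemma prj_neg_l (f : HF) : _root_.prj (-l) f = _root_.prj l f := by
  ext γ; simp [prj_coeff]

lemma fr_prj (f : HF) : Fr l (_root_.prj l f) := by
  intro γ h; rw [prj_coeff] at h; by_contra h1; simp [h1] at h

lemma Nn.ps_sub {f : HF} (h : Nn l f) : Ps l (f - _root_.prj l f) := by
  intro γ h1
  rw [HahnSeries.coeff_sub, prj_coeff] at h1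
  split_ifs at h1 with h2
  · simp at h1
  · rw [sub_zero] at h1
    exact lt_of_le_of_ne (h γ h1) (Ne.symm h2)

lemma add_supp {f g : HF} {γ : Gm} (h : (f + g).coeff γ ≠ 0) : f.coeff γ ≠ 0 ∨ g.coeff γ ≠ 0 := by
  by_contra! h1; simp [h1] at h
lemma sub_supp {f g : HF} {γ : Gm} (h : (f - g).coeff γ ≠ 0) : f.coeff γ ≠ 0 ∨ g.coeff γ ≠ 0 := by
  by_contra! h1; simp [h1] at h

lemma Nn.mul {f g : HF} (hf : Nn l f) (hg : Nn l g) : Nn l (f * g) := by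
  intro γ h; obtain ⟨a, b, ha, hb, rfl⟩ := mul_supp h
  rw [map_add]; have := hf a ha; have := hg b hb; omega
lemma Fr.mul {f g : HF} (hf : Fr l f) (hg : Fr l g) : Fr l (f * g) := by
  intro γ h; obtain ⟨a, b, ha, hb, rfl⟩ := mul_supp h
  rw [map_add]; have := hf a ha; have := hg b hb; omega
lemma Ps.mul {f g : HF} (hf : Ps l f) (hg : Nn l g) : Ps l (f * g) := by
  intro γ h; obtain ⟨a, b, ha, hb, rfl⟩ := mul_supp h
  rw [map_add]; have := hf a ha; have := hg b hb; omega
lemma Fr.add {f g : HF} (hf : Fr l f) (hg : Fr l g) : Fr l (f + g) := by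
  intro γ h; rcases add_supp h with h | h
  exacts [hf _ h, hg _ h]
lemma Fr.sub {f g : HF} (hf : Fr l f) (hg : Fr l g) : Fr l (f - g) := by
  intro γ h; rcases sub_supp h with h | h
  exacts [hf _ h, hg _ h]
lemma Nn.sub {f g : HF} (hf : Nn l f) (hg : Nn l g) : Nn l (f - g) := by
  intro γ h; rcases sub_supp h with h | h
  exacts [hf _ h, hg _ h]
lemma fr_one : Fr l (1 : HF) := by
  intro γ h; rw [← xg_zero, xg_coeff] at h
  by_cases h1 : γ = 0
  · simp [h1]
  · simp [h1] at h
lemma fr_intCast (n : ℤ) : Fr l (n : HF) := by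
  induction n with
  | zero => intro γ h; simp at h
  | succ i ih => rw [Int.cast_add, Int.cast_one]; exact ih.add fr_one
  | pred i ih => rw [Int.cast_sub, Int.cast_one]; exact ih.sub fr_one
lemma fr_xg {a : Gm} (h : l a = 0) : Fr l (xg a) := by
  intro γ h1; rw [xg_coeff] at h1
  by_cases h2 : γ = a
  · rw [h2, h]
  · simp [h2] at h1
lemma nn_xg {a : Gm} (h : 0 ≤ l a) : Nn l (xg a) := by
  intro γ h1; rw [xg_coeff] at h1
  by_cases h2 : γ = a
  · rw [h2]; exact h
  · simp [h2] at h1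
lemma nn_inv {a : Gm} (h0 : 0 < a) (h : 0 ≤ l a) : Nn l (1 - xg a)⁻¹ := by
  intro γ h1
  obtain ⟨n, rfl⟩ := inv_supp h0 h1
  rw [map_nsmul]; positivity
lemma fr_inv_pos {a : Gm} (h0 : 0 < a) (h : l a = 0) : Fr l (1 - xg a)⁻¹ := by
  intro γ h1
  obtain ⟨n, rfl⟩ := inv_supp h0 h1
  rw [map_nsmul, h]; simp
lemma one_sub_neg (a : Gm) : 1 - xg a = - xg a * (1 - xg (-a)) := by
  have : xg a * xg (-a) = 1 := by rw [xg_mul, add_neg_cancel, xg_zero]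
  linear_combination -this
lemma neg_aux {F : Type*} [Field F] (u v : F) : (- u * v)⁻¹ = - (u⁻¹ * v⁻¹) := by
  rw [neg_mul, _root_.inv_neg, mul_inv]
lemma inv_one_sub_neg (a : Gm) : (1 - xg a)⁻¹ = - (xg (-a) * (1 - xg (-a))⁻¹) := by
  rw [one_sub_neg a, ← xg_inv]; exact neg_aux _ _
lemma Fr.neg {f : HF} (hf : Fr l f) : Fr l (-f) := by
  have : Fr l (0 - f) := Fr.sub (by intro γ h; simp at h) hf
  simpa using this
lemma fr_inv {a : Gm} (h : l a = 0) : Fr l (1 - xg a)⁻¹ := by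
  rcases lt_trichotomy a 0 with h0 | h0 | h0
  · rw [inv_one_sub_neg]
    exact ((fr_xg (by simp [h])).mul (fr_inv_pos (neg_pos.mpr h0) (by simp [h]))).neg
  · intro γ h1; simp [h0, xg_zero] at h1
  · exact fr_inv_pos h0 h

lemma prj_mul_fr {c f : HF} (hc : Fr l c) : _root_.prj l (c * f) = c * _root_.prj l f := by
  -- write f = prj f + rest
  have h1 : _root_.prj l (c * (f - _root_.prj l f)) = 0 := by
    ext γ; rw [prj_coeff]; split_ifs with h1
    · by_contra h2
      obtain ⟨a, b, ha, hb, rfl⟩ := mul_supp h2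
      rw [HahnSeries.coeff_sub, prj_coeff] at hb
      have h3 : l b = 0 := by have := hc a ha; rw [map_add] at h1; omega
      simp [h3] at hb
    · rfl
  rw [mul_sub, prj_sub, (hc.mul (fr_prj f)).prj] at h1
  exact sub_eq_zero.mp h1

lemma prj_mul_nn {f g : HF} (hf : Nn l f) (hg : Nn l g) :
    _root_.prj l (f * g) = _root_.prj l f * _root_.prj l g := by
  have h1 := (hf.ps_sub.mul hg).prj
  rw [sub_mul, prj_sub, prj_mul_fr (fr_prj f)] at h1
  exact sub_eq_zero.mp h1

lemma prj_inv_pos {a : Gm} (h0 : 0 < a) (h : 0 < l a) : _root_.prj l (1 - xg a)⁻¹ = 1 := by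
  ext γ
  rw [prj_coeff]
  set A := (1 - xg a)⁻¹ with hA
  have hrec : A = 1 + xg a * A := by
    have : (1 - xg a) * A = 1 := mul_inv_cancel₀ (one_sub_xg_ne h0.ne')
    linear_combination this
  split_ifs with h1
  · have h2 : (xg a * A).coeff γ = 0 := by
      by_contra h2
      obtain ⟨u, v, hu, hv, rfl⟩ := mul_supp h2
      have h3 := nn_inv h0 h.le v hv
      rw [xg_coeff] at hu
      by_cases h4 : u = a
      · rw [map_add, h4] at h1; omega
      · simp [h4] at hu
    rw [hrec, HahnSeries.coeff_add, h2, add_zero]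
  · rw [← xg_zero, xg_coeff, if_neg]; rintro rfl; simp at h1

lemma prj_inv_neg {a : Gm} (h0 : 0 < a) (h : l a < 0) : _root_.prj l (1 - xg a)⁻¹ = 1 := by
  rw [← prj_neg_l]; exact prj_inv_pos h0 (by simpa using h)

lemma inv_mul_inv {P Q : Gm} (hP : 0 < P) (hQ : 0 < Q) :
    (1 - xg P)⁻¹ * (1 - xg Q)⁻¹ = (1 - xg (P + Q))⁻¹ * ((1 - xg P)⁻¹ + (1 - xg Q)⁻¹ - 1) := by
  have h1 := one_sub_xg_ne hP.ne'
  have h2 := one_sub_xg_ne hQ.ne'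
  have h3 := one_sub_xg_ne (add_pos hP hQ).ne'
  rw [← xg_mul] at *
  field_simp
  ring

/-- M in, Q out -/
lemma ct1 {M Q : Gm} (hM : 0 < M) (hQ : 0 < Q) (lM : l M = -1) (lQ : l Q = 1) :
    _root_.prj l ((1 - xg M)⁻¹ * (1 - xg Q)⁻¹) = (1 - xg (M + Q))⁻¹ := by
  rw [inv_mul_inv hM hQ, prj_mul_fr (fr_inv (by rw [map_add]; omega)), prj_sub, prj_add,
    prj_inv_pos hQ (by omega), prj_inv_neg hM (by omega), fr_one.prj]
  ring

lemma ct2 {M P : Gm} (hM : 0 < M) (hP : 0 < P) (lM : l M = -1) (lP : l P = -1) :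
    _root_.prj l ((1 - xg M)⁻¹ * (1 - xg P)⁻¹) = 1 := by
  rw [← prj_neg_l, prj_mul_nn (nn_inv hM (by simp [lM])) (nn_inv hP (by simp [lP])),
    prj_inv_pos hM (by simp [lM]), prj_inv_pos hP (by simp [lP]), one_mul]

lemma ct2' {M P : Gm} (hM : 0 < M) (hP : 0 < P) (lM : l M = 1) (lP : l P = 1) :
    _root_.prj l ((1 - xg M)⁻¹ * (1 - xg P)⁻¹) = 1 := by
  rw [prj_mul_nn (nn_inv hM (by simp [lM])) (nn_inv hP (by simp [lP])),
    prj_inv_pos hM (by simp [lM]), prj_inv_pos hP (by simp [lP]), one_mul]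

lemma ct3 {M P Q : Gm} (hM : 0 < M) (hP : 0 < P) (hQ : 0 < Q) (lM : l M = -1) (lP : l P = -1)
    (lQ : l Q = 1) :
    _root_.prj l ((1 - xg M)⁻¹ * ((1 - xg P)⁻¹ * (1 - xg Q)⁻¹)) =
      (1 - xg (P + Q))⁻¹ * (1 - xg (M + Q))⁻¹ := by
  rw [inv_mul_inv hP hQ]
  rw [show ∀ a b c d e : HF, a * (b * (c + d - e)) = b * (a * c + a * d - a * e) by intros; ring,
    prj_mul_fr (fr_inv (by rw [map_add]; omega)), prj_sub, prj_add, ct2 hM hP lM lP,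
    ct1 hM hQ lM lQ, mul_one, prj_inv_neg hM (by omega)]
  ring

lemma ct4 {N P Q : Gm} (hN : 0 < N) (hP : 0 < P) (hQ : 0 < Q) (lN : l N = 1) (lP : l P = -1)
    (lQ : l Q = 1) :
    _root_.prj l ((1 - xg N)⁻¹ * ((1 - xg P)⁻¹ * (1 - xg Q)⁻¹)) =
      (1 - xg (P + Q))⁻¹ * (1 - xg (P + N))⁻¹ := by
  rw [inv_mul_inv hP hQ]
  rw [show ∀ a b c d e : HF, a * (b * (c + d - e)) = b * (c * a + a * d - a * e) by intros; ring,
    prj_mul_fr (fr_inv (by rw [map_add]; omega)), prj_sub, prj_add, ct2' hN hQ lN lQ,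
    ct1 hP hN lP lN, mul_one, prj_inv_pos hN (by omega)]
  ring

lemma xg_mul_inv {N : Gm} (hN : N ≠ 0) : xg N * (1 - xg N)⁻¹ = (1 - xg N)⁻¹ - 1 := by
  have := one_sub_xg_ne hN
  field_simp
  ring

end PartHahn

section PartPF

namespace Mon
def root (k : Fin 3) (M : Mon) : Mon :=
  if M.co k = -1 then M.add (unit k) else (unit k).add M.neg
end Mon

section PF
variable {F : Type*} [Field F] (x : Mon → F)

structure IsX (x : Mon → F) : Prop where
  add : ∀ M N, x (M.add N) = x M * x N
  neg : ∀ M, x M.neg = (x M)⁻¹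
  ne : ∀ M, x M ≠ 0
  smul : ∀ j M, x (Mon.smul j M) = x M ^ j

variable (k : Fin 3)

def evw (w : F) (M : Mon) : F := x M * (w / x (Mon.unit k)) ^ (M.co k)
def kap (M : Mon) (w : F) : F := if M.co k = -1 then w⁻¹ else -(x (M.root k))⁻¹
def pNn (n : Mon) : Polynomial F :=
  if n.co k = -1 then Polynomial.X - Polynomial.C (x n * x (Mon.unit k))
  else if n.co k = 1 then 1 - Polynomial.C (x n * (x (Mon.unit k))⁻¹) * Polynomial.X
  else Polynomial.C (1 - x n)

variable {x} (hx : IsX x)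
include hx

lemma evw_subst (p M : Mon) : x (Mon.subst k p M) = evw x k (x p) M := by
  unfold Mon.subst evw
  rw [hx.add, hx.smul, hx.add, hx.neg, div_eq_mul_inv]

lemma evw_unit (M : Mon) : evw x k (x (Mon.unit k)) M = x M := by
  unfold evw
  rw [div_self (hx.ne _), _root_.one_zpow, mul_one]

lemma fact1 {w : F} (hw : w ≠ 0) {M : Mon} (hM : M.co k = -1 ∨ M.co k = 1) :
    1 - evw x k w M = kap x k M w * (w - x (M.root k)) := by
  have hz := hx.ne (Mon.unit k)
  have hMM := hx.ne M
  unfold evw kap Mon.root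
  rcases hM with h | h
  · simp only [h, if_true]
    rw [hx.add, _root_.zpow_neg_one]
    field_simp
  · have : ¬ ((1 : ℤ) = -1) := by decide
    simp only [h, if_neg this]
    rw [hx.add, hx.neg, zpow_one]
    field_simp
    ring

lemma fact3 {w : F} (hw : w ≠ 0) {n : Mon} (hn : n.co k = 0 ∨ n.co k = 1 ∨ n.co k = -1) :
    1 - evw x k w n = w ^ (if n.co k = -1 then (-1 : ℤ) else 0) * (pNn x k n).eval w := by
  have hz := hx.ne (Mon.unit k)
  unfold evw pNn
  rcases hn with h | h | h
  · simp [h]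
  · simp [h]; field_simp
  · simp [h]; field_simp

omit hx in
lemma natDegree_pNn (n : Mon) : (pNn x k n).natDegree ≤ if n.co k ≠ 0 then 1 else 0 := by
  unfold pNn
  by_cases h : n.co k = -1
  · simp only [h, if_true]
    rw [if_pos (by decide)]
    exact Polynomial.natDegree_X_sub_C_le _
  · by_cases h1 : n.co k = 1
    · rw [if_neg h, if_pos h1, if_pos (by rw [h1]; decide)]
      refine (Polynomial.natDegree_sub_le _ _).trans (max_le (by simp) ?_)
      simpa using Polynomial.natDegree_C_mul_X_pow_le (x n * (x (Mon.unit k))⁻¹) 1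
    · simp [h, h1]

lemma prod_ns {w : F} (hw : w ≠ 0) (ns : List Mon)
    (hn : ∀ n ∈ ns, n.co k = 0 ∨ n.co k = 1 ∨ n.co k = -1) :
    (ns.map fun n => 1 - evw x k w n).prod =
      w ^ (-((ns.filter fun M => M.co k = -1).length : ℤ)) *
        ((ns.map (pNn x k)).prod).eval w := by
  induction ns with
  | nil => simp
  | cons n l ih =>
    rw [List.map_cons, List.prod_cons, ih (fun m hm => hn m (List.mem_cons_of_mem _ hm)),
      fact3 k hx hw (hn n List.mem_cons_self), List.map_cons, List.prod_cons, Polynomial.eval_mul]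
    by_cases h : n.co k = -1
    · rw [List.filter_cons_of_pos (by simpa using h), if_pos h, List.length_cons, Nat.cast_add,
        Nat.cast_one, _root_.neg_add, zpow_add₀ hw]
      ring
    · rw [List.filter_cons_of_neg (by simpa using h), if_neg h, zpow_zero]
      ring

omit hx in
lemma natDegree_ns (ns : List Mon) :
    ((ns.map (pNn x k)).prod).natDegree ≤ (ns.filter fun M => M.co k ≠ 0).length := by
  induction ns with
  | nil => simp
  | cons n l ih =>
    rw [List.map_cons, List.prod_cons]
    refine (Polynomial.natDegree_mul_le).trans ?_
    have := natDegree_pNn (x := x) k n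
    by_cases h : n.co k = 0
    · rw [List.filter_cons_of_neg (by simpa using h)]
      simp [h] at this
      omega
    · rw [List.filter_cons_of_pos (by simpa using h), List.length_cons]
      simp [h] at this
      omega

lemma fact2 {M : Mon} (hM : M.co k = -1 ∨ M.co k = 1) (hR : x (M.root k) ≠ x (Mon.unit k)) :
    x (M.root k) * kap x k M (x (M.root k)) *
      ((if M.co k = -1 then 1 else x M) * (1 - x M)⁻¹) =
    x (Mon.unit k) * (x (Mon.unit k) - x (M.root k))⁻¹ := by
  have hz := hx.ne (Mon.unit k)
  have hMM := hx.ne M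
  have h1 : x (Mon.unit k) - x (M.root k) ≠ 0 := sub_ne_zero.mpr hR.symm
  have h2 : 1 - x M ≠ 0 := by
    have := fact1 k hx hz hM
    rw [evw_unit k hx] at this
    rw [this]
    refine mul_ne_zero ?_ h1
    unfold kap
    split_ifs
    · exact inv_ne_zero hz
    · exact neg_ne_zero.mpr (inv_ne_zero (hx.ne _))
  unfold kap Mon.root at *
  rcases hM with h | h
  · simp only [h, if_true] at *
    rw [hx.add] at *
    field_simp
  · have : ¬ ((1 : ℤ) = -1) := by decide
    simp only [h, if_neg this] at *
    rw [hx.add, hx.neg] at *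
    field_simp at *
    have h3 : x M - 1 ≠ 0 := by intro h; apply h2; linear_combination -h
    field_simp
    ring

lemma pf (s : Finset Mon) (ns : List Mon) (m : Mon)
    (hs : ∀ M ∈ s, M.co k = -1 ∨ M.co k = 1)
    (hn : ∀ n ∈ ns, n.co k = 0 ∨ n.co k = 1 ∨ n.co k = -1)
    (hinj : Set.InjOn (fun M : Mon => x (M.root k)) s)
    (hz : ∀ M ∈ s, x (Mon.unit k) ≠ x (M.root k))
    (e : ℕ)
    (he : (e : ℤ) = m.co k + ((s.filter fun M => M.co k = -1).card : ℤ)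
      - ((ns.filter fun M => M.co k = -1).length : ℤ) - 1)
    (hdeg : e + (ns.filter fun M => M.co k ≠ 0).length < s.card) :
    x m * (ns.map fun n => 1 - x n).prod * (∏ M ∈ s, (1 - x M))⁻¹ =
      ∑ M ∈ s, (x (Mon.subst k (M.root k) m) *
        (ns.map fun n => 1 - x (Mon.subst k (M.root k) n)).prod *
        (∏ M' ∈ s.erase M, (1 - x (Mon.subst k (M.root k) M')))⁻¹) *
        ((if M.co k = -1 then 1 else x M) * (1 - x M)⁻¹) := by
  set z := x (Mon.unit k) with hzdef
  have hz0 : z ≠ 0 := hx.ne _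
  set C0 : F := ∏ M ∈ s, (if M.co k = -1 then 1 else -(x (M.root k))⁻¹) with hC0
  have hC0ne : C0 ≠ 0 := by
    rw [hC0, Finset.prod_ne_zero_iff]
    intro M _
    split_ifs
    · exact one_ne_zero
    · exact neg_ne_zero.mpr (inv_ne_zero (hx.ne _))
  have hkap : ∀ w : F, w ≠ 0 → ∏ M ∈ s, kap x k M w =
      w ^ (-((s.filter fun M => M.co k = -1).card : ℤ)) * C0 := by
    intro w hw
    rw [Finset.card_filter, Nat.cast_sum, ← Finset.sum_neg_distrib, hC0]
    rw [show w ^ (∑ M ∈ s, -(((if M.co k = -1 then 1 else 0 : ℕ)) : ℤ)) =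
      ∏ M ∈ s, w ^ (-(((if M.co k = -1 then 1 else 0 : ℕ)) : ℤ)) by
        clear hs hinj hz he hdeg hC0 hC0ne C0
        induction s using Finset.induction_on with
        | empty => simp
        | insert a s ha ih => rw [Finset.sum_insert ha, Finset.prod_insert ha, zpow_add₀ hw, ih]]
    rw [← Finset.prod_mul_distrib]
    apply Finset.prod_congr rfl
    intro M _
    unfold kap
    split_ifs <;> simp
  set Pol : Polynomial F := Polynomial.C (x m * z ^ (-(m.co k)) * C0⁻¹) * Polynomial.X ^ e *
    (ns.map (pNn x k)).prod with hPol
  have hdegP : Pol.degree < s.card := by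
    refine lt_of_le_of_lt Polynomial.degree_le_natDegree ?_
    have h1 : Pol.natDegree ≤ e + (ns.filter fun M => M.co k ≠ 0).length := by
      rw [hPol]
      refine Polynomial.natDegree_mul_le.trans ?_
      refine Nat.add_le_add ?_ (natDegree_ns k ns)
      exact Polynomial.natDegree_C_mul_X_pow_le _ _
    exact_mod_cast lt_of_le_of_lt h1 hdeg
  have fact4 : ∀ w : F, w ≠ 0 → evw x k w m * (ns.map fun n => 1 - evw x k w n).prod =
      w * Pol.eval w * ∏ M ∈ s, kap x k M w := by
    intro w hw
    rw [prod_ns k hx hw ns hn, hkap w hw, hPol]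
    simp only [Polynomial.eval_mul, Polynomial.eval_C, Polynomial.eval_pow, Polynomial.eval_X]
    unfold evw
    rw [← hzdef, div_zpow, div_eq_mul_inv, ← _root_.zpow_neg]
    have h1 : w ^ (m.co k) * w ^ (-((ns.filter fun M => M.co k = -1).length : ℤ)) =
        w * w ^ e * w ^ (-((s.filter fun M => M.co k = -1).card : ℤ)) := by
      rw [← zpow_natCast, ← zpow_one_add₀ hw, ← zpow_add₀ hw, ← zpow_add₀ hw]
      congr 1
      omega
    have h2 : C0⁻¹ * C0 = 1 := inv_mul_cancel₀ hC0ne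
    linear_combination (x m * z ^ (-(m.co k)) * (Polynomial.eval w (ns.map (pNn x k)).prod)) * h1 -
      (x m * z ^ (-(m.co k)) * (Polynomial.eval w (ns.map (pNn x k)).prod)) * w * w ^ e *
        w ^ (-((s.filter fun M => M.co k = -1).card : ℤ)) * h2
  have hlag := Lagrange.eq_interpolate hinj hdegP
  have hev := congrArg (Polynomial.eval z) hlag
  rw [Lagrange.eval_interpolate_not_at_node _ hz, Lagrange.eval_nodal] at hev
  have hkz : ∏ M ∈ s, kap x k M z ≠ 0 := by
    rw [hkap z hz0]; exact mul_ne_zero (zpow_ne_zero _ hz0) hC0ne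
  have hnod : ∏ M ∈ s, (z - x (M.root k)) ≠ 0 := by
    rw [Finset.prod_ne_zero_iff]; intro M hM; exact sub_ne_zero.mpr (hz M hM)
  have hL : x m * (ns.map fun n => 1 - x n).prod * (∏ M ∈ s, (1 - x M))⁻¹ =
      z * Pol.eval z * (∏ M ∈ s, (z - x (M.root k)))⁻¹ := by
    have h4 := fact4 z hz0
    simp only [hzdef, evw_unit k hx] at h4
    rw [h4]
    have h5 : ∏ M ∈ s, (1 - x M) = (∏ M ∈ s, kap x k M z) * ∏ M ∈ s, (z - x (M.root k)) := by
      rw [← Finset.prod_mul_distrib]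
      apply Finset.prod_congr rfl
      intro M hM
      rw [← fact1 k hx hz0 (hs M hM), evw_unit k hx]
    rw [h5, ← hzdef]
    field_simp
  rw [hL, hev]
  rw [show ∀ S : F, z * ((∏ M ∈ s, (z - x (M.root k))) * S) * (∏ M ∈ s, (z - x (M.root k)))⁻¹ =
    z * S by intro S; field_simp]
  rw [Finset.mul_sum]
  apply Finset.sum_congr rfl
  intro M hM
  set R := x (M.root k) with hR
  have hR0 : R ≠ 0 := hx.ne _
  simp only [evw_subst k hx]
  rw [← hR, fact4 R hR0]
  have h6 : ∏ M' ∈ s.erase M, (1 - evw x k R M') =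
      (∏ M' ∈ s.erase M, kap x k M' R) * ∏ M' ∈ s.erase M, (R - x (M'.root k)) := by
    rw [← Finset.prod_mul_distrib]
    apply Finset.prod_congr rfl
    intro M' hM'
    rw [← fact1 k hx hR0 (hs M' (Finset.mem_of_mem_erase hM'))]
  have h7 : ∏ M' ∈ s.erase M, kap x k M' R ≠ 0 := by
    rw [Finset.prod_ne_zero_iff]
    intro M' _
    unfold kap
    split_ifs
    · exact inv_ne_zero hR0
    · exact neg_ne_zero.mpr (inv_ne_zero (hx.ne _))
  rw [h6, ← Finset.mul_prod_erase s (fun M => kap x k M R) hM, Lagrange.nodalWeight,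
    Finset.prod_inv_distrib]
  have h8 := fact2 k hx (hs M hM) (hz M hM).symm
  rw [← hR, ← hzdef] at h8
  rw [mul_inv]
  have h9 : (∏ M' ∈ s.erase M, kap x k M' R) * (∏ M' ∈ s.erase M, kap x k M' R)⁻¹ = 1 :=
    mul_inv_cancel₀ h7
  set A := (∏ M' ∈ s.erase M, (R - x (M'.root k)))⁻¹
  set B := Pol.eval R
  set D := ∏ M' ∈ s.erase M, kap x k M' R
  set t := (if M.co k = -1 then 1 else x M) * (1 - x M)⁻¹
  linear_combination (-(B * A)) * h8 - (B * A * (R * kap x k M R * t)) * h9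

end PF

end PartPF

section PartVal

namespace Mon
lemma co_add (k : Fin 3) (M N : Mon) : (M.add N).co k = M.co k + N.co k := by
  fin_cases k <;> rfl
lemma co_neg (k : Fin 3) (M : Mon) : M.neg.co k = - M.co k := by
  fin_cases k <;> rfl
lemma co_smul (k : Fin 3) (j : ℤ) (M : Mon) : (smul j M).co k = j * M.co k := by
  fin_cases k <;> rfl
lemma co_unit (k : Fin 3) : (unit k).co k = 1 := by
  fin_cases k <;> rfl
lemma co_subst (k : Fin 3) {M : Mon} (hM : M.co k = -1 ∨ M.co k = 1) (N : Mon) :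
    (subst k (M.root k) N).co k = 0 := by
  unfold subst root
  rw [co_add, co_smul, co_add, co_neg, co_unit]
  split_ifs with h
  · rw [co_add, co_unit, h]; ring
  · rw [co_add, co_unit, co_neg]
    rcases hM with h1 | h1
    · exact absurd h1 h
    · rw [h1]; ring

def g (M : Mon) : Gm := toLex ![M.s, M.t, M.a, M.b, M.c, M.d]

lemma g_add (M N : Mon) : (M.add N).g = M.g + N.g := by
  apply ofLex.injective
  funext i
  fin_cases i <;> rfl
lemma g_neg (M : Mon) : M.neg.g = - M.g := by
  apply ofLex.injective
  funext i
  fin_cases i <;> rfl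
lemma g_smul (j : ℤ) (M : Mon) : (smul j M).g = j • M.g := by
  apply ofLex.injective
  funext i
  fin_cases i <;> exact (smul_eq_mul j _).symm
lemma g_inj {M N : Mon} (h : M.g = N.g) : M = N := by
  have h' := fun i => congrFun (congrArg ofLex h) i
  cases M; cases N
  simp only [g] at h'
  have h0 := h' 0; have h1 := h' 1; have h2 := h' 2; have h3 := h' 3; have h4 := h' 4
  have h5 := h' 5
  simp at h0 h1 h2 h3 h4 h5
  simp [*]
lemma g_pos {M : Mon} (h : M.pos = true) : 0 < M.g := by
  show ∃ i, (∀ j < i, (0 : ℤ) = M.g j) ∧ (0 : ℤ) < M.g i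
  unfold pos at h
  by_cases h0 : M.s = 0
  swap
  · rw [if_pos h0] at h
    exact ⟨0, by simp, by simpa [g] using h⟩
  by_cases h1 : M.t = 0
  swap
  · rw [if_neg (by simpa using h0), if_pos h1] at h
    exact ⟨1, by intro j hj; fin_cases j <;> simp_all [g] , by simpa [g] using h⟩
  by_cases h2 : M.a = 0
  swap
  · rw [if_neg (by simpa using h0), if_neg (by simpa using h1), if_pos h2] at h
    exact ⟨2, by intro j hj; fin_cases j <;> simp_all [g] , by simpa [g] using h⟩
  by_cases h3 : M.b = 0
  swap
  · rw [if_neg (by simpa using h0), if_neg (by simpa using h1), if_neg (by simpa using h2),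
      if_pos h3] at h
    exact ⟨3, by intro j hj; fin_cases j <;> simp_all [g] , by simpa [g] using h⟩
  by_cases h4 : M.c = 0
  swap
  · rw [if_neg (by simpa using h0), if_neg (by simpa using h1), if_neg (by simpa using h2),
      if_neg (by simpa using h3), if_pos h4] at h
    exact ⟨4, by intro j hj; fin_cases j <;> simp_all [g] , by simpa [g] using h⟩
  · rw [if_neg (by simpa using h0), if_neg (by simpa using h1), if_neg (by simpa using h2),
      if_neg (by simpa using h3), if_neg (by simpa using h4)] at h
    exact ⟨5, by intro j hj; fin_cases j <;> simp_all [g] , by simpa [g] using h⟩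
end Mon

def xm (M : Mon) : HF := xg M.g

lemma xg_zsmul (j : ℤ) (γ : Gm) : xg (j • γ) = xg γ ^ j := by
  induction j with
  | zero => simp [xg_zero]
  | succ i ih => rw [add_smul, one_smul, ← xg_mul, ih, zpow_add_one₀ (xg_ne _)]
  | pred i ih =>
    rw [sub_smul, one_smul, sub_eq_add_neg, ← xg_mul, ih, _root_.zpow_sub_one₀ (xg_ne _), xg_inv]

lemma isX : IsX xm where
  add M N := by unfold xm; rw [Mon.g_add, xg_mul]
  neg M := by unfold xm; rw [Mon.g_neg, xg_inv]
  ne M := xg_ne _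
  smul j M := by unfold xm; rw [Mon.g_smul, xg_zsmul]

def idx (k : Fin 3) : Fin 6 := match k with
  | 0 => 2
  | 1 => 3
  | 2 => 4

def crd (i : Fin 6) : Gm →+ ℤ where
  toFun γ := ofLex γ i
  map_zero' := rfl
  map_add' _ _ := rfl

def lc (k : Fin 3) : Gm →+ ℤ := crd (idx k)

lemma lc_g (k : Fin 3) (M : Mon) : lc k M.g = M.co k := by
  fin_cases k <;> rfl

section V
variable {F : Type*} [Field F] (x : Mon → F)

def dpr (l : List Mon) : F := (l.map fun M => 1 - x M).prod

def val (T : Term) : F := (T.c : F) * x T.m * dpr x T.ns * (dpr x T.ds)⁻¹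

variable {x}
lemma dpr_nil : dpr x [] = 1 := rfl
lemma dpr_cons (M : Mon) (l : List Mon) : dpr x (M :: l) = (1 - x M) * dpr x l := by
  simp [dpr]
lemma dpr_append (l l' : List Mon) : dpr x (l ++ l') = dpr x l * dpr x l' := by
  simp [dpr]
lemma dpr_perm {l l' : List Mon} (h : l.Perm l') : dpr x l = dpr x l' :=
  (h.map _).prod_eq

variable (hx : IsX x) (hpos : ∀ M : Mon, M.pos = true → 1 - x M ≠ 0)
include hx

lemma one_sub_neg' (M : Mon) : 1 - x M = - x M * (1 - x M.neg) := by
  rw [hx.neg]; have := hx.ne M; field_simp; ring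

lemma val_addD (M : Mon) (T : Term) : val x (T.addD M) = val x T * (1 - x M)⁻¹ := by
  unfold Term.addD
  split_ifs with h
  · simp only [val, dpr_cons, mul_inv]; ring
  · simp only [val, dpr_cons, mul_inv]
    rw [one_sub_neg' hx M, neg_aux, hx.add, hx.neg]
    push_cast; ring

include hpos
omit hx in
lemma val_addN' (M : Mon) (T : Term) : val x (T.addN' M) = val x T * (1 - x M) := by
  unfold Term.addN'
  split_ifs with h
  · simp only [Bool.and_eq_true, decide_eq_true_eq] at h
    have h1 := hpos M h.1
    simp only [val]
    rw [dpr_perm (List.perm_cons_erase h.2), dpr_cons, mul_inv]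
    field_simp
  · simp only [val, dpr_cons]; ring

lemma val_addN (M : Mon) (T : Term) : val x (T.addN M) = val x T * (1 - x M) := by
  unfold Term.addN
  split_ifs with h
  · exact val_addN' hpos M T
  · rw [val_addN' hpos, one_sub_neg' hx M]
    simp only [val]
    rw [hx.add]; push_cast; ring

lemma val_norm (T : Term) : ((T.norm).map (val x)).sum = val x T := by
  have hx0 : x Mon.zero = 1 := by
    have h1 := hx.add Mon.zero Mon.zero
    have h2 : Mon.zero.add Mon.zero = Mon.zero := rfl
    rw [h2] at h1
    exact (mul_eq_left₀ (hx.ne _)).mp h1.symm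
  have hD : ∀ (l : List Mon) (T : Term), val x (l.foldr Term.addD T) = val x T * (dpr x l)⁻¹ := by
    intro l T
    induction l with
    | nil => simp [dpr_nil]
    | cons M l ih => rw [List.foldr_cons, val_addD hx, ih, dpr_cons, mul_inv]; ring
  have hN : ∀ (l : List Mon) (T : Term), val x (l.foldr Term.addN T) = val x T * (dpr x l) := by
    intro l T
    induction l with
    | nil => simp [dpr_nil]
    | cons M l ih => rw [List.foldr_cons, val_addN hx hpos, ih, dpr_cons]; ring
  unfold Term.norm
  split_ifs with h
  · have : dpr x T.ns = 0 := by
      rw [dpr_perm (List.perm_cons_erase h), dpr_cons, hx0]; ring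
    simp [val, this]
  · simp only [List.map_cons, List.map_nil, List.sum_cons, List.sum_nil, add_zero]
    rw [hN, hD]
    simp only [val, dpr_nil]
    ring
end V

lemma splitDup_spec (l : List Mon) : (Term.splitDup l).1.Nodup ∧
    l.Perm ((Term.splitDup l).1 ++ (Term.splitDup l).2) := by
  induction l with
  | nil => simp [Term.splitDup]
  | cons M l ih =>
    obtain ⟨h1, h2⟩ := ih
    simp only [Term.splitDup]
    split_ifs with h
    · exact ⟨h1, (List.Perm.cons M h2).trans List.perm_middle.symm⟩
    · exact ⟨List.nodup_cons.mpr ⟨h, h1⟩, by simpa using h2⟩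

lemma hposX (M : Mon) (h : M.pos = true) : 1 - xm M ≠ 0 := one_sub_xg_ne (Mon.g_pos h).ne'

end PartVal

section PartStep

lemma xm_g (M : Mon) : xm M = xg M.g := rfl

lemma subst_in (k : Fin 3) {M Q : Mon} (hM : M.co k = -1) (hQ : Q.co k = 1) :
    xm (Mon.subst k (M.root k) Q) = xg (M.g + Q.g) := by
  unfold Mon.root Mon.subst
  rw [if_pos hM, hQ, isX.add, isX.smul, isX.add, isX.add, isX.neg, ← xg_mul, zpow_one, ← xm_g,
    ← xm_g]
  have := isX.ne (Mon.unit k)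
  field_simp

lemma subst_out (k : Fin 3) {M P : Mon} (hM : M.co k = 1) (hP : P.co k = -1) :
    xm (Mon.subst k (M.root k) P) = xg (P.g + M.g) := by
  unfold Mon.root Mon.subst
  rw [if_neg (by rw [hM]; decide), hP, isX.add, isX.smul, isX.add, isX.add, isX.neg, ← xg_mul,
    _root_.zpow_neg_one, ← xm_g, ← xm_g, isX.neg]
  have := isX.ne (Mon.unit k)
  have := isX.ne M
  field_simp

def Case4 (A B ab : List Mon) : Prop :=
  (A = [] ∧ B = [] ∧ ab = []) ∨ (∃ P, A = [P] ∧ B = [] ∧ ab = []) ∨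
  (∃ Q, A = [] ∧ B = [Q] ∧ ab = []) ∨ (∃ P Q, A = [P] ∧ B = [Q] ∧ ab = [P.add Q])

lemma dpr_one (M : Mon) : dpr xm [M] = 1 - xg M.g := by
  rw [dpr_cons, dpr_nil, mul_one]; rfl

lemma ctIn (k : Fin 3) {A B ab : List Mon} (h4 : Case4 A B ab)
    (hA : ∀ P ∈ A, P.pos = true ∧ P.co k = -1) (hB : ∀ Q ∈ B, Q.pos = true ∧ Q.co k = 1)
    {M : Mon} (hM : M.pos = true) (cM : M.co k = -1) :
    prj (lc k) ((1 - xg M.g)⁻¹ * ((dpr xm A)⁻¹ * (dpr xm B)⁻¹)) =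
      (dpr xm (B.map (Mon.subst k (M.root k))))⁻¹ * (dpr xm ab)⁻¹ := by
  have gM := Mon.g_pos hM
  have lM := (lc_g k M).trans cM
  rcases h4 with ⟨rfl, rfl, rfl⟩ | ⟨P, rfl, rfl, rfl⟩ | ⟨Q, rfl, rfl, rfl⟩ | ⟨P, Q, rfl, rfl, rfl⟩
  · simp only [List.map_nil, dpr_nil, inv_one, mul_one]
    exact prj_inv_neg gM (by rw [lM]; decide)
  · simp only [List.map_nil, dpr_nil, inv_one, mul_one, dpr_one]
    obtain ⟨h1, h2⟩ := hA P (by simp)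
    exact ct2 gM (Mon.g_pos h1) lM ((lc_g k P).trans h2)
  · obtain ⟨h1, h2⟩ := hB Q (by simp)
    simp only [List.map_nil, dpr_nil, inv_one, mul_one, one_mul, dpr_one, List.map_cons]
    rw [← xm_g (Mon.subst _ _ _), subst_in k cM h2]
    exact ct1 gM (Mon.g_pos h1) lM ((lc_g k Q).trans h2)
  · obtain ⟨h1, h2⟩ := hB Q (by simp)
    obtain ⟨h3, h4⟩ := hA P (by simp)
    simp only [List.map_nil, dpr_one, List.map_cons]
    rw [← xm_g (Mon.subst _ _ _), subst_in k cM h2, Mon.g_add]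
    rw [ct3 gM (Mon.g_pos h3) (Mon.g_pos h1) lM ((lc_g k P).trans h4) ((lc_g k Q).trans h2)]
    ring

def outF (k : Fin 3) (A ab : List Mon) (M : Mon) : HF := match A with
  | [] => 0
  | P :: _ => xm (P.add M) * ((dpr xm (A.map (Mon.subst k (M.root k))))⁻¹ * (dpr xm ab)⁻¹)

lemma ctOut (k : Fin 3) {A B ab : List Mon} (h4 : Case4 A B ab)
    (hA : ∀ P ∈ A, P.pos = true ∧ P.co k = -1) (hB : ∀ Q ∈ B, Q.pos = true ∧ Q.co k = 1)
    {M : Mon} (hM : M.pos = true) (cM : M.co k = 1) :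
    prj (lc k) ((xg M.g * (1 - xg M.g)⁻¹) * ((dpr xm A)⁻¹ * (dpr xm B)⁻¹)) =
      outF k A ab M := by
  have gM := Mon.g_pos hM
  have lM := (lc_g k M).trans cM
  rw [xg_mul_inv gM.ne', sub_mul, prj_sub, one_mul]
  rcases h4 with ⟨rfl, rfl, rfl⟩ | ⟨P, rfl, rfl, rfl⟩ | ⟨Q, rfl, rfl, rfl⟩ | ⟨P, Q, rfl, rfl, rfl⟩
  · simp only [dpr_nil, inv_one, mul_one, outF]
    rw [prj_inv_pos gM (by rw [lM]; decide), fr_one.prj, sub_self]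
  · obtain ⟨h1, h2⟩ := hA P (by simp)
    have gP := Mon.g_pos h1
    simp only [List.map_nil, dpr_nil, inv_one, mul_one, dpr_one, outF, List.map_cons]
    rw [← xm_g (Mon.subst _ _ _), subst_out k cM h2, mul_comm,
      ct1 gP gM ((lc_g k P).trans h2) lM, prj_inv_neg gP (by rw [lc_g k P, h2]; decide),
      ← xg_mul_inv (add_pos gP gM).ne', xm_g, Mon.g_add]
  · obtain ⟨h1, h2⟩ := hB Q (by simp)
    have gQ := Mon.g_pos h1
    simp only [dpr_nil, inv_one, one_mul, dpr_one, outF]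
    rw [ct2' gM gQ lM ((lc_g k Q).trans h2), prj_inv_pos gQ (by rw [lc_g k Q, h2]; decide),
      sub_self]
  · obtain ⟨h1, h2⟩ := hB Q (by simp)
    obtain ⟨h3, h4⟩ := hA P (by simp)
    have gQ := Mon.g_pos h1
    have gP := Mon.g_pos h3
    simp only [List.map_nil, dpr_one, List.map_cons, outF]
    rw [← xm_g (Mon.subst _ _ _), subst_out k cM h4,
      ct4 gM gP gQ lM ((lc_g k P).trans h4) ((lc_g k Q).trans h2),
      ct1 gP gQ ((lc_g k P).trans h4) ((lc_g k Q).trans h2), xm_g, Mon.g_add, Mon.g_add]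
    have := xg_mul_inv (add_pos gP gM).ne'
    rw [← mul_assoc, this]; ring

lemma sum_flatMap' (f : Mon → List Term) (l : List Mon) :
    ((l.flatMap f).map (val xm)).sum = (l.map fun M => ((f M).map (val xm)).sum).sum := by
  induction l with
  | nil => simp
  | cons a l ih => simp [List.flatMap_cons, ih]

lemma prj_finset_sum {ι : Type*} (l : Gm →+ ℤ) (s : Finset ι) (f : ι → HF) :
    prj l (∑ i ∈ s, f i) = ∑ i ∈ s, prj l (f i) := by
  classical
  induction s using Finset.induction_on with
  | empty => simp [prj_zero]
  | insert a s ha ih => rw [Finset.sum_insert ha, Finset.sum_insert ha, prj_add, ih]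

lemma fr_dpr (k : Fin 3) (l : List Mon) (h : ∀ M ∈ l, M.co k = 0) :
    Fr (lc k) (dpr xm l) ∧ Fr (lc k) (dpr xm l)⁻¹ := by
  induction l with
  | nil => simp [dpr_nil, fr_one]
  | cons a l ih =>
    obtain ⟨h1, h2⟩ := ih (fun M hM => h M (List.mem_cons_of_mem _ hM))
    have h3 : lc k a.g = 0 := (lc_g k a).trans (h a (by simp))
    rw [dpr_cons, mul_inv]
    exact ⟨(fr_one.sub (fr_xg h3)).mul h1, (fr_inv h3).mul h2⟩

lemma dpr_erase_toFinset {h : List Mon} (hnd : h.Nodup) (M : Mon) (f : Mon → Mon) :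
    ∏ M' ∈ h.toFinset.erase M, (1 - xm (f M')) = dpr xm ((h.erase M).map f) := by
  have : h.toFinset.erase M = (h.erase M).toFinset := by
    ext a; simp [hnd.mem_erase_iff]
  rw [this, List.prod_toFinset _ (hnd.erase M), dpr, List.map_map]
  rfl

lemma outs_correct (k : Fin 3) (T : Term) (base h A B ab : List Mon)
    (hbase : ∀ M ∈ base, M.co k = 0) (hnd : h.Nodup)
    (hh : ∀ M ∈ h, M.pos = true ∧ (M.co k = -1 ∨ M.co k = 1))
    (hA : ∀ P ∈ A, P.pos = true ∧ P.co k = -1) (hB : ∀ Q ∈ B, Q.pos = true ∧ Q.co k = 1)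
    (hns : ∀ n ∈ T.ns, n.co k = 0 ∨ n.co k = 1 ∨ n.co k = -1)
    (h4 : Case4 A B ab)
    (hds : T.ds.Perm (base ++ (h ++ (A ++ B))))
    (he : 0 ≤ Term.expA k T h ∧
      Term.expA k T h + ((T.ns.filter fun M => M.co k ≠ 0).length : ℤ) < (h.length : ℤ)) :
    prj (lc k) (val xm T) = ((Term.outs k T base h A B ab).map (val xm)).sum := by
  have hroot_inj : ∀ M ∈ h, ∀ N ∈ h, xm (M.root k) = xm (N.root k) → M = N := by
    intro M hM N hN e
    obtain ⟨pM, cM⟩ := hh M hM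
    obtain ⟨pN, cN⟩ := hh N hN
    have e' := xg_inj e
    have gM := Mon.g_pos pM
    have gN := Mon.g_pos pN
    unfold Mon.root at e'
    split_ifs at e' with h1 h2 h2
    · rw [Mon.g_add, Mon.g_add] at e'
      exact Mon.g_inj (add_right_cancel e')
    · rw [Mon.g_add, Mon.g_add, Mon.g_neg, add_comm] at e'
      have := add_left_cancel e'
      rw [this] at gM
      exact absurd gN (not_lt.mpr (neg_pos.mp gM).le)
    · rw [Mon.g_add, Mon.g_add, Mon.g_neg, add_comm _ (Mon.unit k).g] at e'
      have := add_left_cancel e'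
      rw [← this] at gN
      exact absurd gM (not_lt.mpr (neg_pos.mp gN).le)
    · rw [Mon.g_add, Mon.g_add, Mon.g_neg, Mon.g_neg] at e'
      exact Mon.g_inj (neg_injective (add_left_cancel e'))
  have hroot_ne : ∀ M ∈ h, xm (Mon.unit k) ≠ xm (M.root k) := by
    intro M hM e
    obtain ⟨pM, cM⟩ := hh M hM
    have e' := xg_inj e
    have gM := Mon.g_pos pM
    unfold Mon.root at e'
    split_ifs at e' with h1
    · rw [Mon.g_add] at e'
      exact gM.ne' (by simpa using e')
    · rw [Mon.g_add, Mon.g_neg] at e'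
      exact gM.ne' (by simpa using e')
  obtain ⟨he0, he1⟩ := he
  obtain ⟨e, hee⟩ := Int.eq_ofNat_of_zero_le he0
  have hcard : ((h.toFinset.filter fun M => M.co k = -1).card : ℤ) =
      ((h.filter fun M => M.co k = -1).length : ℤ) := by
    rw [← List.toFinset_card_of_nodup (hnd.filter _), List.toFinset_filter]
    simp
  have hpf := pf k isX h.toFinset T.ns T.m (fun M hM => (hh M (by simpa using hM)).2) hns
    (fun M hM N hN e => hroot_inj M (by simpa using hM) N (by simpa using hN) e)
    (fun M hM => hroot_ne M (by simpa using hM)) e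
    (by rw [hcard, ← hee]; rfl)
    (by
      rw [List.toFinset_card_of_nodup hnd]
      have := he1; rw [hee] at this; exact_mod_cast this)
  have hv : val xm T = ∑ M ∈ h.toFinset, ((T.c : HF) * (dpr xm base)⁻¹ *
      (xm (Mon.subst k (M.root k) T.m) * dpr xm (T.ns.map (Mon.subst k (M.root k))) *
        (dpr xm ((h.erase M).map (Mon.subst k (M.root k))))⁻¹)) *
      (((if M.co k = -1 then 1 else xm M) * (1 - xm M)⁻¹) * ((dpr xm A)⁻¹ * (dpr xm B)⁻¹)) := by
    rw [val, dpr_perm hds]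
    simp only [dpr_append, mul_inv]
    have h5 : (dpr xm h)⁻¹ = (∏ M ∈ h.toFinset, (1 - xm M))⁻¹ := by
      rw [List.prod_toFinset _ hnd, dpr]
    rw [h5]
    have h6 : dpr xm T.ns = (T.ns.map fun n => 1 - xm n).prod := rfl
    rw [h6]
    rw [show ∀ a b c d e f g : HF, a * b * c * (d * (e * (f * g))) = (b * c * e) * (a * d * (f * g)) by
      intros; ring, hpf, Finset.sum_mul]
    apply Finset.sum_congr rfl
    intro M hM
    rw [dpr_erase_toFinset hnd]
    simp only [dpr, List.map_map]
    rw [show ((fun M => 1 - xm M) ∘ Mon.subst k (M.root k)) =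
      (fun n => 1 - xm (Mon.subst k (M.root k) n)) from rfl]
    ring
  rw [hv, prj_finset_sum, Term.outs, sum_flatMap', ← List.sum_toFinset _ hnd]
  apply Finset.sum_congr rfl
  intro M hM
  have hMh : M ∈ h := by simpa using hM
  obtain ⟨pM, cM⟩ := hh M hMh
  have hfr : Fr (lc k) ((T.c : HF) * (dpr xm base)⁻¹ *
      (xm (Mon.subst k (M.root k) T.m) * dpr xm (T.ns.map (Mon.subst k (M.root k))) *
        (dpr xm ((h.erase M).map (Mon.subst k (M.root k))))⁻¹)) := by
    have hs : ∀ l : List Mon, ∀ N ∈ l.map (Mon.subst k (M.root k)), N.co k = 0 := by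
      intro l N hN
      obtain ⟨N', _, rfl⟩ := List.mem_map.mp hN
      exact Mon.co_subst k cM N'
    refine ((fr_intCast _).mul (fr_dpr k base hbase).2).mul (((?_ : Fr (lc k) _).mul
      (fr_dpr k _ (hs _)).1).mul (fr_dpr k _ (hs _)).2)
    exact fr_xg ((lc_g k _).trans (Mon.co_subst k cM _))
  rw [prj_mul_fr hfr]
  by_cases hin : M.co k = -1
  · have hr : M.root k = M.add (Mon.unit k) := by unfold Mon.root; rw [if_pos hin]
    simp only [if_pos hin, one_mul]
    rw [← hr, val_norm isX hposX, val]
    simp only [dpr_append, List.map_append, mul_inv]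
    have := ctIn k h4 hA hB pM hin
    rw [xm_g M, this]
    ring
  · have hr : M.root k = (Mon.unit k).add M.neg := by unfold Mon.root; rw [if_neg hin]
    have hout : M.co k = 1 := cM.resolve_left hin
    simp only [if_neg hin]
    rw [xm_g M, ctOut k h4 hA hB pM hout]
    cases A with
    | nil => simp [outF]
    | cons P l =>
      simp only [outF]
      rw [← hr, val_norm isX hposX, val]
      simp only [dpr_append, List.map_append, mul_inv, isX.add]
      ring

theorem step_correct (k : Fin 3) (T : Term) (L : List Term) (hL : T.step k = some L) :
    prj (lc k) (val xm T) = (L.map (val xm)).sum := by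
  unfold Term.step at hL
  split_ifs at hL with hall
  simp only [Bool.and_eq_true, List.all_eq_true, Bool.or_eq_true, decide_eq_true_eq] at hall
  obtain ⟨hds, hns⟩ := hall
  obtain ⟨s1, s2⟩ := splitDup_spec (T.ds.filter fun M => M.co k ≠ 0)
  set sd := Term.splitDup (T.ds.filter fun M => M.co k ≠ 0) with hsd
  obtain ⟨h, ex⟩ := sd
  simp only at hL s1 s2
  have hmem : ∀ M ∈ h ++ ex, M.pos = true ∧ (M.co k = -1 ∨ M.co k = 1) := by
    intro M hM
    have h1 := s2.mem_iff.mpr hM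
    rw [List.mem_filter] at h1
    obtain ⟨h2, h3⟩ := h1
    have h3' : M.co k ≠ 0 := by simpa using h3
    rcases hds M h2 with h4 | ⟨h4, h5⟩
    · exact absurd h4 h3'
    · exact ⟨h4, h5.symm⟩
  have hperm : T.ds.Perm ((T.ds.filter fun M => M.co k = 0) ++ (h ++
      ((ex.filter fun M => M.co k = -1) ++ (ex.filter fun M => M.co k ≠ -1)))) := by
    have p1 : T.ds.Perm ((T.ds.filter fun M => M.co k = 0) ++ (T.ds.filter fun M => M.co k ≠ 0)) := by
      have := (List.filter_append_perm (fun M => decide (M.co k = 0)) T.ds).symm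
      simpa using this
    have p2 : ex.Perm ((ex.filter fun M => M.co k = -1) ++ (ex.filter fun M => M.co k ≠ -1)) := by
      have := (List.filter_append_perm (fun M => decide (M.co k = -1)) ex).symm
      simpa using this
    exact p1.trans ((s2.trans (p2.append_left h)).append_left _)
  have hA : ∀ P ∈ ex.filter (fun M => M.co k = -1), P.pos = true ∧ P.co k = -1 := by
    intro P hP
    rw [List.mem_filter] at hP
    exact ⟨(hmem P (List.mem_append_right _ hP.1)).1, by simpa using hP.2⟩
  have hB : ∀ P ∈ ex.filter (fun M => M.co k ≠ -1), P.pos = true ∧ P.co k = 1 := by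
    intro P hP
    rw [List.mem_filter] at hP
    have h1 := hmem P (List.mem_append_right _ hP.1)
    exact ⟨h1.1, h1.2.resolve_left (by simpa using hP.2)⟩
  have hbase : ∀ M ∈ T.ds.filter (fun M => M.co k = 0), M.co k = 0 := by
    intro M hM
    rw [List.mem_filter] at hM
    simpa using hM.2
  have hns' : ∀ n ∈ T.ns, n.co k = 0 ∨ n.co k = 1 ∨ n.co k = -1 := by
    intro n hn
    have := hns n hn
    tauto
  generalize ex.filter (fun M => M.co k = -1) = A at *
  generalize ex.filter (fun M => M.co k ≠ -1) = B at *
  generalize T.ds.filter (fun M => M.co k = 0) = base at *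
  unfold Term.step' at hL
  split_ifs at hL with he
  have key : ∀ ab, Case4 A B ab → prj (lc k) (val xm T) =
      ((Term.outs k T base h A B ab).map (val xm)).sum := fun ab h4 =>
    outs_correct k T base h A B ab hbase s1
      (fun M hM => hmem M (List.mem_append_left _ hM)) hA hB hns' h4 hperm he
  split at hL
  · rw [← Option.some_inj.mp hL]; exact key _ (Or.inl ⟨rfl, rfl, rfl⟩)
  · rw [← Option.some_inj.mp hL]; exact key _ (Or.inr (Or.inl ⟨_, rfl, rfl, rfl⟩))
  · rw [← Option.some_inj.mp hL]; exact key _ (Or.inr (Or.inr (Or.inl ⟨_, rfl, rfl, rfl⟩)))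
  · rw [← Option.some_inj.mp hL]; exact key _ (Or.inr (Or.inr (Or.inr ⟨_, _, rfl, rfl, rfl⟩)))
  · exact absurd hL (by simp)

theorem stepL_correct (k : Fin 3) (l L : List Term) (hL : Term.stepL k l = some L) :
    prj (lc k) (l.map (val xm)).sum = (L.map (val xm)).sum := by
  induction l generalizing L with
  | nil =>
    simp only [Term.stepL, Option.some_inj] at hL
    subst hL; simp [prj_zero]
  | cons T l ih =>
    simp only [Term.stepL] at hL
    split at hL
    · rename_i a b ha hb
      rw [← Option.some_inj.mp hL]
      simp only [List.map_cons, List.sum_cons, List.map_append, List.sum_append]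
      rw [prj_add, step_correct k T a ha, ih b hb]
    · exact absurd hL (by simp)

theorem runAll_correct (L : List Term) (hL : Term.runAll = some L) :
    prj (lc 2) (prj (lc 1) (prj (lc 0) (val xm Term.start))) = (L.map (val xm)).sum := by
  unfold Term.runAll at hL
  simp only at hL
  split at hL
  · exact absurd hL (by simp)
  · rename_i l0 h0
    split at hL
    · exact absurd hL (by simp)
    · rename_i l1 h1
      rw [← val_norm isX hposX Term.start, stepL_correct 0 _ _ h0, stepL_correct 1 _ _ h1,
        stepL_correct 2 _ _ hL]

end PartStep

section PartKron

structure PT where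
  c : ℤ
  i : ℕ
  j : ℕ
  fs : List (ℕ × ℕ × ℕ × ℕ)

namespace PT

def ev {R : Type*} [CommRing R] (s t : R) (P : PT) : R :=
  (P.c : R) * (s ^ P.i * t ^ P.j) *
    (P.fs.map fun f => s ^ f.1 * t ^ f.2.1 - s ^ f.2.2.1 * t ^ f.2.2.2).prod

def degS (P : PT) : ℕ := P.i + (P.fs.map fun f => max f.1 f.2.2.1).sum
def bnd (P : PT) : ℕ := P.c.natAbs * 2 ^ P.fs.length

def evN (w d : ℕ) (P : PT) : ℕ × ℕ :=
  P.fs.foldl (fun acc f =>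
    (Nat.shiftLeft acc.1 (w * (f.1 + d * f.2.1)) + Nat.shiftLeft acc.2 (w * (f.2.2.1 + d * f.2.2.2)),
     Nat.shiftLeft acc.2 (w * (f.1 + d * f.2.1)) + Nat.shiftLeft acc.1 (w * (f.2.2.1 + d * f.2.2.2))))
    (Nat.shiftLeft P.c.toNat (w * (P.i + d * P.j)), Nat.shiftLeft (-P.c).toNat (w * (P.i + d * P.j)))

def sumN (w d : ℕ) : List PT → ℕ × ℕ
  | [] => (0, 0)
  | P :: l => ((evN w d P).1 + (sumN w d l).1, (evN w d P).2 + (sumN w d l).2)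

def kron (w d : ℕ) (l : List PT) : Bool :=
  (l.all fun P => Nat.blt P.degS d) && Nat.blt (l.map bnd).sum (2 ^ w) &&
    (match sumN w d l with | (a, b) => Nat.beq a b)

lemma evN_eq (w d : ℕ) (P : PT) :
    (((evN w d P).1 : ℤ) - ((evN w d P).2 : ℤ)) =
      ev ((2 : ℤ) ^ w) (((2 : ℤ) ^ w) ^ d) P := by
  obtain ⟨c, i, j, fs⟩ := P
  have key : ∀ (fs : List (ℕ × ℕ × ℕ × ℕ)) (p : ℕ × ℕ),
      (((fs.foldl (fun acc f =>
    (Nat.shiftLeft acc.1 (w * (f.1 + d * f.2.1)) + Nat.shiftLeft acc.2 (w * (f.2.2.1 + d * f.2.2.2)),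
     Nat.shiftLeft acc.2 (w * (f.1 + d * f.2.1)) + Nat.shiftLeft acc.1 (w * (f.2.2.1 + d * f.2.2.2))))
    p : ℕ × ℕ).1 : ℤ) - ((fs.foldl (fun acc f =>
    (Nat.shiftLeft acc.1 (w * (f.1 + d * f.2.1)) + Nat.shiftLeft acc.2 (w * (f.2.2.1 + d * f.2.2.2)),
     Nat.shiftLeft acc.2 (w * (f.1 + d * f.2.1)) + Nat.shiftLeft acc.1 (w * (f.2.2.1 + d * f.2.2.2))))
    p : ℕ × ℕ).2 : ℤ)) = ((p.1 : ℤ) - p.2) *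
      (fs.map fun f => ((2 : ℤ) ^ w) ^ f.1 * (((2 : ℤ) ^ w) ^ d) ^ f.2.1 -
        ((2 : ℤ) ^ w) ^ f.2.2.1 * (((2 : ℤ) ^ w) ^ d) ^ f.2.2.2).prod := by
    intro fs
    induction fs with
    | nil => intro p; simp
    | cons f l ih =>
      intro p
      rw [List.foldl_cons, ih, List.map_cons, List.prod_cons]
      have h : ∀ a u, Nat.shiftLeft a u = a * 2 ^ u := fun a u => Nat.shiftLeft_eq a u
      simp only [h]
      push_cast
      simp only [← pow_mul, ← pow_add]
      ring
  unfold evN ev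
  rw [key]
  have h : ∀ a u, Nat.shiftLeft a u = a * 2 ^ u := fun a u => Nat.shiftLeft_eq a u
  simp only [h]
  congr 1
  push_cast
  rw [← sub_mul]
  congr 1
  · have := Int.toNat_sub_toNat_neg c
    exact_mod_cast this
  · simp only [← pow_mul, ← pow_add]; congr 1; ring

lemma sumN_eq (w d : ℕ) (l : List PT) :
    (((sumN w d l).1 : ℤ) - ((sumN w d l).2 : ℤ)) =
      (l.map (ev ((2 : ℤ) ^ w) (((2 : ℤ) ^ w) ^ d))).sum := by
  induction l with
  | nil => simp [sumN]
  | cons P l ih =>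
    rw [List.map_cons, List.sum_cons, ← ih, ← evN_eq]
    simp only [sumN]; push_cast; ring

lemma poly_zero {R : Type*} [CommRing R] [IsDomain R] (b : R) (hb : b ≠ 0) (p : Polynomial R)
    (h0 : p.eval b = 0) (hc : ∀ n, b ∣ p.coeff n → p.coeff n = 0) : p = 0 := by
  have : ∀ (N : ℕ) (p : Polynomial R), p.natDegree ≤ N → p.eval b = 0 →
      (∀ n, b ∣ p.coeff n → p.coeff n = 0) → p = 0 := by
    intro N
    induction N with
    | zero =>
      intro p hp h0 hc
      rw [Polynomial.eq_C_of_natDegree_le_zero hp] at h0 ⊢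
      simpa using h0
    | succ N ih =>
      intro p hp h0 hc
      have h1 := Polynomial.divX_mul_X_add p
      have h2 : p.divX.eval b * b + p.coeff 0 = 0 := by
        have := congrArg (Polynomial.eval b) h1
        simpa [h0] using this
      have h3 : p.coeff 0 = 0 := hc 0 ⟨-(p.divX.eval b), by linear_combination h2⟩
      rw [h3, add_zero] at h2
      have h4 : p.divX.eval b = 0 := (mul_eq_zero.mp h2).resolve_right hb
      have h5 : p.divX = 0 := by
        apply ih _ _ h4
        · intro n hn
          rw [Polynomial.coeff_divX] at hn ⊢
          exact hc _ hn
        · rw [Polynomial.natDegree_divX_eq_natDegree_tsub_one]; omega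
      rw [← h1, h5, h3]; simp
  exact this _ p le_rfl h0 hc

open scoped Polynomial in
lemma bound1 (d : ℕ) (P : PT) (n : ℕ) :
    |(ev (Polynomial.X : ℤ[X]) (Polynomial.X ^ d) P).coeff n| ≤ (P.bnd : ℤ) := by
  obtain ⟨c, i, j, fs⟩ := P
  induction fs generalizing n with
  | nil =>
    simp only [ev, bnd, List.map_nil, List.prod_nil, mul_one, List.length_nil, pow_zero]
    rw [← pow_mul, ← pow_add, ← Polynomial.C_eq_intCast, Polynomial.coeff_C_mul_X_pow]
    split_ifs <;> simp
  | cons f l ih =>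
    have e : ev (Polynomial.X : ℤ[X]) (Polynomial.X ^ d) ⟨c, i, j, f :: l⟩ =
      ev (Polynomial.X : ℤ[X]) (Polynomial.X ^ d) ⟨c, i, j, l⟩ * Polynomial.X ^ (f.1 + d * f.2.1) -
      ev (Polynomial.X : ℤ[X]) (Polynomial.X ^ d) ⟨c, i, j, l⟩ * Polynomial.X ^ (f.2.2.1 + d * f.2.2.2) := by
      simp only [ev, List.map_cons, List.prod_cons]
      rw [pow_add, pow_mul, pow_add, pow_mul]; ring
    rw [e, Polynomial.coeff_sub, Polynomial.coeff_mul_X_pow', Polynomial.coeff_mul_X_pow']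
    have hb : (bnd ⟨c, i, j, f :: l⟩ : ℤ) = 2 * (bnd ⟨c, i, j, l⟩ : ℤ) := by
      simp only [bnd, List.length_cons, pow_succ]; push_cast; ring
    rw [hb]
    have h0 : (0 : ℤ) ≤ (bnd ⟨c, i, j, l⟩ : ℤ) := by positivity
    have h1 := ih (n - (f.1 + d * f.2.1))
    have h2 := ih (n - (f.2.2.1 + d * f.2.2.2))
    rw [abs_le] at *
    split_ifs <;> constructor <;> linarith

open scoped Polynomial in
lemma bound2 (P : PT) (n : ℕ) :
    ((ev (Polynomial.C Polynomial.X : ℤ[X][X]) Polynomial.X P).coeff n).natDegree ≤ P.degS := by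
  obtain ⟨c, i, j, fs⟩ := P
  induction fs generalizing n with
  | nil =>
    simp only [ev, degS, List.map_nil, List.prod_nil, mul_one, List.sum_nil, add_zero]
    rw [← mul_assoc, ← Polynomial.C_eq_intCast, ← Polynomial.C_pow, ← Polynomial.C_mul, Polynomial.coeff_C_mul_X_pow]
    split_ifs
    · have := Polynomial.natDegree_C_mul_X_pow_le c i
      simpa using this
    · simp
  | cons f l ih =>
    have e : ev (Polynomial.C Polynomial.X : ℤ[X][X]) Polynomial.X ⟨c, i, j, f :: l⟩ =
      Polynomial.C (Polynomial.X ^ f.1) * (ev (Polynomial.C Polynomial.X : ℤ[X][X]) Polynomial.X ⟨c, i, j, l⟩ * Polynomial.X ^ f.2.1) -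
      Polynomial.C (Polynomial.X ^ f.2.2.1) * (ev (Polynomial.C Polynomial.X : ℤ[X][X]) Polynomial.X ⟨c, i, j, l⟩ * Polynomial.X ^ f.2.2.2) := by
      simp only [ev, List.map_cons, List.prod_cons, Polynomial.C_pow]
      ring
    rw [e, Polynomial.coeff_sub, Polynomial.coeff_C_mul, Polynomial.coeff_C_mul,
      Polynomial.coeff_mul_X_pow', Polynomial.coeff_mul_X_pow']
    have hb : degS ⟨c, i, j, f :: l⟩ = max f.1 f.2.2.1 + degS ⟨c, i, j, l⟩ := by
      simp only [degS, List.map_cons, List.sum_cons]; ring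
    rw [hb]
    have key : ∀ (a b m : ℕ), (Polynomial.X ^ a * (if b ≤ m then (ev (Polynomial.C Polynomial.X : ℤ[X][X]) Polynomial.X ⟨c, i, j, l⟩).coeff (m - b)
        else 0)).natDegree ≤ a + degS ⟨c, i, j, l⟩ := by
      intro a b m
      refine Polynomial.natDegree_mul_le.trans ?_
      refine Nat.add_le_add (Polynomial.natDegree_X_pow_le a) ?_
      split_ifs
      · exact ih _
      · simp
    refine (Polynomial.natDegree_sub_le _ _).trans (max_le ?_ ?_)
    · refine (key _ _ _).trans ?_; have := le_max_left f.1 f.2.2.1; omega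
    · refine (key _ _ _).trans ?_; have := le_max_right f.1 f.2.2.1; omega

lemma map_ev {R S : Type*} [CommRing R] [CommRing S] (φ : R →+* S) (s t : R) (l : List PT) :
    φ (l.map (ev s t)).sum = (l.map (ev (φ s) (φ t))).sum := by
  rw [map_list_sum, List.map_map]
  congr 2
  funext P
  simp only [Function.comp, ev, map_mul, map_pow, map_intCast, map_list_prod, List.map_map]
  congr 3
  funext f
  simp

open scoped Polynomial in
theorem kron_sound (w d : ℕ) (l : List PT) (h : kron w d l = true)
    {R : Type*} [CommRing R] (s t : R) : (l.map (ev s t)).sum = 0 := by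
  unfold kron at h
  simp only [Bool.and_eq_true, List.all_eq_true] at h
  obtain ⟨⟨h1, h2⟩, h3⟩ := h
  have h1' : ∀ P ∈ l, P.degS < d := fun P hP => by simpa [Nat.blt] using h1 P hP
  have h2' : (l.map bnd).sum < 2 ^ w := by simpa [Nat.blt] using h2
  have h3' : (sumN w d l).1 = (sumN w d l).2 := Nat.eq_of_beq_eq_true h3
  have hz := sumN_eq w d l
  rw [h3', sub_self] at hz
  -- step 1
  have hq : (l.map (ev (Polynomial.X : ℤ[X]) (Polynomial.X ^ d))).sum = 0 := by
    apply poly_zero ((2 : ℤ) ^ w) (by positivity)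
    · have := map_ev (Polynomial.evalRingHom ((2 : ℤ) ^ w)) (Polynomial.X : ℤ[X]) (Polynomial.X ^ d) l
      simp only [Polynomial.coe_evalRingHom, Polynomial.eval_X, Polynomial.eval_pow] at this
      rw [this, ← hz]
    · intro n hn
      apply Int.eq_zero_of_abs_lt_dvd hn
      have hle : |((l.map (ev (Polynomial.X : ℤ[X]) (Polynomial.X ^ d))).sum).coeff n| ≤ ((l.map bnd).sum : ℕ) := by
        clear h1 h2 h3 h1' h2' h3' hz hn
        induction l with
        | nil => simp
        | cons P l ih =>
          simp only [List.map_cons, List.sum_cons, Polynomial.coeff_add]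
          rw [Nat.cast_add]
          exact (abs_add_le _ _).trans (add_le_add (bound1 d P n) ih)
      refine lt_of_le_of_lt hle ?_
      exact_mod_cast h2'
  have hp : (l.map (ev (Polynomial.C Polynomial.X : ℤ[X][X]) Polynomial.X)).sum = 0 := by
    apply poly_zero ((Polynomial.X : ℤ[X]) ^ d) (by simp)
    · have := map_ev (Polynomial.evalRingHom ((Polynomial.X : ℤ[X]) ^ d)) (Polynomial.C Polynomial.X : ℤ[X][X]) Polynomial.X l
      simp only [Polynomial.coe_evalRingHom, Polynomial.eval_X, Polynomial.eval_C] at this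
      rw [this, hq]
    · intro n hn
      by_contra hne
      have h5 := Polynomial.natDegree_le_of_dvd hn hne
      rw [Polynomial.natDegree_X_pow] at h5
      have hd : 0 < d := by
        rcases Nat.eq_zero_or_pos d with h0 | h0
        · exfalso
          apply hne
          cases l with
          | nil => simp
          | cons P l => have := h1' P (by simp); omega
        · exact h0
      have h6 : ((l.map (ev (Polynomial.C Polynomial.X : ℤ[X][X]) Polynomial.X)).sum.coeff n).natDegree < d := by
        clear h1 h2 h3 h2' h3' hz hn hq hne h5
        induction l with
        | nil => simpa using hd
        | cons P l ih =>
          simp only [List.map_cons, List.sum_cons, Polynomial.coeff_add]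
          refine lt_of_le_of_lt (Polynomial.natDegree_add_le _ _) (max_lt ?_ ?_)
          · exact lt_of_le_of_lt (bound2 P n) (h1' P (by simp))
          · exact ih (fun Q hQ => h1' Q (by simp [hQ]))
      omega
  have := map_ev (Polynomial.eval₂RingHom (Polynomial.eval₂RingHom (Int.castRingHom R) s) t)
    (Polynomial.C Polynomial.X : ℤ[X][X]) Polynomial.X l
  rw [hp, map_zero] at this
  simpa using this.symm

end PT

end PartKron

section PartFinal

def mst (i j : ℤ) : Mon := ⟨i, j, 0, 0, 0, 0⟩

def comL : List Mon := ([(4, 0), (3, 1), (3, -1), (2, 1), (2, -1), (2, 0), (1, 1), (1, -1), (3, 0),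
  (2, 1), (2, -1), (1, 1), (1, -1), (2, 0), (1, 1), (1, -1), (1, 0), (1, 0), (1, 0), (0, 1), (0, 1),
  (0, 1), (0, 1), (2, 2), (1, 2), (0, 2), (1, 0), (1, -2), (2, -2), (1, 0), (0, 1), (2, 0), (1, 1),
  (1, -1), (0, 1), (1, 2), (1, 3), (0, 3), (0, 2), (0, 2), (1, -2), (1, -3), (0, 4), (1, 0)] :
  List (ℤ × ℤ)).map fun p => mst p.1 p.2

def denL : List Mon := ([(1, 0), (0, 1), (2, 0), (1, 1), (1, 1), (0, 2), (3, 0), (2, 1), (2, 1),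
  (1, 2), (1, 2), (0, 3), (4, 0), (3, 1), (2, 2), (1, 3), (0, 4)] :
  List (ℤ × ℤ)).map fun p => mst p.1 p.2

def numL : List Term := ([(-1, 0, 0), (1, 1, 1), (1, 1, 2), (1, 2, 1), (-1, 2, 2), (-2, 2, 3),
  (-1, 2, 4), (-2, 3, 2), (-2, 3, 3), (1, 3, 4), (1, 3, 5), (-1, 4, 2), (1, 4, 3), (2, 4, 4),
  (1, 4, 5), (-1, 4, 6), (1, 5, 3), (1, 5, 4), (-2, 5, 5), (-2, 5, 6), (-1, 6, 4), (-2, 6, 5),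
  (-1, 6, 6), (1, 6, 7), (1, 7, 6), (1, 7, 7), (-1, 8, 8)] : List (ℤ × ℤ × ℤ)).map
  fun p => ⟨p.1, mst p.2.1 p.2.2, [], denL⟩

def subL : List Mon → List Mon → Option (List Mon)
  | com, [] => some com
  | com, M :: l => if M ∈ com then subL (com.erase M) l else none

def isST (M : Mon) : Bool := decide (M.a = 0) && decide (M.b = 0) && decide (M.c = 0) && decide (M.d = 0)

def shS (r : List Mon) : ℤ := (r.map fun M => ((-M.s).toNat : ℤ)).sum
def shT (r : List Mon) : ℤ := (r.map fun M => ((-M.t).toNat : ℤ)).sum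

def conv (T : Term) : Option PT :=
  match T.ns, subL comL T.ds with
  | [], some r =>
    if isST T.m && r.all isST && decide (0 ≤ T.m.s - shS r + 4) && decide (0 ≤ T.m.t - shT r + 48)
    then some ⟨T.c, (T.m.s - shS r + 4).toNat, (T.m.t - shT r + 48).toNat,
      r.map fun M => ((-M.s).toNat, (-M.t).toNat, M.s.toNat, M.t.toNat)⟩
    else none
  | _, _ => none

def convL : List Term → Option (List PT)
  | [] => some []
  | T :: l => match conv T, convL l with
    | some P, some Q => some (P :: Q)
    | _, _ => none

def checkAll : Bool := match Term.runAll with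
  | none => false
  | some L => match convL (L ++ numL) with
    | none => false
    | some Ps => PT.kron 48 80 Ps

set_option maxRecDepth 100000 in
lemma checkAll_true : checkAll = true := by decide +kernel

lemma subL_perm (com l r : List Mon) (h : subL com l = some r) : com.Perm (l ++ r) := by
  induction l generalizing com with
  | nil => simp only [subL, Option.some_inj] at h; rw [h]; simp
  | cons M l ih =>
    simp only [subL] at h
    split_ifs at h with hm
    exact (List.perm_cons_erase hm).trans ((ih _ h).cons M)

lemma dpr_ne (l : List Mon) (h : ∀ M ∈ l, M.pos = true) : dpr xm l ≠ 0 := by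
  induction l with
  | nil => simp [dpr_nil]
  | cons a l ih =>
    rw [dpr_cons]
    exact mul_ne_zero (hposX a (h a (by simp))) (ih fun M hM => h M (by simp [hM]))

lemma com_ne : dpr xm comL ≠ 0 := dpr_ne _ (by decide +kernel)
lemma den_ne : dpr xm denL ≠ 0 := dpr_ne _ (by decide +kernel)

lemma xm_st {M : Mon} (h : isST M = true) :
    xm M = xm (mst 1 0) ^ M.s * xm (mst 0 1) ^ M.t := by
  rw [← isX.smul, ← isX.smul, ← isX.add]
  congr 1
  unfold isST at h
  simp only [Bool.and_eq_true, decide_eq_true_eq] at h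
  obtain ⟨⟨⟨h1, h2⟩, h3⟩, h4⟩ := h
  cases M
  simp_all [Mon.add, Mon.smul, mst]

lemma zpow_toNat {F : Type*} [Field F] {s : F} (hs : s ≠ 0) (n : ℤ) :
    s ^ ((-n).toNat) * s ^ n = s ^ n.toNat := by
  rw [← zpow_natCast, ← zpow_natCast, ← zpow_add₀ hs]
  congr 1
  omega

lemma dpr_shift (r : List Mon) (h : ∀ M ∈ r, isST M = true) :
    xm (mst 1 0) ^ (shS r) * xm (mst 0 1) ^ (shT r) * dpr xm r =
    ((r.map fun M => ((-M.s).toNat, (-M.t).toNat, M.s.toNat, M.t.toNat)).map fun f =>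
      xm (mst 1 0) ^ f.1 * xm (mst 0 1) ^ f.2.1 - xm (mst 1 0) ^ f.2.2.1 * xm (mst 0 1) ^ f.2.2.2).prod := by
  induction r with
  | nil => simp [shS, shT, dpr_nil]
  | cons M r ih =>
    have hs := isX.ne (mst 1 0)
    have ht := isX.ne (mst 0 1)
    have h1 : shS (M :: r) = ((-M.s).toNat : ℤ) + shS r := by simp [shS]
    have h2 : shT (M :: r) = ((-M.t).toNat : ℤ) + shT r := by simp [shT]
    rw [List.map_cons, List.map_cons, List.prod_cons, ← ih (fun M hM => h M (by simp [hM])), h1, h2,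
      dpr_cons, zpow_add₀ hs, zpow_add₀ ht, zpow_natCast, zpow_natCast, xm_st (h M (by simp))]
    have e1 := zpow_toNat hs M.s
    have e2 := zpow_toNat ht M.t
    simp only
    rw [← e1, ← e2]
    ring

lemma conv_sound (T : Term) (P : PT) (h : conv T = some P) :
    val xm T * (dpr xm comL * (xm (mst 1 0) ^ 4 * xm (mst 0 1) ^ 48)) =
      PT.ev (xm (mst 1 0)) (xm (mst 0 1)) P := by
  unfold conv at h
  split at h
  · rename_i r hns hr
    split_ifs at h with hc
    simp only [Bool.and_eq_true, decide_eq_true_eq, List.all_eq_true] at hc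
    obtain ⟨⟨⟨hm, hr'⟩, h1⟩, h2⟩ := hc
    have hs := isX.ne (mst 1 0)
    have ht := isX.ne (mst 0 1)
    have hp := dpr_perm (x := xm) (subL_perm _ _ _ hr)
    rw [dpr_append] at hp
    have hne : dpr xm T.ds ≠ 0 := by
      intro h0; rw [h0, zero_mul] at hp; exact com_ne hp
    rw [← Option.some_inj.mp h]
    unfold PT.ev
    simp only
    rw [← dpr_shift r hr', val, hns, dpr_nil, hp, xm_st hm]
    rw [← zpow_natCast _ (T.m.s - shS r + 4).toNat, ← zpow_natCast _ (T.m.t - shT r + 48).toNat,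
      Int.toNat_of_nonneg h1, Int.toNat_of_nonneg h2, zpow_add₀ hs, zpow_add₀ ht, zpow_sub₀ hs,
      zpow_sub₀ ht]
    have hs' : xm (mst 1 0) ^ (shS r) ≠ 0 := zpow_ne_zero _ hs
    have ht' : xm (mst 0 1) ^ (shT r) ≠ 0 := zpow_ne_zero _ ht
    have e1 : xm (mst 1 0) ^ (4 : ℤ) = xm (mst 1 0) ^ 4 := by norm_cast
    have e2 : xm (mst 0 1) ^ (48 : ℤ) = xm (mst 0 1) ^ 48 := by norm_cast
    rw [e1, e2]
    field_simp
  · exact absurd h (by simp)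

lemma convL_sound (l : List Term) (Ps : List PT) (h : convL l = some Ps) :
    (l.map (val xm)).sum * (dpr xm comL * (xm (mst 1 0) ^ 4 * xm (mst 0 1) ^ 48)) =
      (Ps.map (PT.ev (xm (mst 1 0)) (xm (mst 0 1)))).sum := by
  induction l generalizing Ps with
  | nil =>
    simp only [convL, Option.some_inj] at h
    subst h; simp
  | cons T l ih =>
    simp only [convL] at h
    split at h
    · rename_i a b ha hb
      rw [← Option.some_inj.mp h]
      simp only [List.map_cons, List.sum_cons]
      rw [add_mul, conv_sound T a ha, ih b hb]
    · exact absurd h (by simp)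

/-- the constant term -/
def PH : HF := prj (lc 2) (prj (lc 1) (prj (lc 0) (val xm Term.start)))

lemma xm_mst (i j : ℕ) : xm (mst i j) = xm (mst 1 0) ^ i * xm (mst 0 1) ^ j := by
  rw [xm_st (by simp [isST, mst])]
  simp [mst]

theorem PH_eq (s t : HF) (hs : s = xm (mst 1 0)) (ht : t = xm (mst 0 1)) :
    PH * ((1 - s) * (1 - t) *
          (1 - s ^ 2) * (1 - s * t) ^ 2 * (1 - t ^ 2) *
          (1 - s ^ 3) * (1 - s ^ 2 * t) ^ 2 * (1 - s * t ^ 2) ^ 2 * (1 - t ^ 3) *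
          (1 - s ^ 4) * (1 - s ^ 3 * t) * (1 - s ^ 2 * t ^ 2) * (1 - s * t ^ 3) *
          (1 - t ^ 4)) =
      (1 - s * t + s ^ 2 * t ^ 2) *
        (1 - s * t ^ 2 - s ^ 2 * t + s ^ 2 * t ^ 3 + s ^ 3 * t ^ 2 + s ^ 2 * t ^ 4 +
          2 * (s ^ 3 * t ^ 3) + s ^ 4 * t ^ 2 + s ^ 3 * t ^ 4 + s ^ 4 * t ^ 3 -
          s ^ 4 * t ^ 5 - s ^ 5 * t ^ 4 + s ^ 6 * t ^ 6) := by
  have hc := checkAll_true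
  unfold checkAll at hc
  split at hc
  · exact absurd hc (by simp)
  rename_i L hL
  split at hc
  · exact absurd hc (by simp)
  rename_i Ps hPs
  have h0 := PT.kron_sound 48 80 Ps hc (xm (mst 1 0)) (xm (mst 0 1))
  rw [← convL_sound _ _ hPs] at h0
  have hne : dpr xm comL * (xm (mst 1 0) ^ 4 * xm (mst 0 1) ^ 48) ≠ 0 :=
    mul_ne_zero com_ne (mul_ne_zero (pow_ne_zero _ (isX.ne _)) (pow_ne_zero _ (isX.ne _)))
  have h1 := (mul_eq_zero.mp h0).resolve_right hne
  rw [List.map_append, List.sum_append, ← runAll_correct L hL] at h1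
  have hPH : PH = prj (lc 2) (prj (lc 1) (prj (lc 0) (val xm Term.start))) := by unfold PH; rfl
  rw [← hPH] at h1
  have hx : ∀ i j : ℕ, xm (mst i j) = s ^ i * t ^ j := by
    intro i j; rw [xm_mst, hs, ht]
  have hD : dpr xm denL = (1 - s) * (1 - t) *
          (1 - s ^ 2) * (1 - s * t) ^ 2 * (1 - t ^ 2) *
          (1 - s ^ 3) * (1 - s ^ 2 * t) ^ 2 * (1 - s * t ^ 2) ^ 2 * (1 - t ^ 3) *
          (1 - s ^ 4) * (1 - s ^ 3 * t) * (1 - s ^ 2 * t ^ 2) * (1 - s * t ^ 3) *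
          (1 - t ^ 4) := by
    have hx' : ∀ i j : ℤ, 0 ≤ i → 0 ≤ j → xm (mst i j) = s ^ i.toNat * t ^ j.toNat := by
      intro i j hi hj
      rw [← hx, Int.toNat_of_nonneg hi, Int.toNat_of_nonneg hj]
    unfold denL dpr
    simp only [List.map_cons, List.map_nil, List.prod_cons, List.prod_nil]
    simp [hx']
    ring
  have hN : (numL.map (val xm)).sum * dpr xm denL = - ((1 - s * t + s ^ 2 * t ^ 2) *
        (1 - s * t ^ 2 - s ^ 2 * t + s ^ 2 * t ^ 3 + s ^ 3 * t ^ 2 + s ^ 2 * t ^ 4 +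
          2 * (s ^ 3 * t ^ 3) + s ^ 4 * t ^ 2 + s ^ 3 * t ^ 4 + s ^ 4 * t ^ 3 -
          s ^ 4 * t ^ 5 - s ^ 5 * t ^ 4 + s ^ 6 * t ^ 6)) := by
    have hv : ∀ (c i j : ℤ), val xm ⟨c, mst i j, [], denL⟩ * dpr xm denL = c * xm (mst i j) := by
      intro c i j
      rw [val]
      simp only [dpr_nil, mul_one]
      rw [mul_assoc, inv_mul_cancel₀ den_ne, mul_one]
    have hx' : ∀ i j : ℤ, 0 ≤ i → 0 ≤ j → xm (mst i j) = s ^ i.toNat * t ^ j.toNat := by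
      intro i j hi hj
      rw [← hx, Int.toNat_of_nonneg hi, Int.toNat_of_nonneg hj]
    unfold numL
    simp only [List.map_cons, List.map_nil, List.sum_cons, List.sum_nil, add_mul, hv]
    simp [hx']
    ring
  rw [← hD]
  linear_combination dpr xm denL * h1 - hN

end PartFinal

section PartRep1

/-- the polynomial ring on pairs of 4 by 4 matrices -/
abbrev RP (K : Type*) [Field K] := MvPolynomial (MatVar 4) K

def eg (i : Fin 4) : Gm :=
  toLex ![0, 0, if i = 0 then 1 else 0, if i = 1 then 1 else 0, if i = 2 then 1 else 0,
    if i = 3 then 1 else 0]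
def sg : Gm := toLex ![1, 0, 0, 0, 0, 0]
def tg : Gm := toLex ![0, 1, 0, 0, 0, 0]

def wg : MatVar 4 → Gm
  | Sum.inl a => sg + (eg a.1 - eg a.2)
  | Sum.inr a => tg + (eg a.1 - eg a.2)

def cw (i : Fin 4) : Gm →+ ℤ := crd (Fin.natAdd 2 i)

lemma cw_eg (i j : Fin 4) : cw i (eg j) = if i = j then 1 else 0 := by
  fin_cases i <;> fin_cases j <;> rfl
lemma cw_sg (i : Fin 4) : cw i sg = 0 := by fin_cases i <;> rfl
lemma cw_tg (i : Fin 4) : cw i tg = 0 := by fin_cases i <;> rfl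

def cv (i : Fin 4) : MatVar 4 → ℤ
  | Sum.inl a => (if i = a.1 then 1 else 0) - (if i = a.2 then 1 else 0)
  | Sum.inr a => (if i = a.1 then 1 else 0) - (if i = a.2 then 1 else 0)

lemma cw_wg (i : Fin 4) (v : MatVar 4) : cw i (wg v) = cv i v := by
  rcases v with a | a <;> simp [wg, cv, map_add, map_sub, cw_eg, cw_sg, cw_tg]

section
variable (K : Type*) [Field K]

def dgen (i j : Fin 4) : MatVar 4 → RP K
  | Sum.inl a => (if a.1 = j then X (Sum.inl (i, a.2)) else 0)
      - (if a.2 = i then X (Sum.inl (a.1, j)) else 0)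
  | Sum.inr a => (if a.1 = j then X (Sum.inr (i, a.2)) else 0)
      - (if a.2 = i then X (Sum.inr (a.1, j)) else 0)

def Dd (i j : Fin 4) : Derivation K (RP K) (RP K) := mkDerivation K (dgen K i j)

def Dl (i j : Fin 4) : Module.End K (RP K) := (Dd K i j : RP K →ₗ[K] RP K)

variable {K}
lemma Dl_apply (i j : Fin 4) (f : RP K) : Dl K i j f = Dd K i j f := rfl

lemma Dd_X (i j : Fin 4) (v : MatVar 4) : Dd K i j (X v) = dgen K i j v := mkDerivation_X _ _ _

def kd (a b : Fin 4) : RP K := if a = b then 1 else 0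
lemma kd_comm (a b : Fin 4) : kd (K := K) a b = kd b a := by
  unfold kd; simp only [eq_comm]
lemma Dd_kd (i j a b : Fin 4) : Dd K i j (kd a b) = 0 := by
  unfold kd; split_ifs <;> simp
lemma ite_kd (a b : Fin 4) (f : RP K) : (if a = b then f else 0) = kd a b * f := by
  unfold kd; split_ifs <;> simp

lemma Dd_bracket (i j k l : Fin 4) :
    ⁅Dd K i j, Dd K k l⁆ = (if j = k then Dd K i l else 0) - (if l = i then Dd K k j else 0) := by
  apply derivation_ext
  intro v
  rw [Derivation.commutator_apply, Derivation.sub_apply, Dd_X, Dd_X]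
  have h1 : (if j = k then Dd K i l else 0) (X v) = if j = k then dgen K i l v else 0 := by
    split_ifs <;> simp [Dd_X]
  have h2 : (if l = i then Dd K k j else 0) (X v) = if l = i then dgen K k j v else 0 := by
    split_ifs <;> simp [Dd_X]
  rw [h1, h2]
  rcases v with ⟨a, b⟩ | ⟨a, b⟩
  all_goals
    simp only [dgen, ite_kd, map_sub, Derivation.leibniz, Dd_kd, smul_eq_mul, mul_zero, add_zero,
      Dd_X, kd_comm j k, kd_comm i l]
    ring

lemma Dl_comm (i j k l : Fin 4) :
    Dl K i j * Dl K k l - Dl K k l * Dl K i j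
      = (if j = k then Dl K i l else 0) - (if l = i then Dl K k j else 0) := by
  apply LinearMap.ext
  intro f
  have h := congrArg (fun D => D f) (Dd_bracket (K := K) i j k l)
  simp only [Derivation.commutator_apply] at h
  simp only [LinearMap.sub_apply, Module.End.mul_apply, Dl_apply]
  rw [h]
  split_ifs <;> simp [Dl_apply]

lemma Dd_monomial (i j : Fin 4) (m : MatVar 4 →₀ ℕ) :
    Dd K i j (monomial m 1) = m.sum fun v k => monomial (m - Finsupp.single v 1) (k : K) * dgen K i j v := by
  unfold Dd
  rw [mkDerivation_monomial, one_smul]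
  rfl

lemma dgen_wh (i j : Fin 4) (v : MatVar 4) :
    IsWeightedHomogeneous wg (dgen K i j v) (wg v + (eg i - eg j)) := by
  have hX : ∀ (v : MatVar 4) (γ : Gm), wg v = γ → IsWeightedHomogeneous wg (X v : RP K) γ := by
    rintro v γ rfl; exact isWeightedHomogeneous_X K wg v
  rcases v with ⟨a, b⟩ | ⟨a, b⟩
  all_goals
    simp only [dgen]
    apply IsWeightedHomogeneous.sub
    · split_ifs with h
      · subst h
        apply hX
        simp only [wg]; abel
      · exact isWeightedHomogeneous_zero _ _ _
    · split_ifs with h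
      · subst h
        apply hX
        simp only [wg]; abel
      · exact isWeightedHomogeneous_zero _ _ _

/-- total weight -/
def Wt : (MatVar 4 →₀ ℕ) →+ Gm := Finsupp.weight wg

lemma Dd_wh (i j : Fin 4) (m : MatVar 4 →₀ ℕ) :
    IsWeightedHomogeneous wg (Dd K i j (monomial m 1)) (Wt m + (eg i - eg j)) := by
  rw [Dd_monomial]
  unfold Finsupp.sum
  apply IsWeightedHomogeneous.sum
  intro v hv
  have : Wt m + (eg i - eg j) = Wt (m - Finsupp.single v 1) + (wg v + (eg i - eg j)) := by
    have h2 : m = (m - Finsupp.single v 1) + Finsupp.single v 1 := by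
      rw [tsub_add_cancel_of_le]
      rw [Finsupp.single_le_iff]
      exact Nat.one_le_iff_ne_zero.mpr (Finsupp.mem_support_iff.mp hv)
    conv_lhs => rw [h2]
    rw [map_add]
    have : Wt (Finsupp.single v 1) = wg v := by
      unfold Wt; simp [Finsupp.weight_apply]
    rw [this]; abel
  rw [this]
  exact IsWeightedHomogeneous.mul (isWeightedHomogeneous_monomial _ _ _ rfl) (dgen_wh i j v)

lemma dgen_ii (i : Fin 4) (v : MatVar 4) : dgen K i i v = (cv i v : K) • X v := by
  rcases v with ⟨a, b⟩ | ⟨a, b⟩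
  all_goals
    by_cases h1 : a = i <;> by_cases h2 : b = i <;>
      simp [dgen, cv, h1, h2, eq_comm (a := i)]

lemma cw_Wt (i : Fin 4) (m : MatVar 4 →₀ ℕ) : cw i (Wt m) = m.sum fun v k => (k : ℤ) * cv i v := by
  unfold Wt
  rw [Finsupp.weight_apply, Finsupp.sum, map_sum]
  apply Finset.sum_congr rfl
  intro v _
  rw [map_nsmul, cw_wg]; simp

lemma Dd_ii (i : Fin 4) (m : MatVar 4 →₀ ℕ) :
    Dd K i i (monomial m 1) = ((cw i (Wt m) : ℤ) : K) • monomial m 1 := by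
  rw [Dd_monomial, cw_Wt]
  unfold Finsupp.sum
  rw [Int.cast_sum, Finset.sum_smul]
  apply Finset.sum_congr rfl
  intro v hv
  have h2 : m = (m - Finsupp.single v 1) + Finsupp.single v 1 := by
    rw [tsub_add_cancel_of_le]
    rw [Finsupp.single_le_iff]
    exact Nat.one_le_iff_ne_zero.mpr (Finsupp.mem_support_iff.mp hv)
  simp only []
  rw [dgen_ii, mul_smul_comm, X, monomial_mul, ← h2]
  simp [smul_monomial, mul_comm]
end

end PartRep1

section PartComb

def altS {R : Type*} [Ring R] (T : ℤ → ℤ → ℤ → R) : R :=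
  T 0 0 0 - T 0 0 1 - T 0 1 0 + T 0 1 2 + T 0 2 1 - T 0 2 2 - T 1 0 0 + T 1 0 1 + T 1 2 0 - T 1
    2 3 - T 1 3 1 + T 1 3 3 + T 2 1 0 - T 2 1 2 - T 2 2 0 + T 2 2 3 + T 2 4 2 - T 2 4 3 - T 3 2
    1 + T 3 2 2 + T 3 3 1 - T 3 3 3 - T 3 4 2 + T 3 4 3

lemma altS_cas {R : Type*} [CommRing R] (T TC SA SB SC SD SE SF : ℤ → ℤ → ℤ → R)
    (hSA : ∀ i j k : ℤ, SA i j k - SA (i + 1) (j + 0) (k + 0) = ((i - (j - i) : ℤ) : R) * T i j k)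
    (hSB : ∀ i j k : ℤ, SB i j k - SB (i + 0) (j + 1) (k + 0) = (((j - i) - (k - j) : ℤ) : R) * T i j k)
    (hSC : ∀ i j k : ℤ, SC i j k - SC (i + 0) (j + 0) (k + 1) = (((k - j) - (-k) : ℤ) : R) * T i j k)
    (hSD : ∀ i j k : ℤ, SD i j k - SD (i + 1) (j + 1) (k + 0) = ((i - (k - j) : ℤ) : R) * T i j k)
    (hSE : ∀ i j k : ℤ, SE i j k - SE (i + 0) (j + 1) (k + 1) = (((j - i) - (-k) : ℤ) : R) * T i j k)
    (hSF : ∀ i j k : ℤ, SF i j k - SF (i + 1) (j + 1) (k + 1) = ((i - (-k) : ℤ) : R) * T i j k)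
    (hC : ∀ i j k : ℤ, TC i j k = ((i ^ 2 + (j - i) ^ 2 + (k - j) ^ 2 + (-k) ^ 2
      - ((i - (j - i)) + ((j - i) - (k - j)) + ((k - j) - (-k)) + (i - (k - j)) + ((j - i) - (-k)) + (i - (-k))) : ℤ) : R) * T i j k
      + 2 * (SA i j k + SB i j k + SC i j k + SD i j k + SE i j k + SF i j k)) :
    altS TC = 0 := by
  have eSA : altS SA = - (-1) * T 0 1 0 - (1) * T 1 1 0 + (-2) * T 0 2 1 + (-1) * T 0 1 2 - (-2)
      * T 0 2 2 - (-1) * T 1 3 1 + (1) * T 1 1 2 + (2) * T 2 2 1 - (1) * T 2 3 1 - (2) * T 2 2 2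
      + (-1) * T 1 3 3 + (1) * T 2 3 3 := by
    norm_num at hSA
    unfold altS
    linear_combination (norm := (norm_num; ring)) hSA 0 0 0 - hSA 0 1 0 - hSA 0 0 1 - hSA 1 1 0
      + hSA 1 2 0 + hSA 0 2 1 + hSA 0 1 2 - hSA 0 2 2 - hSA 1 3 1 - hSA 1 2 2 + hSA 1 2 1 + hSA
      1 1 2 + hSA 2 2 1 - hSA 2 3 1 - hSA 2 2 2 - hSA 1 2 3 + hSA 1 3 3 + hSA 2 4 2 + hSA 2 3 3
      - hSA 2 4 3
  have eSB : altS SB = - (-1) * T 1 0 0 - (-1) * T 0 0 1 + (-2) * T 1 0 1 - (1) * T 1 1 0 - (1)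
      * T 0 1 1 + (2) * T 1 2 1 - (-2) * T 2 1 2 + (-1) * T 3 2 2 + (-1) * T 2 2 3 - (2) * T 2 3
      2 + (1) * T 3 3 2 + (1) * T 2 3 3 := by
    norm_num at hSB
    unfold altS
    linear_combination (norm := (norm_num; ring)) hSB 0 0 0 - hSB 1 0 0 - hSB 0 0 1 + hSB 1 0 1
      - hSB 1 1 0 + hSB 2 1 0 + hSB 1 1 1 - hSB 0 1 1 + hSB 0 1 2 + hSB 1 2 1 - hSB 2 2 2 - hSB
      2 1 2 - hSB 3 2 1 + hSB 3 2 2 - hSB 1 2 3 + hSB 2 2 3 - hSB 2 3 2 + hSB 3 3 2 + hSB 2 3 3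
      - hSB 3 3 3
  have eSC : altS SC = - (-1) * T 0 1 0 + (-1) * T 2 1 0 + (-2) * T 1 2 0 - (-2) * T 2 2 0 - (1)
      * T 0 1 1 - (-1) * T 1 3 1 + (1) * T 2 1 1 + (-1) * T 3 3 1 + (2) * T 1 2 2 - (2) * T 2 2
      2 - (1) * T 1 3 2 + (1) * T 3 3 2 := by
    norm_num at hSC
    unfold altS
    linear_combination (norm := (norm_num; ring)) hSC 0 0 0 - hSC 1 0 0 - hSC 0 1 0 + hSC 2 1 0
      + hSC 1 2 0 - hSC 2 2 0 - hSC 0 1 1 + hSC 0 2 1 - hSC 2 2 1 - hSC 1 3 1 + hSC 2 1 1 + hSC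
      1 2 1 - hSC 3 2 1 + hSC 3 3 1 + hSC 1 2 2 - hSC 2 2 2 - hSC 1 3 2 + hSC 3 3 2 + hSC 2 4 2
      - hSC 3 4 2
  have eSD : altS SD = - (1) * T 1 0 0 - (1) * T 0 1 0 + (2) * T 1 1 0 - (-1) * T 0 0 1 + (1) *
      T 0 2 1 + (-1) * T 0 1 2 + (1) * T 1 2 2 - (1) * T 1 1 1 + (2) * T 2 1 1 - (3) * T 2 2 1 -
      (1) * T 2 1 2 - (2) * T 1 3 2 + (3) * T 2 3 2 + (1) * T 2 2 3 + (1) * T 1 3 3 - (2) * T 2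
      3 3 := by
    norm_num at hSD
    unfold altS
    linear_combination (norm := (norm_num; ring)) hSD 0 0 0 - hSD 1 0 0 - hSD 0 1 0 + hSD 1 1 0
      - hSD 0 0 1 + hSD 1 0 1 + hSD 0 2 1 + hSD 0 1 2 - hSD 0 2 2 + hSD 1 2 2 - hSD 1 1 1 + hSD
      2 1 1 - hSD 2 2 1 - hSD 2 1 2 - hSD 1 3 2 + hSD 2 3 2 - hSD 1 2 3 + hSD 2 2 3 + hSD 1 3 3
      - hSD 2 3 3
  have eSE : altS SE = - (-1) * T 1 0 0 - (1) * T 0 1 0 - (1) * T 0 0 1 + (2) * T 0 1 1 + (-1) *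
      T 2 1 0 + (1) * T 1 2 0 + (1) * T 2 2 1 - (1) * T 1 1 1 + (2) * T 1 1 2 - (1) * T 2 1 2 -
      (3) * T 1 2 2 - (2) * T 2 3 1 + (1) * T 3 3 1 + (1) * T 3 2 2 + (3) * T 2 3 2 - (2) * T 3
      3 2 := by
    norm_num at hSE
    unfold altS
    linear_combination (norm := (norm_num; ring)) hSE 0 0 0 - hSE 1 0 0 - hSE 0 1 0 - hSE 0 0 1
      + hSE 1 0 1 + hSE 0 1 1 + hSE 2 1 0 + hSE 1 2 0 - hSE 2 2 0 + hSE 2 2 1 - hSE 1 1 1 + hSE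
      1 1 2 - hSE 2 1 2 - hSE 1 2 2 - hSE 3 2 1 - hSE 2 3 1 + hSE 3 3 1 + hSE 3 2 2 + hSE 2 3 2
      - hSE 3 3 2
  have eSF : altS SF = - (1) * T 1 0 0 - (1) * T 0 0 1 + (2) * T 1 0 1 + (2) * T 2 1 0 + (1) * T
      1 2 0 - (2) * T 2 2 0 - (3) * T 2 1 1 - (2) * T 1 2 1 + (2) * T 1 1 1 + (1) * T 0 2 1 +
      (2) * T 0 1 2 - (3) * T 1 1 2 - (2) * T 0 2 2 - (2) * T 1 3 1 + (3) * T 2 3 1 + (4) * T 2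
      2 2 + (3) * T 1 3 2 - (4) * T 2 3 2 := by
    norm_num at hSF
    unfold altS
    linear_combination (norm := (norm_num; ring)) hSF 0 0 0 - hSF 1 0 0 - hSF 0 1 0 - hSF 0 0 1
      + hSF 1 0 1 + hSF 2 1 0 + hSF 1 2 0 - hSF 2 2 0 - hSF 2 1 1 - hSF 1 2 1 + hSF 1 1 1 + hSF
      0 2 1 + hSF 0 1 2 - hSF 1 1 2 - hSF 0 2 2 - hSF 1 3 1 + hSF 2 3 1 + hSF 2 2 2 + hSF 1 3 2
      - hSF 2 3 2
  have e0 : altS TC = 2 * (altS SA + altS SB + altS SC + altS SD + altS SE + altS SF) := by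
    unfold altS
    simp only [hC]
    norm_num
    ring
  rw [e0, eSA, eSB, eSC, eSD, eSE, eSF]
  ring

end PartComb

section PartRep2

def degG : Gm →+ ℤ := crd 0 + crd 1

lemma degG_wg (v : MatVar 4) : degG (wg v) = 1 := by
  revert v; decide

lemma degG_Wt (m : MatVar 4 →₀ ℕ) : degG (Wt m) = (∑ v, m v : ℕ) := by
  unfold Wt
  rw [Finsupp.weight_apply, Finsupp.sum_fintype _ _ (by simp), map_sum]
  rw [Nat.cast_sum]
  apply Finset.sum_congr rfl
  intro v _
  rw [map_nsmul, degG_wg, nsmul_eq_mul, mul_one]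

lemma Mfin (γ : Gm) : {m : MatVar 4 →₀ ℕ | Wt m = γ}.Finite := by
  have : {m : MatVar 4 →₀ ℕ | Wt m = γ} ⊆
      (fun m : MatVar 4 →₀ ℕ => (m : MatVar 4 → ℕ)) ⁻¹'
        {g : MatVar 4 → ℕ | ∀ v, g v ∈ Set.Iic (degG γ).toNat} := by
    intro m hm v
    have h := degG_Wt m
    rw [Set.mem_ofPred_eq] at hm
    rw [hm] at h
    have h2 : m v ≤ ∑ v, m v := Finset.single_le_sum (fun _ _ => Nat.zero_le _) (Finset.mem_univ v)
    simp only [Set.mem_Iic]; omega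
  refine Set.Finite.subset (Set.Finite.preimage ?_ ?_) this
  · exact DFunLike.coe_injective.injOn
  · exact Set.Finite.pi' fun _ => Set.finite_Iic _

def Ms (γ : Gm) : Finset (MatVar 4 →₀ ℕ) := (Mfin γ).toFinset

lemma mem_Ms {γ : Gm} {m : MatVar 4 →₀ ℕ} : m ∈ Ms γ ↔ Wt m = γ := by
  simp [Ms]

section
variable {K : Type*} [Field K]

lemma wh_expand {γ : Gm} {f : RP K} (h : IsWeightedHomogeneous wg f γ) :
    f = ∑ n ∈ Ms γ, coeff n f • monomial n 1 := by
  ext m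
  rw [coeff_sum]
  simp only [coeff_smul, coeff_monomial, smul_eq_mul, mul_ite, mul_one, mul_zero]
  rw [Finset.sum_ite_eq']
  split_ifs with h1
  · rfl
  · by_contra h2
    exact h1 (mem_Ms.mpr (h h2))

/-- operators shifting weights -/
def Shift (β : Gm) (A : Module.End K (RP K)) : Prop :=
  ∀ m, IsWeightedHomogeneous wg (A (monomial m 1)) (Wt m + β)

lemma Shift.apply {β : Gm} {A : Module.End K (RP K)} (h : Shift β A) {γ : Gm} {f : RP K}
    (hf : IsWeightedHomogeneous wg f γ) : IsWeightedHomogeneous wg (A f) (γ + β) := by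
  rw [wh_expand hf, map_sum]
  apply IsWeightedHomogeneous.sum
  intro n hn
  rw [map_smul, ← mem_Ms.mp hn, MvPolynomial.smul_eq_C_mul]
  exact (h n).C_mul _

lemma Shift.mul {α β : Gm} {A B : Module.End K (RP K)} (hA : Shift α A) (hB : Shift β B) :
    Shift (β + α) (A * B) := by
  intro m
  rw [← add_assoc]
  exact hA.apply (hB m)

lemma Shift.add {α : Gm} {A B : Module.End K (RP K)} (hA : Shift α A) (hB : Shift α B) :
    Shift α (A + B) := fun m => (hA m).add (hB m)

lemma Shift.smul {α : Gm} {A : Module.End K (RP K)} (hA : Shift α A) (c : K) :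
    Shift α (c • A) := by
  intro m
  rw [LinearMap.smul_apply, MvPolynomial.smul_eq_C_mul]
  exact (hA m).C_mul _

lemma Shift.sum {ι : Type*} (s : Finset ι) {α : Gm} {A : ι → Module.End K (RP K)}
    (hA : ∀ i ∈ s, Shift α (A i)) : Shift α (∑ i ∈ s, A i) := by
  intro m
  rw [LinearMap.sum_apply]
  exact IsWeightedHomogeneous.sum _ _ _ fun i hi => hA i hi m

lemma shift_one : Shift 0 (1 : Module.End K (RP K)) := by
  intro m
  rw [add_zero]
  exact isWeightedHomogeneous_monomial _ _ _ rfl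

lemma shift_Dl (i j : Fin 4) : Shift (eg i - eg j) (Dl K i j) := fun m => Dd_wh i j m

def trM (γ : Gm) (A : Module.End K (RP K)) : K := ∑ m ∈ Ms γ, coeff m (A (monomial m 1))

lemma trM_add (γ : Gm) (A B : Module.End K (RP K)) : trM γ (A + B) = trM γ A + trM γ B := by
  simp [trM, Finset.sum_add_distrib]
lemma trM_sub (γ : Gm) (A B : Module.End K (RP K)) : trM γ (A - B) = trM γ A - trM γ B := by
  simp [trM, Finset.sum_sub_distrib]
lemma trM_sum {ι : Type*} (s : Finset ι) (γ : Gm) (A : ι → Module.End K (RP K)) :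
    trM γ (∑ i ∈ s, A i) = ∑ i ∈ s, trM γ (A i) := by
  unfold trM
  rw [Finset.sum_comm]
  simp [LinearMap.sum_apply, coeff_sum]
lemma trM_one (γ : Gm) : trM γ (1 : Module.End K (RP K)) = (Ms γ).card := by
  simp [trM, coeff_monomial]

lemma trM_cyc {β γ γ' : Gm} {A B : Module.End K (RP K)} (hB : Shift β B) (hA : Shift (-β) A)
    (hγ : γ' = γ + β) :
    trM γ (A * B) = trM γ' (B * A) := by
  subst hγ
  have h1 : ∀ m ∈ Ms γ, coeff m ((A * B) (monomial m 1)) =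
      ∑ n ∈ Ms (γ + β), coeff n (B (monomial m 1)) * coeff m (A (monomial n 1)) := by
    intro m hm
    have h := hB m
    rw [mem_Ms.mp hm] at h
    rw [Module.End.mul_apply]
    conv_lhs => rw [wh_expand h]
    simp [map_sum, coeff_sum]
  have h2 : ∀ n ∈ Ms (γ + β), coeff n ((B * A) (monomial n 1)) =
      ∑ m ∈ Ms γ, coeff n (B (monomial m 1)) * coeff m (A (monomial n 1)) := by
    intro n hn
    have h := hA n
    rw [mem_Ms.mp hn, add_neg_cancel_right] at h
    rw [Module.End.mul_apply]
    conv_lhs => rw [wh_expand h]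
    simp [map_sum, coeff_sum, mul_comm]
  unfold trM
  rw [Finset.sum_congr rfl h1, Finset.sum_congr rfl h2, Finset.sum_comm]

variable (K) in
/-- the Casimir operator -/
def Cas : Module.End K (RP K) := ∑ i, ∑ j, Dl K i j * Dl K j i

lemma Cas_comm (k l : Fin 4) : Commute (Dl K k l) (Cas K) := by
  have h1 : ∀ i j, Dl K k l * (Dl K i j * Dl K j i) - (Dl K i j * Dl K j i) * Dl K k l =
      ((if l = i then Dl K k j * Dl K j i else 0) - (if j = k then Dl K i l * Dl K j i else 0))
      + ((if l = j then Dl K i j * Dl K k i else 0) - (if i = k then Dl K i j * Dl K j l else 0)) := by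
    intro i j
    have e : Dl K k l * (Dl K i j * Dl K j i) - (Dl K i j * Dl K j i) * Dl K k l =
      (Dl K k l * Dl K i j - Dl K i j * Dl K k l) * Dl K j i
       + Dl K i j * (Dl K k l * Dl K j i - Dl K j i * Dl K k l) := by
      simp only [sub_mul, mul_sub, mul_assoc]; abel
    rw [e, Dl_comm, Dl_comm]
    simp only [sub_mul, mul_sub, ite_mul, mul_ite, zero_mul, mul_zero]
  apply sub_eq_zero.mp
  unfold Cas
  rw [Finset.mul_sum, Finset.sum_mul, ← Finset.sum_sub_distrib]
  simp only [Finset.mul_sum, Finset.sum_mul, ← Finset.sum_sub_distrib, h1]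
  simp only [Finset.sum_add_distrib, Finset.sum_sub_distrib, Finset.sum_ite_eq, Finset.sum_ite_eq',
    Finset.mem_univ, if_true]
  have e1 : ∑ i, ∑ j, (if l = i then Dl K k j * Dl K j i else 0) = ∑ j, Dl K k j * Dl K j l := by
    rw [Finset.sum_comm]; simp
  have e2 : ∑ i, ∑ j, (if i = k then Dl K i j * Dl K j l else 0) = ∑ j, Dl K k j * Dl K j l := by
    rw [Finset.sum_comm]; simp
  rw [e1, e2]
  abel

lemma shift_Cas : Shift 0 (Cas K) := by
  unfold Cas
  refine Shift.sum _ fun i _ => Shift.sum _ fun j _ => ?_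
  have := (shift_Dl (K := K) i j).mul (shift_Dl j i)
  simpa using this

section
variable {A : Module.End K (RP K)} (hA : ∀ i j, Commute (Dl K i j) A) (hs : Shift 0 A)
include hA hs

lemma S_rec (i j : Fin 4) (γ γ' : Gm) (hγ : γ' = γ + (eg i - eg j)) :
    trM γ (Dl K j i * Dl K i j * A) = trM γ' (Dl K i j * Dl K j i * A) := by
  rw [mul_assoc, trM_cyc (β := eg i - eg j) (γ' := γ') (A := Dl K j i) (B := Dl K i j * A) _ _ hγ,
    mul_assoc, mul_assoc, (hA j i).eq]
  · simpa using (shift_Dl (K := K) i j).mul hs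
  · simpa using (shift_Dl (K := K) j i)

omit hs in
lemma tr_ii (i : Fin 4) (γ : Gm) : trM γ (Dl K i i * A) = (cw i γ : ℤ) * trM γ A := by
  rw [(hA i i).eq]
  unfold trM
  rw [Finset.mul_sum]
  apply Finset.sum_congr rfl
  intro m hm
  rw [Module.End.mul_apply, Dl_apply, Dd_ii, map_smul, coeff_smul, mem_Ms.mp hm, smul_eq_mul]

omit hs in
lemma S_diff (i j : Fin 4) (γ : Gm) :
    trM γ (Dl K i j * Dl K j i * A) - trM γ (Dl K j i * Dl K i j * A)
      = ((cw i γ - cw j γ : ℤ) : K) * trM γ A := by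
  rw [← trM_sub, ← sub_mul, Dl_comm, if_pos rfl, if_pos rfl, sub_mul, trM_sub, tr_ii hA, tr_ii hA]
  push_cast; ring

lemma S_str (i j : Fin 4) (γ γ' : Gm) (hγ : γ' = γ + (eg i - eg j)) :
    trM γ (Dl K i j * Dl K j i * A) - trM γ' (Dl K i j * Dl K j i * A)
      = ((cw i γ - cw j γ : ℤ) : K) * trM γ A := by
  rw [← S_rec hA hs i j γ γ' hγ, S_diff hA]

end

def gmu (p q i j k : ℤ) : Gm := toLex ![p, q, i, j - i, k - j, -k]

theorem altS_Cas_mul {A : Module.End K (RP K)} (hA : ∀ i j, Commute (Dl K i j) A) (hs : Shift 0 A)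
    (p q : ℤ) : altS (fun i j k => trM (gmu p q i j k) (Cas K * A)) = 0 := by
  have key : ∀ (a b : Fin 4) (x y z : ℤ) (c d : ℤ → ℤ → ℤ → ℤ)
      (_ : ∀ i j k, gmu p q (i + x) (j + y) (k + z) = gmu p q i j k + (eg a - eg b))
      (_ : ∀ i j k, cw a (gmu p q i j k) = c i j k) (_ : ∀ i j k, cw b (gmu p q i j k) = d i j k),
      ∀ i j k : ℤ, trM (gmu p q i j k) (Dl K a b * Dl K b a * A)
        - trM (gmu p q (i + x) (j + y) (k + z)) (Dl K a b * Dl K b a * A)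
        = ((c i j k - d i j k : ℤ) : K) * trM (gmu p q i j k) A := by
    intro a b x y z c d h h1 h2 i j k
    rw [S_str hA hs a b _ _ (h i j k), h1, h2]
  have c0 : ∀ i j k, cw 0 (gmu p q i j k) = i := fun _ _ _ => rfl
  have c1 : ∀ i j k, cw 1 (gmu p q i j k) = j - i := fun _ _ _ => rfl
  have c2 : ∀ i j k, cw 2 (gmu p q i j k) = k - j := fun _ _ _ => rfl
  have c3 : ∀ i j k, cw 3 (gmu p q i j k) = -k := fun _ _ _ => rfl
  refine altS_cas (fun i j k => trM (gmu p q i j k) A) _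
    (fun i j k => trM (gmu p q i j k) (Dl K 0 1 * Dl K 1 0 * A))
    (fun i j k => trM (gmu p q i j k) (Dl K 1 2 * Dl K 2 1 * A))
    (fun i j k => trM (gmu p q i j k) (Dl K 2 3 * Dl K 3 2 * A))
    (fun i j k => trM (gmu p q i j k) (Dl K 0 2 * Dl K 2 0 * A))
    (fun i j k => trM (gmu p q i j k) (Dl K 1 3 * Dl K 3 1 * A))
    (fun i j k => trM (gmu p q i j k) (Dl K 0 3 * Dl K 3 0 * A))
    (key 0 1 _ _ _ _ _ ?_ c0 c1) (key 1 2 _ _ _ _ _ ?_ c1 c2) (key 2 3 _ _ _ _ _ ?_ c2 c3)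
    (key 0 2 _ _ _ _ _ ?_ c0 c2) (key 1 3 _ _ _ _ _ ?_ c1 c3) (key 0 3 _ _ _ _ _ ?_ c0 c3) ?_
  iterate 6
    · intro i j k
      apply ofLex.injective
      funext u
      change ofLex (gmu p q _ _ _) u = ofLex (gmu p q i j k) u + (ofLex (eg _) u - ofLex (eg _) u)
      fin_cases u <;> simp [gmu, eg] <;> omega
  intro i j k
  unfold Cas
  simp only [Fin.sum_univ_four, add_mul, trM_add]
  have d := fun a b => S_diff hA a b (gmu p q i j k)
  have e2 : ∀ a, trM (gmu p q i j k) (Dl K a a * Dl K a a * A) =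
      ((cw a (gmu p q i j k) : ℤ) : K) * ((cw a (gmu p q i j k) : ℤ) * trM (gmu p q i j k) A) := by
    intro a
    have h1 : ∀ i j, Commute (Dl K i j) A := hA
    rw [mul_assoc, (hA a a).eq, ← mul_assoc]
    unfold trM
    rw [Finset.mul_sum, Finset.mul_sum]
    apply Finset.sum_congr rfl
    intro m hm
    rw [Module.End.mul_apply, Dl_apply, Dd_ii, map_smul, coeff_smul, mem_Ms.mp hm, smul_eq_mul,
      (hA a a).eq, Module.End.mul_apply, Dl_apply, Dd_ii, map_smul, coeff_smul, mem_Ms.mp hm,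
      smul_eq_mul]
  have d10 := d 0 1
  have d20 := d 0 2
  have d30 := d 0 3
  have d21 := d 1 2
  have d31 := d 1 3
  have d32 := d 2 3
  rw [e2 0, e2 1, e2 2, e2 3]
  simp only [c0, c1, c2, c3] at *
  push_cast at *
  linear_combination -d10 - d20 - d30 - d21 - d31 - d32
end

end PartRep2

section PartRep3

section
variable {K : Type*} [Field K]
lemma Dl_sum (i j : Fin 4) (f : RP K) : Dl K i j f =
    ∑ k : Fin 4, ((X (Sum.inl (i, k)) * pderiv (Sum.inl (j, k)) f
        - X (Sum.inl (k, j)) * pderiv (Sum.inl (k, i)) f)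
      + (X (Sum.inr (i, k)) * pderiv (Sum.inr (j, k)) f
        - X (Sum.inr (k, j)) * pderiv (Sum.inr (k, i)) f)) := by
  have h : Dd K i j = ∑ k : Fin 4, (((X (Sum.inl (i, k)) : RP K) • pderiv (Sum.inl (j, k))
        - (X (Sum.inl (k, j)) : RP K) • pderiv (Sum.inl (k, i)))
      + ((X (Sum.inr (i, k)) : RP K) • pderiv (Sum.inr (j, k))
        - (X (Sum.inr (k, j)) : RP K) • pderiv (Sum.inr (k, i)))) := by
    apply derivation_ext
    intro v
    rw [Dd_X]
    have hc : ∀ g : Fin 4 → Derivation K (RP K) (RP K), (∑ k, g k) (X v) = ∑ k, g k (X v) := by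
      intro g
      simp [Fin.sum_univ_four]
    rw [hc]
    simp only [Derivation.add_apply, Derivation.sub_apply, Derivation.smul_apply, smul_eq_mul,
      pderiv_X, Finset.sum_add_distrib, Finset.sum_sub_distrib]
    rcases v with ⟨a, b⟩ | ⟨a, b⟩
    all_goals
      by_cases h1 : a = j <;> by_cases h2 : b = i <;>
        simp [dgen, Pi.single_apply, h1, h2]
  rw [Dl_apply, h]
  simp [Fin.sum_univ_four]
end

def mfac (m : MatVar 4 →₀ ℕ) : ℚ := ∏ v, ((m v).factorial : ℚ)

lemma mfac_pos (m : MatVar 4 →₀ ℕ) : 0 < mfac m :=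
  Finset.prod_pos fun v _ => by exact_mod_cast Nat.factorial_pos _

lemma mfac_add (m : MatVar 4 →₀ ℕ) (u : MatVar 4) :
    mfac (m + Finsupp.single u 1) = (m u + 1 : ℚ) * mfac m := by
  unfold mfac
  rw [← Finset.mul_prod_erase _ _ (Finset.mem_univ u),
    ← Finset.mul_prod_erase _ (fun v => ((m v).factorial : ℚ)) (Finset.mem_univ u)]
  have : ∏ x ∈ Finset.univ.erase u, (((m + Finsupp.single u 1 : MatVar 4 →₀ ℕ) x).factorial : ℚ)
      = ∏ x ∈ Finset.univ.erase u, ((m x).factorial : ℚ) := by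
    apply Finset.prod_congr rfl
    intro x hx
    have : x ≠ u := Finset.ne_of_mem_erase hx
    simp [Finsupp.single_apply, this.symm]
  rw [this]
  simp [Nat.factorial_succ]
  ring

def Bf : RP ℚ →ₗ[ℚ] RP ℚ →ₗ[ℚ] ℚ :=
  (basisMonomials (MatVar 4) ℚ).constr ℚ fun m => mfac m • lcoeff ℚ m

lemma Bf_mon (m : MatVar 4 →₀ ℕ) (g : RP ℚ) : Bf (monomial m 1) g = mfac m * coeff m g := by
  unfold Bf
  have : (monomial m 1 : RP ℚ) = basisMonomials (MatVar 4) ℚ m := by simp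
  rw [this, Module.Basis.constr_basis]
  simp

lemma Bf_symm (f g : RP ℚ) : Bf f g = Bf g f := by
  have : Bf = Bf.flip := by
    apply (basisMonomials (MatVar 4) ℚ).ext
    intro m
    apply (basisMonomials (MatVar 4) ℚ).ext
    intro n
    rw [LinearMap.flip_apply]
    simp only [coe_basisMonomials, Bf_mon, coeff_monomial]
    by_cases h : m = n
    · subst h; rfl
    · simp [h, Ne.symm h]
  exact congrFun (congrArg DFunLike.coe (congrFun (congrArg DFunLike.coe this) f)) g

lemma Bf_exp (f : RP ℚ) : Bf f f = ∑ m ∈ f.support, mfac m * (coeff m f) ^ 2 := by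
  have e : ∀ g, Bf f g = ∑ m ∈ f.support, coeff m f * (mfac m * coeff m g) := by
    intro g
    conv_lhs => rw [f.as_sum]
    rw [map_sum, LinearMap.sum_apply]
    apply Finset.sum_congr rfl
    intro m _
    have : (monomial m (coeff m f) : RP ℚ) = coeff m f • monomial m 1 := by
      rw [smul_monomial, smul_eq_mul, mul_one]
    rw [this, map_smul, LinearMap.smul_apply, Bf_mon, smul_eq_mul]
  rw [e]
  apply Finset.sum_congr rfl
  intro m _
  ring

lemma Bf_self (f : RP ℚ) (h : Bf f f = 0) : f = 0 := by
  have e := Bf_exp f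
  by_contra hf
  rw [e] at h
  have hpos : 0 < ∑ m ∈ f.support, mfac m * (coeff m f) ^ 2 := by
    apply Finset.sum_pos
    · intro m hm
      have := mem_support_iff.mp hm
      have := mfac_pos m
      positivity
    · exact support_nonempty.mpr hf
  exact hpos.ne' h

lemma Bf_nonneg (f : RP ℚ) : 0 ≤ Bf f f := by
  have e := Bf_exp f
  rw [e]
  exact Finset.sum_nonneg fun m _ => mul_nonneg (mfac_pos m).le (sq_nonneg _)

lemma Bf_X (u : MatVar 4) (f g : RP ℚ) : Bf (X u * f) g = Bf f (pderiv u g) := by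
  have : Bf ∘ₗ (LinearMap.mulLeft ℚ (X u)) = (Bf.flip ∘ₗ (pderiv (R := ℚ) u).toLinearMap).flip := by
    apply (basisMonomials (MatVar 4) ℚ).ext
    intro m
    apply LinearMap.ext
    intro g
    simp only [coe_basisMonomials, LinearMap.comp_apply, LinearMap.flip_apply,
      LinearMap.mulLeft_apply]
    have h : (X u * monomial m 1 : RP ℚ) = monomial (m + Finsupp.single u 1) 1 := by
      rw [X, monomial_mul, add_comm, mul_one]
    rw [h, Bf_mon, mfac_add]
    change _ = Bf (monomial m 1) (pderiv u g)
    rw [Bf_mon, coeff_pderiv]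
    ring
  exact congrFun (congrArg DFunLike.coe (congrFun (congrArg DFunLike.coe this) f)) g

lemma Bf_X' (u : MatVar 4) (f g : RP ℚ) : Bf (pderiv u f) g = Bf f (X u * g) := by
  rw [Bf_symm, ← Bf_X, Bf_symm]

lemma Bf_Dl (i j : Fin 4) (f g : RP ℚ) : Bf (Dl ℚ i j f) g = Bf f (Dl ℚ j i g) := by
  rw [Dl_sum, Dl_sum]
  simp only [map_sum, map_add, map_sub, LinearMap.sum_apply, LinearMap.add_apply,
    LinearMap.sub_apply, Bf_X, Bf_X']

lemma Bf_Cas (f g : RP ℚ) : Bf (Cas ℚ f) g = ∑ i, ∑ j, Bf (Dl ℚ j i f) (Dl ℚ j i g) := by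
  unfold Cas
  simp only [LinearMap.sum_apply, map_sum, Module.End.mul_apply, Bf_Dl]

lemma Cas_ker {f : RP ℚ} (h : Cas ℚ f = 0) (i j : Fin 4) : Dl ℚ i j f = 0 := by
  have h1 := Bf_Cas f f
  rw [h, map_zero, LinearMap.zero_apply] at h1
  have h2 := (Finset.sum_eq_zero_iff_of_nonneg
    (fun i _ => Finset.sum_nonneg fun j _ => Bf_nonneg _)).mp h1.symm j (Finset.mem_univ _)
  have h3 := (Finset.sum_eq_zero_iff_of_nonneg (fun j _ => Bf_nonneg _)).mp h2 i (Finset.mem_univ _)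
  exact Bf_self _ h3

lemma Bf_Cas' (f g : RP ℚ) : Bf (Cas ℚ f) g = Bf f (Cas ℚ g) := by
  rw [Bf_Cas, Bf_symm f, Bf_Cas]
  simp only [Bf_symm]

lemma Cas_sq {f : RP ℚ} (h : Cas ℚ (Cas ℚ f) = 0) : Cas ℚ f = 0 := by
  apply Bf_self
  rw [← Bf_Cas', h]; simp

lemma Cas_pow (e : ℕ) {f : RP ℚ} (h : (Cas ℚ ^ e) f = 0) : Cas ℚ f = 0 := by
  induction e with
  | zero =>
    rw [pow_zero, Module.End.one_apply] at h
    rw [h, map_zero]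
  | succ e ih =>
    rcases Nat.eq_zero_or_pos e with h0 | h0
    · subst h0; simpa using h
    · apply ih
      obtain ⟨d, rfl⟩ : ∃ d, e = d + 1 := ⟨e - 1, by omega⟩
      rw [pow_succ', pow_succ', Module.End.mul_apply, Module.End.mul_apply] at h
      rw [pow_succ', Module.End.mul_apply]
      exact Cas_sq h

end PartRep3

section PartRep4

lemma aeval_restrict_aux {V : Type*} [AddCommGroup V] [Module ℚ V] (T : Module.End ℚ V)
    (U : Submodule ℚ V) (h : ∀ x ∈ U, T x ∈ U) (P : Polynomial ℚ) (x : U) :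
    ((Polynomial.aeval (T.restrict h) P x : U) : V) = Polynomial.aeval T P (x : V) := by
  induction P using Polynomial.induction_on' with
  | add p q hp hq => simp [hp, hq]
  | monomial n a =>
    simp only [Polynomial.aeval_monomial, Module.End.mul_apply, Module.algebraMap_end_apply,
      Submodule.coe_smul]
    congr 1
    induction n generalizing x with
    | zero => simp
    | succ n ih =>
      rw [pow_succ, pow_succ, Module.End.mul_apply, Module.End.mul_apply, ih]
      rfl

theorem exists_P (G : Finset Gm) : ∃ P : Polynomial ℚ, P.coeff 0 = 1 ∧
    ∀ m, Wt m ∈ G → ∀ i j, Dl ℚ i j (Polynomial.aeval (Cas ℚ) P (monomial m 1)) = 0 := by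
  classical
  set F : Finset (RP ℚ) := (G.biUnion Ms).image (fun m => monomial m 1) with hF
  set U : Submodule ℚ (RP ℚ) := Submodule.span ℚ (F : Set (RP ℚ)) with hU
  have hmem : ∀ m, Wt m ∈ G → (monomial m 1 : RP ℚ) ∈ U := by
    intro m hm
    apply Submodule.subset_span
    simp only [hF, Finset.coe_image]
    exact ⟨m, Finset.mem_biUnion.mpr ⟨_, hm, mem_Ms.mpr rfl⟩, rfl⟩
  have hC : ∀ x ∈ U, Cas ℚ x ∈ U := by
    intro x hx
    have : U ≤ U.comap (Cas ℚ) := by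
      rw [hU, Submodule.span_le]
      intro y hy
      simp only [hF, Finset.coe_image] at hy
      obtain ⟨m, hm, rfl⟩ := hy
      obtain ⟨γ, hγ, hm⟩ := Finset.mem_biUnion.mp (Finset.mem_coe.mp hm)
      have h2 := shift_Cas (K := ℚ) m
      rw [add_zero] at h2
      change Cas ℚ (monomial m 1) ∈ U
      rw [wh_expand h2]
      refine Submodule.sum_mem _ fun n hn => Submodule.smul_mem _ _ (hmem n ?_)
      rw [mem_Ms.mp hn, mem_Ms.mp hm]; exact hγ
    exact this hx
  haveI : FiniteDimensional ℚ U := FiniteDimensional.span_finset ℚ F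
  set T : Module.End ℚ U := (Cas ℚ).restrict hC
  have hχ := LinearMap.aeval_self_charpoly T
  have hχ0 : T.charpoly ≠ 0 := (LinearMap.charpoly_monic T).ne_zero
  obtain ⟨u, hu, hnd⟩ := T.charpoly.exists_eq_pow_rootMultiplicity_mul_and_not_dvd hχ0 0
  rw [map_zero, sub_zero] at hu hnd
  rw [Polynomial.X_dvd_iff] at hnd
  refine ⟨Polynomial.C (u.coeff 0)⁻¹ * u, by simp [hnd], ?_⟩
  intro m hm i j
  apply Cas_ker
  apply Cas_pow (T.charpoly.rootMultiplicity 0)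
  have h1 := aeval_restrict_aux (Cas ℚ) U hC T.charpoly ⟨_, hmem m hm⟩
  have h2 : Polynomial.aeval ((Cas ℚ).restrict hC) T.charpoly = 0 := hχ
  rw [h2] at h1
  simp only [LinearMap.zero_apply, Submodule.coe_zero] at h1
  rw [hu, map_mul, map_pow, Polynomial.aeval_X, Module.End.mul_apply] at h1
  rw [map_mul, Polynomial.aeval_C, Module.End.mul_apply, Module.algebraMap_end_apply, map_smul,
    ← h1, smul_zero]

section
variable (K : Type*) [Field K] [CharZero K]

def mpK : RP ℚ →+* RP K := MvPolynomial.map (algebraMap ℚ K)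

lemma mpK_Dl (i j : Fin 4) (f : RP ℚ) : mpK K (Dl ℚ i j f) = Dl K i j (mpK K f) := by
  have hX : ∀ v, mpK K (X v) = X v := fun v => map_X _ _
  have hd : ∀ v, mpK K (dgen ℚ i j v) = dgen K i j v := by
    intro v
    rcases v with a | a <;> simp only [dgen, map_sub, apply_ite (mpK K), map_zero, hX]
  simp only [Dl_apply]
  induction f using MvPolynomial.induction_on with
  | C a =>
    have : mpK K (C a) = C (algebraMap ℚ K a) := map_C _ _
    rw [this]; simp
  | add p q hp hq => simp only [map_add, hp, hq]
  | mul_X p v hp =>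
    rw [Derivation.leibniz, map_mul, Derivation.leibniz, hX, Dd_X, Dd_X]
    simp only [smul_eq_mul, map_add, map_mul, hX, hd, hp]

lemma mpK_Cas (f : RP ℚ) : mpK K (Cas ℚ f) = Cas K (mpK K f) := by
  unfold Cas
  simp only [LinearMap.sum_apply, map_sum, Module.End.mul_apply, mpK_Dl]

lemma mpK_smul (a : ℚ) (f : RP ℚ) : mpK K (a • f) = algebraMap ℚ K a • mpK K f := by
  rw [MvPolynomial.smul_eq_C_mul, MvPolynomial.smul_eq_C_mul, map_mul]
  congr 1
  exact map_C _ _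

lemma mpK_aeval (P : Polynomial ℚ) (f : RP ℚ) : mpK K (Polynomial.aeval (Cas ℚ) P f) =
    Polynomial.aeval (Cas K) (P.map (algebraMap ℚ K)) (mpK K f) := by
  induction P using Polynomial.induction_on' with
  | add p q hp hq => simp [hp, hq]
  | monomial n a =>
    rw [Polynomial.map_monomial, Polynomial.aeval_monomial, Polynomial.aeval_monomial,
      Module.End.mul_apply, Module.End.mul_apply, Module.algebraMap_end_apply,
      Module.algebraMap_end_apply, mpK_smul]
    congr 1
    induction n generalizing f with
    | zero => simp
    | succ n ih =>
      rw [pow_succ, pow_succ, Module.End.mul_apply, Module.End.mul_apply, ih, mpK_Cas]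

theorem exists_PK (G : Finset Gm) : ∃ P : Polynomial K, P.coeff 0 = 1 ∧
    ∀ m, Wt m ∈ G → ∀ i j, Dl K i j (Polynomial.aeval (Cas K) P (monomial m 1)) = 0 := by
  obtain ⟨P, h0, h⟩ := exists_P G
  refine ⟨P.map (algebraMap ℚ K), by simp [h0], ?_⟩
  intro m hm i j
  have h1 : (monomial m 1 : RP K) = mpK K (monomial m 1) := by
    unfold mpK; rw [map_monomial, (algebraMap ℚ K).map_one]
  rw [h1, ← mpK_aeval, ← mpK_Dl, h m hm, map_zero]

/-- projection operator onto the invariants for the relevant weights -/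
theorem exists_Pr (G : Finset Gm) : ∃ A Q : Module.End K (RP K), A = 1 - Cas K * Q ∧ Shift 0 A ∧
    (∀ i j, Commute (Dl K i j) Q) ∧ Shift 0 Q ∧ (∀ f, (∀ i j, Dl K i j f = 0) → A f = f) ∧
    ∀ m, Wt m ∈ G → ∀ i j, Dl K i j (A (monomial m 1)) = 0 := by
  obtain ⟨P, h0, h⟩ := exists_PK K G
  have hcomm : ∀ (R : Polynomial K) i j, Commute (Dl K i j) (Polynomial.aeval (Cas K) R) := by
    intro R i j
    induction R using Polynomial.induction_on' with
    | add p q hp hq => rw [map_add]; exact hp.add_right hq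
    | monomial n a =>
      rw [Polynomial.aeval_monomial]
      exact Commute.mul_right (show Commute _ _ from (Algebra.commutes a _).symm) ((Cas_comm i j).pow_right n)
  have hsh : ∀ (R : Polynomial K), Shift 0 (Polynomial.aeval (Cas K) R) := by
    intro R
    induction R using Polynomial.induction_on' with
    | add p q hp hq => rw [map_add]; exact hp.add hq
    | monomial n a =>
      rw [Polynomial.aeval_monomial, ← Algebra.smul_def]
      apply Shift.smul
      induction n with
      | zero => exact shift_one
      | succ n ih => simpa [pow_succ] using ih.mul shift_Cas
  obtain ⟨R, hR⟩ : Polynomial.X ∣ 1 - P := by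
    rw [Polynomial.X_dvd_iff]; simp [h0]
  have hA : Polynomial.aeval (Cas K) P = 1 - Cas K * Polynomial.aeval (Cas K) R := by
    have : P = 1 - Polynomial.X * R := by rw [← hR]; ring
    conv_lhs => rw [this]
    simp
  refine ⟨_, _, hA, hsh _, hcomm _, hsh _, ?_, h⟩
  intro f hf
  have hC : Cas K f = 0 := by
    unfold Cas
    simp [LinearMap.sum_apply, Module.End.mul_apply, hf]
  have hc : Commute (Cas K) (Polynomial.aeval (Cas K) R) := by
    have := (Commute.all (Polynomial.X : Polynomial K) R).map (Polynomial.aeval (Cas K))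
    simpa using this
  rw [hA, LinearMap.sub_apply, hc.eq, Module.End.mul_apply, hC]
  simp
end

end PartRep4

section PartRep5

section
variable {K : Type*} [Field K]

lemma coeff_Dl_ii (i : Fin 4) (f : RP K) (m : MatVar 4 →₀ ℕ) :
    coeff m (Dl K i i f) = ((cw i (Wt m) : ℤ) : K) * coeff m f := by
  induction f using MvPolynomial.induction_on' with
  | monomial u a =>
    have h : (monomial u a : RP K) = a • monomial u 1 := by rw [smul_monomial]; simp
    rw [h, map_smul, Dl_apply, Dd_ii]
    simp only [coeff_smul, coeff_monomial, smul_eq_mul]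
    split_ifs with h
    · subst h; ring
    · simp
  | add p q hp hq => rw [map_add, coeff_add, hp, hq, coeff_add]; ring

lemma sum_cw_Wt (m : MatVar 4 →₀ ℕ) : ∑ i, cw i (Wt m) = 0 := by
  simp only [cw_Wt, Finsupp.sum]
  rw [Finset.sum_comm]
  apply Finset.sum_eq_zero
  intro v _
  rw [← Finset.mul_sum]
  have : ∑ i, cv i v = 0 := by
    rcases v with a | a <;> simp [cv, Finset.sum_sub_distrib]
  rw [this, mul_zero]

lemma zpow_sum_aux {a : K} (ha : a ≠ 0) {ι : Type*} (s : Finset ι) (e : ι → ℤ) :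
    ∏ v ∈ s, a ^ e v = a ^ (∑ v ∈ s, e v) := by
  classical
  induction s using Finset.induction_on with
  | empty => simp
  | insert v s hv ih => rw [Finset.prod_insert hv, Finset.sum_insert hv, zpow_add₀ ha, ih]

/-- entries of a one-parameter conjugate -/
def qp (i j : Fin 4) (x : MatVar 4 → K) : MatVar 4 → Polynomial K
  | Sum.inl a => Polynomial.C (x (Sum.inl a)) + Polynomial.X * ((if a.1 = i then Polynomial.C (x (Sum.inl (j, a.2))) else 0)
      - (if a.2 = j then Polynomial.C (x (Sum.inl (a.1, i))) else 0))
      - Polynomial.X ^ 2 * (if a.1 = i then if a.2 = j then Polynomial.C (x (Sum.inl (j, i))) else 0 else 0)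
  | Sum.inr a => Polynomial.C (x (Sum.inr a)) + Polynomial.X * ((if a.1 = i then Polynomial.C (x (Sum.inr (j, a.2))) else 0)
      - (if a.2 = j then Polynomial.C (x (Sum.inr (a.1, i))) else 0))
      - Polynomial.X ^ 2 * (if a.1 = i then if a.2 = j then Polynomial.C (x (Sum.inr (j, i))) else 0 else 0)

lemma deriv_qp {i j : Fin 4} (hij : i ≠ j) (x : MatVar 4 → K) (f : RP K) :
    Polynomial.derivative (aeval (qp i j x) f) = aeval (qp i j x) (Dd K j i f) := by
  have hg : ∀ v, Polynomial.derivative (qp i j x v) = aeval (qp i j x) (dgen K j i v) := by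
    intro v
    rcases v with ⟨a, b⟩ | ⟨a, b⟩
    all_goals
      by_cases h1 : a = i <;> by_cases h2 : b = j <;>
        simp [dgen, qp, h1, h2, hij, hij.symm] <;> (try ring_nf)
      try simp [Polynomial.C_ofNat]
      try ring
  induction f using MvPolynomial.induction_on with
  | C a => simp
  | add p q hp hq => simp only [map_add, hp, hq]
  | mul_X p v hp =>
    rw [Derivation.leibniz, map_mul, Polynomial.derivative_mul, hp, aeval_X, hg, Dd_X]
    simp only [smul_eq_mul, map_add, map_mul, aeval_X]; ring

lemma eval_qp {i j : Fin 4} (hij : i ≠ j) (A B : Matrix (Fin 4) (Fin 4) K) (c : K) (v : MatVar 4) :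
    Polynomial.eval c (qp i j (pairSub A B) v) =
      pairSub (transvection i j c * A * transvection i j (-c))
        (transvection i j c * B * transvection i j (-c)) v := by
  have key : ∀ (A : Matrix (Fin 4) (Fin 4) K) (a b : Fin 4),
      (transvection i j c * A * transvection i j (-c)) a b = A a b + c * ((if a = i then A j b else 0)
        - if b = j then A a i else 0) - c ^ 2 * (if a = i then if b = j then A j i else 0 else 0) := by
    intro A a b
    by_cases h2 : b = j
    · subst h2
      rw [mul_transvection_apply_same]
      by_cases h1 : a = i
      · subst h1
        rw [transvection_mul_apply_same, transvection_mul_apply_same]; simp; ring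
      · rw [transvection_mul_apply_of_ne _ _ _ _ h1, transvection_mul_apply_of_ne _ _ _ _ h1]
        simp [h1]
        try ring
    · rw [mul_transvection_apply_of_ne _ _ _ _ h2]
      by_cases h1 : a = i
      · subst h1
        rw [transvection_mul_apply_same]; simp [h2]
      · rw [transvection_mul_apply_of_ne _ _ _ _ h1]
        simp [h1, h2]
  rcases v with ⟨a, b⟩ | ⟨a, b⟩
  all_goals
    simp only [pairSub, key, qp]
    split_ifs <;> (simp; try ring)

lemma eval_aeval_qp {i j : Fin 4} (hij : i ≠ j) (A B : Matrix (Fin 4) (Fin 4) K) (c : K) (f : RP K) :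
    Polynomial.eval c (aeval (qp i j (pairSub A B)) f) =
      eval (pairSub (transvection i j c * A * transvection i j (-c))
        (transvection i j c * B * transvection i j (-c))) f := by
  induction f using MvPolynomial.induction_on with
  | C a => simp
  | add p q hp hq => simp only [map_add, Polynomial.eval_add, hp, hq]
  | mul_X p v hp => 
    rw [map_mul, map_mul, Polynomial.eval_mul, hp, aeval_X, eval_qp hij, eval_X]

lemma pairSub_surj (x : MatVar 4 → K) : ∃ A B : Matrix (Fin 4) (Fin 4) K, pairSub A B = x := by
  refine ⟨fun a b => x (Sum.inl (a, b)), fun a b => x (Sum.inr (a, b)), ?_⟩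
  funext v
  rcases v with ⟨a, b⟩ | ⟨a, b⟩ <;> rfl

lemma transv_inv {i j : Fin 4} (hij : i ≠ j) (c : K) :
    (transvection i j c)⁻¹ = transvection i j (-c) := by
  apply Matrix.inv_eq_right_inv
  rw [transvection_mul_transvection_same _ _ hij]; simp

lemma inv_iff' (f : RP K) : IsMatInvariant f ↔ ∀ M : Matrix (Fin 4) (Fin 4) K, M.det ≠ 0 →
    ∀ A B, eval (pairSub (M * A * M⁻¹) (M * B * M⁻¹)) f = eval (pairSub A B) f := by
  constructor
  · intro h M hM A B
    have := h (Matrix.GeneralLinearGroup.mkOfDetNeZero M hM) A B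
    rwa [Matrix.coe_units_inv] at this
  · intro h a A B
    rw [Matrix.coe_units_inv]
    exact h _ (by simpa using (Matrix.isUnit_iff_isUnit_det _).mp a.isUnit |>.ne_zero) A B

lemma Dl_of_inv [CharZero K] (f : RP K) (h : IsMatInvariant f) (i j : Fin 4) : Dl K i j f = 0 := by
  rw [inv_iff'] at h
  have off : ∀ i j, i ≠ j → Dl K j i f = 0 := by
    intro i j hij
    apply MvPolynomial.funext
    intro x
    obtain ⟨A, B, rfl⟩ := pairSub_surj x
    have h1 : aeval (qp i j (pairSub A B)) f = Polynomial.C (eval (pairSub A B) f) := by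
      apply Polynomial.funext
      intro c
      rw [eval_aeval_qp hij, Polynomial.eval_C, ← transv_inv hij]
      apply h
      rw [det_transvection_of_ne _ _ hij]; exact one_ne_zero
    have h2 := deriv_qp hij (pairSub A B) f
    rw [h1, Polynomial.derivative_C] at h2
    have h3 := eval_aeval_qp hij A B 0 (Dd K j i f)
    rw [← h2] at h3
    simpa [Dl_apply] using h3.symm
  by_cases hij : i = j
  · subst hij
    have h1 : ∀ k, Dl K k k f = Dl K i i f := by
      intro k
      by_cases hk : k = i
      · rw [hk]
      · have := congrArg (fun D => D f) (Dl_comm (K := K) k i i k)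
        simp only [LinearMap.sub_apply, Module.End.mul_apply, off i k (Ne.symm hk), off k i hk,
          map_zero, sub_zero, if_true] at this
        exact (sub_eq_zero.mp this.symm)
    have h2 : ∑ k, Dl K k k f = 0 := by
      ext m
      rw [coeff_sum]
      simp only [coeff_Dl_ii]
      rw [← Finset.sum_mul, ← Int.cast_sum, sum_cw_Wt]; simp
    simp only [h1, Finset.sum_const, Finset.card_univ, Fintype.card_fin] at h2
    simpa using h2
  · exact off j i (Ne.symm hij)

lemma inv_of_Dl [CharZero K] (f : RP K) (h : ∀ i j, Dl K i j f = 0) : IsMatInvariant f := by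
  rw [inv_iff']
  intro M hM
  refine Matrix.diagonal_transvection_induction_of_det_ne_zero (fun M =>
    ∀ A B, eval (pairSub (M * A * M⁻¹) (M * B * M⁻¹)) f = eval (pairSub A B) f) M hM ?_ ?_ ?_
  · intro d hd A B
    rw [det_diagonal] at hd
    have hd' : ∀ i, d i ≠ 0 := fun i => Finset.prod_ne_zero_iff.mp hd i (Finset.mem_univ i)
    have hi : (diagonal d)⁻¹ = diagonal (fun i => (d i)⁻¹) := by
      apply Matrix.inv_eq_right_inv
      rw [diagonal_mul_diagonal]
      simp [hd']
    rw [hi, eval_eq', eval_eq']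
    apply Finset.sum_congr rfl
    intro m hm
    have hw : ∀ i, cw i (Wt m) = 0 := by
      intro i
      have := coeff_Dl_ii i f m
      rw [h, coeff_zero] at this
      have h2 := (mul_eq_zero.mp this.symm).resolve_right (mem_support_iff.mp hm)
      exact_mod_cast h2
    congr 1
    have hv : ∀ v, pairSub (diagonal d * A * diagonal (fun i => (d i)⁻¹))
        (diagonal d * B * diagonal (fun i => (d i)⁻¹)) v = (∏ i, d i ^ cv i v) * pairSub A B v := by
      intro v
      rcases v with ⟨a, b⟩ | ⟨a, b⟩
      all_goals
        simp only [pairSub, mul_diagonal, diagonal_mul, cv]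
        have : ∀ i, d i ^ ((if i = a then (1:ℤ) else 0) - (if i = b then 1 else 0)) =
            (if i = a then d i else 1) * (if i = b then (d i)⁻¹ else 1) := by
          intro i
          rw [zpow_sub₀ (hd' i)]
          split_ifs <;> simp [div_eq_mul_inv]
        simp only [this, Finset.prod_mul_distrib, Finset.prod_ite_eq', Finset.mem_univ, if_true]
        ring
    simp only [hv, mul_pow, Finset.prod_mul_distrib]
    rw [show (∏ v, (∏ i, d i ^ cv i v) ^ m v) = 1 from ?_, one_mul]
    simp only [← Finset.prod_pow]
    rw [Finset.prod_comm]
    apply Finset.prod_eq_one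
    intro i _
    have h3 := hw i
    rw [cw_Wt, Finsupp.sum_fintype _ _ (by simp)] at h3
    have : ∀ v, (d i ^ cv i v) ^ m v = d i ^ ((m v : ℤ) * cv i v) := by
      intro v; rw [mul_comm, _root_.zpow_mul]; simp
    simp only [this]
    rw [zpow_sum_aux (hd' i) Finset.univ, h3, zpow_zero]
  · rintro ⟨i, j, hij, c⟩ A B
    simp only [TransvectionStruct.toMatrix]
    rw [transv_inv hij, ← eval_aeval_qp hij]
    have h2 := deriv_qp hij (pairSub A B) f
    rw [← Dl_apply, h, map_zero] at h2
    have h3 := Polynomial.eq_C_of_natDegree_eq_zero (Polynomial.derivative_eq_zero.mp h2)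
    have h4 := eval_aeval_qp hij A B 0 f
    rw [h3] at h4 ⊢
    simpa using h4
  · intro M N _ _ hM hN A B
    rw [Matrix.mul_inv_rev]
    have := hM (N * A * N⁻¹) (N * B * N⁻¹)
    rw [hN] at this
    rw [← this]
    simp only [Matrix.mul_assoc]
end

end PartRep5

section PartRep6

lemma gm_ext {a b : Gm} (h0 : crd 0 a = crd 0 b) (h1 : crd 1 a = crd 1 b)
    (h : ∀ i, cw i a = cw i b) : a = b := by
  apply ofLex.injective
  funext u
  have h2 := h 0
  have h3 := h 1
  have h4 := h 2
  have h5 := h 3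
  fin_cases u
  · exact h0
  · exact h1
  · exact h2
  · exact h3
  · exact h4
  · exact h5

lemma crd0_Wt (m : MatVar 4 →₀ ℕ) : crd 0 (Wt m) = ((Finsupp.weight (bideg 4) m).1 : ℤ)
    ∧ crd 1 (Wt m) = ((Finsupp.weight (bideg 4) m).2 : ℤ) := by
  induction m using Finsupp.induction_linear with
  | zero => simp
  | add f g hf hg => simp [map_add, hf.1, hf.2, hg.1, hg.2]
  | single v k =>
    have : Wt (Finsupp.single v k) = k • wg v := by
      unfold Wt; simp [Finsupp.weight_single]
    rw [this, map_nsmul, map_nsmul, Finsupp.weight_single]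
    have h : crd 0 (wg v) = ((bideg 4 v).1 : ℤ) ∧ crd 1 (wg v) = ((bideg 4 v).2 : ℤ) := by
      rcases v with ⟨a, b⟩ | ⟨a, b⟩ <;> constructor <;> 
        simp only [wg, map_add, map_sub, bideg] <;> rfl
    rw [h.1, h.2]; simp

section
variable (K : Type*) [Field K] [CharZero K]

def Vsub (γ : Gm) : Submodule K (RP K) :=
  weightedHomogeneousSubmodule K wg γ ⊓ ⨅ i, ⨅ j, LinearMap.ker (Dl K i j)

variable {K}
lemma mem_Vsub {γ : Gm} {f : RP K} : f ∈ Vsub K γ ↔ IsWeightedHomogeneous wg f γ ∧ ∀ i j, Dl K i j f = 0 := by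
  simp [Vsub, Submodule.mem_iInf]

lemma pure_eq (p q : ℕ) : pureComponent K 4 p q = (Vsub K (gmu p q 0 0 0) : Set (RP K)) := by
  ext f
  rw [SetLike.mem_coe, mem_Vsub]
  have hi : IsMatInvariant f ↔ ∀ i j, Dl K i j f = 0 :=
    ⟨fun h i j => Dl_of_inv f h i j, inv_of_Dl f⟩
  unfold pureComponent
  rw [Set.mem_ofPred_eq, hi, and_comm]
  apply and_congr_left
  intro hD
  constructor
  · intro h m hm
    have h1 := h hm
    have h2 := crd0_Wt m
    rw [h1] at h2
    refine gm_ext h2.1 h2.2 fun i => ?_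
    have := coeff_Dl_ii i f m
    rw [hD, coeff_zero] at this
    have h2 : cw i (Wt m) = 0 := by
      exact_mod_cast (mul_eq_zero.mp this.symm).resolve_right hm
    refine h2.trans ?_
    fin_cases i <;> rfl
  · intro h m hm
    have h1 : Wt m = _ := h hm
    have h2 := crd0_Wt m
    rw [h1] at h2
    have e0 : crd 0 (gmu p q 0 0 0) = p := rfl
    have e1 : crd 1 (gmu p q 0 0 0) = q := rfl
    rw [e0, e1] at h2
    exact Prod.ext (by exact_mod_cast h2.1.symm) (by exact_mod_cast h2.2.symm)

lemma finrank_V (γ : Gm) (A : Module.End K (RP K)) (hs : Shift 0 A)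
    (h1 : ∀ f, (∀ i j, Dl K i j f = 0) → A f = f)
    (h2 : ∀ m, Wt m = γ → ∀ i j, Dl K i j (A (monomial m 1)) = 0) :
    trM γ A = (Module.finrank K (Vsub K γ) : K) := by
  classical
  set ι : (Ms γ → K) →ₗ[K] RP K := ∑ n : Ms γ, (LinearMap.toSpanSingleton K (RP K) (monomial n.1 1)).comp (LinearMap.proj n) with hι
  have ιa : ∀ c, ι c = ∑ n : Ms γ, c n • (monomial n.1 1 : RP K) := by
    intro c; simp [hι, LinearMap.sum_apply]
  set π : RP K →ₗ[K] (Ms γ → K) := LinearMap.pi fun n => lcoeff K n.1 with hπ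
  have πa : ∀ f n, π f n = coeff n.1 f := fun f n => rfl
  have πι : ∀ c, π (ι c) = c := by
    intro c
    funext n
    rw [πa, ιa, coeff_sum]
    simp only [coeff_smul, coeff_monomial, smul_eq_mul, mul_ite, mul_one, mul_zero]
    rw [Finset.sum_eq_single n]
    · simp
    · intro b _ hb
      rw [if_neg]; exact fun h => hb (Subtype.ext h)
    · simp
  have ιw : ∀ c, IsWeightedHomogeneous wg (ι c) γ := by
    intro c
    rw [ιa]
    apply IsWeightedHomogeneous.sum
    intro n _
    rw [smul_monomial]
    exact isWeightedHomogeneous_monomial _ _ _ (mem_Ms.mp n.2)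
  have ιπ : ∀ f, IsWeightedHomogeneous wg f γ → ι (π f) = f := by
    intro f hf
    conv_rhs => rw [wh_expand hf]
    rw [ιa, ← Finset.sum_coe_sort (Ms γ)]
    rfl
  set W : Submodule K (Ms γ → K) := (Vsub K γ).comap ι with hW
  have hWV : W.map ι = Vsub K γ := by
    ext f
    constructor
    · rintro ⟨c, hc, rfl⟩; exact hc
    · intro hf
      have := ιπ f (mem_Vsub.mp hf).1
      exact ⟨π f, by rw [hW]; change ι (π f) ∈ Vsub K γ; rw [this]; exact hf, this⟩
  have hinj : Function.Injective ι := Function.LeftInverse.injective πι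
  have hfr : Module.finrank K (Vsub K γ) = Module.finrank K W := by
    rw [← hWV]
    exact (Submodule.equivMapOfInjective ι hinj W).finrank_eq.symm
  have hP : LinearMap.IsProj W (π ∘ₗ A ∘ₗ ι) := by
    constructor
    · intro c
      have hw : IsWeightedHomogeneous wg (A (ι c)) γ := by simpa using hs.apply (ιw c)
      change ι (π (A (ι c))) ∈ Vsub K γ
      rw [ιπ _ hw, mem_Vsub]
      refine ⟨hw, fun i j => ?_⟩
      rw [ιa, map_sum, map_sum]
      apply Finset.sum_eq_zero
      intro n _
      rw [map_smul, map_smul, h2 _ (mem_Ms.mp n.2), smul_zero]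
    · intro c hc
      change π (A (ι c)) = c
      rw [h1 _ (mem_Vsub.mp hc).2, πι]
  rw [hfr, ← hP.trace, LinearMap.trace_eq_matrix_trace K (Pi.basisFun K (Ms γ))]
  unfold trM Matrix.trace
  rw [← Finset.sum_coe_sort (Ms γ)]
  apply Finset.sum_congr rfl
  intro n _
  rw [Matrix.diag_apply, LinearMap.toMatrix_apply]
  simp only [Pi.basisFun_apply, Pi.basisFun_repr, LinearMap.comp_apply, πa]
  congr 2
  rw [ιa, Finset.sum_eq_single n]
  · simp
  · intro b _ hb; simp [hb]
  · simp

lemma trM_zero_of (γ : Gm) (A : Module.End K (RP K)) (hs : Shift 0 A) (i : Fin 4) (hi : cw i γ ≠ 0)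
    (h2 : ∀ m, Wt m = γ → ∀ i j, Dl K i j (A (monomial m 1)) = 0) : trM γ A = 0 := by
  apply Finset.sum_eq_zero
  intro m hm
  have := coeff_Dl_ii i (A (monomial m 1)) m
  rw [h2 m (mem_Ms.mp hm), coeff_zero, mem_Ms.mp hm] at this
  exact (mul_eq_zero.mp this.symm).resolve_left (by exact_mod_cast hi)

lemma altS_sub {R : Type*} [CommRing R] (T U : ℤ → ℤ → ℤ → R) :
    altS (fun i j k => T i j k - U i j k) = altS T - altS U := by
  unfold altS; ring

lemma altS_single {R : Type*} [Ring R] (T : ℤ → ℤ → ℤ → R)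
    (h : ∀ i j k, i ∈ Finset.Icc (0:ℤ) 4 → j ∈ Finset.Icc (0:ℤ) 4 → k ∈ Finset.Icc (0:ℤ) 4 →
      (i ≠ 0 ∨ j ≠ 0 ∨ k ≠ 0) → T i j k = 0) : altS T = T 0 0 0 := by
  unfold altS
  rw [h 0 0 1, h 0 1 0, h 0 1 2, h 0 2 1, h 0 2 2, h 1 0 0, h 1 0 1, h 1 2 0, h 1 2 3, h 1 3 1,
    h 1 3 3, h 2 1 0, h 2 1 2, h 2 2 0, h 2 2 3, h 2 4 2, h 2 4 3, h 3 2 1, h 3 2 2, h 3 3 1,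
    h 3 3 3, h 3 4 2, h 3 4 3]
  · simp
  all_goals simp

variable (K)
theorem pureDim_eq (p q : ℕ) : (pureDim K 4 p q : ℤ) = altS (fun i j k => ((Ms (gmu p q i j k)).card : ℤ)) := by
  set I := Finset.Icc (0:ℤ) 4
  obtain ⟨A, Q, hAQ, hsA, hcQ, hsQ, hf, hm⟩ := exists_Pr K
    (((I ×ˢ I) ×ˢ I).image fun x => gmu p q x.1.1 x.1.2 x.2)
  have hm' : ∀ i j k, i ∈ I → j ∈ I → k ∈ I → ∀ m, Wt m = gmu p q i j k → ∀ a b,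
      Dl K a b (A (monomial m 1)) = 0 := by
    intro i j k hi hj hk m h
    apply hm
    rw [h, Finset.mem_image]
    exact ⟨((i, j), k), by simp [hi, hj, hk], rfl⟩
  have h0 : (0:ℤ) ∈ I := by simp [I]
  have e1 : altS (fun i j k => trM (gmu p q i j k) A) =
      (Module.finrank K (Vsub K (gmu p q 0 0 0)) : K) := by
    rw [← finrank_V _ A hsA hf (hm' 0 0 0 h0 h0 h0)]
    apply altS_single
    intro i j k hi hj hk h
    by_cases hi0 : i = 0
    · by_cases hk0 : k = 0
      · have hj0 : j ≠ 0 := by tauto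
        apply trM_zero_of _ A hsA 1 _ (hm' i j k hi hj hk)
        change j - i ≠ 0
        rw [hi0]; simpa using hj0
      · apply trM_zero_of _ A hsA 3 _ (hm' i j k hi hj hk)
        change -k ≠ 0
        simpa using hk0
    · apply trM_zero_of _ A hsA 0 _ (hm' i j k hi hj hk)
      exact hi0
  have e2 : altS (fun i j k => trM (gmu p q i j k) A) =
      altS (fun i j k => ((Ms (gmu p q i j k)).card : K)) := by
    have h := altS_Cas_mul hcQ hsQ p q
    rw [hAQ]
    simp only [trM_sub, trM_one]
    rw [altS_sub, h, sub_zero]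
  have e3 : (pureDim K 4 p q : K) = altS (fun i j k => ((Ms (gmu p q i j k)).card : K)) := by
    rw [← e2, e1]
    unfold pureDim Set.finrank
    rw [pure_eq, Submodule.span_eq]
  have e4 : ((pureDim K 4 p q : ℤ) : K) =
      ((altS (fun i j k => ((Ms (gmu p q i j k)).card : ℤ)) : ℤ) : K) := by
    push_cast [altS]
    rw [e3]; rfl
  exact_mod_cast e4
end

end PartRep6

section PartCount

def wm : MatVar 4 → Mon
  | Sum.inl a => ⟨1, 0, (if a.1 = 0 then 1 else 0) - (if a.2 = 0 then 1 else 0),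
      (if a.1 = 1 then 1 else 0) - (if a.2 = 1 then 1 else 0),
      (if a.1 = 2 then 1 else 0) - (if a.2 = 2 then 1 else 0),
      (if a.1 = 3 then 1 else 0) - (if a.2 = 3 then 1 else 0)⟩
  | Sum.inr a => ⟨0, 1, (if a.1 = 0 then 1 else 0) - (if a.2 = 0 then 1 else 0),
      (if a.1 = 1 then 1 else 0) - (if a.2 = 1 then 1 else 0),
      (if a.1 = 2 then 1 else 0) - (if a.2 = 2 then 1 else 0),
      (if a.1 = 3 then 1 else 0) - (if a.2 = 3 then 1 else 0)⟩

lemma wm_g (v : MatVar 4) : (wm v).g = wg v := by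
  apply ofLex.injective
  funext u
  rcases v with ⟨a, b⟩ | ⟨a, b⟩
  · change ofLex (wm _).g u = ofLex sg u + (ofLex (eg a) u - ofLex (eg b) u)
    fin_cases u <;> simp [Mon.g, wm, eg, sg]
  · change ofLex (wm _).g u = ofLex tg u + (ofLex (eg a) u - ofLex (eg b) u)
    fin_cases u <;> simp [Mon.g, wm, eg, tg]

lemma wm_multiset : (Finset.univ : Finset (MatVar 4)).val.map wm = (Term.start.ds : Multiset Mon) := by
  decide +kernel

lemma wg_pos (v : MatVar 4) : 0 < wg v := by
  rw [← wm_g]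
  apply Mon.g_pos
  rcases v with ⟨a, b⟩ | ⟨a, b⟩ <;> simp [wm, Mon.pos]

lemma dpr_start : dpr xm Term.start.ds = ∏ v, (1 - xg (wg v)) := by
  have h : ∀ v, xg (wg v) = xm (wm v) := fun v => by rw [← wm_g]; rfl
  unfold dpr
  simp only [h]
  have h2 := congrArg (fun S : Multiset Mon => (S.map fun M => 1 - xm M).prod) wm_multiset
  simp only [Multiset.map_map] at h2
  exact h2.symm

lemma xg_mul_coeff (a γ : Gm) (f : HF) : (xg a * f).coeff γ = f.coeff (γ - a) := by
  have := HahnSeries.coeff_single_mul_add (r := (1 : ℚ)) (x := f) (a := γ - a) (b := a)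
  rw [sub_add_cancel, one_mul] at this
  exact this

/-- count of monomials of a given weight and restricted support -/
def cnt (S : Finset (MatVar 4)) (γ : Gm) : ℚ := (((Ms γ).filter (fun m => m.support ⊆ S)).card : ℚ)

lemma cnt_neg (S : Finset (MatVar 4)) (γ : Gm) (h : degG γ < 0) : cnt S γ = 0 := by
  unfold cnt
  rw [Nat.cast_eq_zero, Finset.card_eq_zero, Finset.filter_eq_empty_iff]
  intro m hm
  rw [← mem_Ms.mp hm, degG_Wt] at h
  omega

lemma Wt_single (a : MatVar 4) : Wt (Finsupp.single a 1) = wg a := by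
  unfold Wt; simp [Finsupp.weight_apply]

lemma cnt_rec (S : Finset (MatVar 4)) (a : MatVar 4) (ha : a ∉ S) (γ : Gm) :
    cnt (insert a S) γ = cnt (insert a S) (γ - wg a) + cnt S γ := by
  classical
  unfold cnt
  rw [← Nat.cast_add]
  congr 1
  rw [← Finset.card_filter_add_card_filter_not (s := (Ms γ).filter (fun m => m.support ⊆ insert a S))
    (fun m => m a ≠ 0)]
  congr 1
  · symm
    apply Finset.card_bij (fun m _ => m + Finsupp.single a 1)
    · intro m hm
      simp only [Finset.mem_filter, mem_Ms] at hm ⊢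
      refine ⟨⟨by rw [map_add, hm.1, Wt_single]; abel, ?_⟩, by simp⟩
      refine Finsupp.support_add.trans (Finset.union_subset hm.2 ?_)
      exact Finsupp.support_single_subset.trans (by simp)
    · intro m _ n _ h
      exact add_right_cancel h
    · intro m hm
      simp only [Finset.mem_filter, mem_Ms] at hm
      have h2 : m = (m - Finsupp.single a 1) + Finsupp.single a 1 := by
        rw [tsub_add_cancel_of_le]
        rw [Finsupp.single_le_iff]
        exact Nat.one_le_iff_ne_zero.mpr hm.2
      refine ⟨m - Finsupp.single a 1, ?_, h2.symm⟩
      simp only [Finset.mem_filter, mem_Ms]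
      constructor
      · have := hm.1.1
        rw [h2, map_add, Wt_single] at this
        rw [← this]; abel
      · refine Finset.Subset.trans ?_ hm.1.2
        exact Finsupp.support_tsub
  · congr 1
    ext m
    simp only [Finset.mem_filter, not_not]
    constructor
    · rintro ⟨⟨h1, h2⟩, h3⟩
      refine ⟨h1, fun v hv => ?_⟩
      rcases Finset.mem_insert.mp (h2 hv) with rfl | h
      · exact absurd h3 (Finsupp.mem_support_iff.mp hv)
      · exact h
    · rintro ⟨h1, h2⟩
      refine ⟨⟨h1, h2.trans (Finset.subset_insert _ _)⟩, ?_⟩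
      by_contra h
      exact ha (h2 (Finsupp.mem_support_iff.mpr h))

lemma prod_coeff (S : Finset (MatVar 4)) : Nn degG (∏ v ∈ S, (1 - xg (wg v))⁻¹) ∧
    ∀ γ, (∏ v ∈ S, (1 - xg (wg v))⁻¹).coeff γ = cnt S γ := by
  classical
  induction S using Finset.induction_on with
  | empty =>
    rw [Finset.prod_empty]
    refine ⟨fr_one.nn, fun γ => ?_⟩
    rw [← xg_zero, xg_coeff]
    unfold cnt
    by_cases h : γ = 0
    · subst h
      rw [if_pos rfl]
      symm
      rw [Nat.cast_eq_one, Finset.card_eq_one]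
      refine ⟨0, ?_⟩
      ext m
      simp only [Finset.mem_filter, mem_Ms, Finset.subset_empty, Finsupp.support_eq_empty,
        Finset.mem_singleton]
      constructor
      · exact fun h => h.2
      · rintro rfl; simp
    · rw [if_neg h]
      symm
      rw [Nat.cast_eq_zero, Finset.card_eq_zero, Finset.filter_eq_empty_iff]
      intro m hm h2
      rw [Finset.subset_empty, Finsupp.support_eq_empty] at h2
      subst h2
      rw [mem_Ms, map_zero] at hm
      exact h hm.symm
  | insert a S ha ih =>
    rw [Finset.prod_insert ha]
    have hn : Nn degG ((1 - xg (wg a))⁻¹ * ∏ v ∈ S, (1 - xg (wg v))⁻¹) :=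
      (nn_inv (wg_pos a) (by rw [degG_wg]; norm_num)).mul ih.1
    refine ⟨hn, ?_⟩
    set F := ∏ v ∈ S, (1 - xg (wg v))⁻¹ with hF
    set H := (1 - xg (wg a))⁻¹ * F with hH
    have hne := one_sub_xg_ne (wg_pos a).ne'
    have hrec : ∀ γ, H.coeff γ = H.coeff (γ - wg a) + cnt S γ := by
      intro γ
      have : H = xg (wg a) * H + F := by
        rw [hH]; field_simp; ring
      conv_lhs => rw [this]
      rw [HahnSeries.coeff_add, xg_mul_coeff, ih.2]
    have main : ∀ n : ℕ, ∀ γ, degG γ < n → H.coeff γ = cnt (insert a S) γ := by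
      intro n
      induction n with
      | zero =>
        intro γ h
        rw [cnt_neg _ _ (by exact_mod_cast h)]
        by_contra h2
        have := hn γ h2
        push_cast at h; omega
      | succ n ihn =>
        intro γ h
        rw [hrec, cnt_rec S a ha, ihn]
        rw [map_sub, degG_wg]; push_cast at h; omega
    intro γ
    exact main ((degG γ).toNat + 1) γ (by push_cast; omega)

def GS : HF := ∏ v, (1 - xg (wg v))⁻¹

lemma GS_coeff (γ : Gm) : GS.coeff γ = ((Ms γ).card : ℚ) := by
  unfold GS
  rw [(prod_coeff Finset.univ).2]
  unfold cnt
  rw [Finset.filter_true_of_mem]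
  intro m _; exact Finset.subset_univ _

lemma GS_zero (γ : Gm) (h : crd 0 γ < 0 ∨ crd 1 γ < 0) : GS.coeff γ = 0 := by
  rw [GS_coeff, Nat.cast_eq_zero, Finset.card_eq_zero, Finset.eq_empty_iff_forall_notMem]
  intro m hm
  rw [← mem_Ms.mp hm] at h
  have key : ∀ i : Fin 6, (∀ v, 0 ≤ crd i (wg v)) → 0 ≤ crd i (Wt m) := by
    intro i hi
    unfold Wt
    rw [Finsupp.weight_apply, Finsupp.sum, map_sum]
    apply Finset.sum_nonneg
    intro v _
    rw [map_nsmul]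
    exact nsmul_nonneg (hi v) _
  have h0 := key 0 (by
    intro v; rw [← wm_g]
    rcases v with a | a
    · exact zero_le_one
    · exact le_refl _)
  have h1 := key 1 (by
    intro v; rw [← wm_g]
    rcases v with a | a
    · exact le_refl _
    · exact zero_le_one)
  omega

lemma altS_expand {R : Type*} [CommRing R] (A B C G : R) :
    ((1 - A) * ((1 - A * B) * ((1 - A * B * C) * ((1 - B) * ((1 - B * C) * (1 - C)))))) * G =
    altS (fun i j k => A ^ i.toNat * B ^ j.toNat * C ^ k.toNat * G) := by
  have e2 : Int.toNat 2 = 2 := rfl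
  have e3 : Int.toNat 3 = 3 := rfl
  have e4 : Int.toNat 4 = 4 := rfl
  unfold altS
  simp only [Int.toNat_zero, Int.toNat_one, e2, e3, e4]
  ring

lemma altS_coeff (T : ℤ → ℤ → ℤ → HF) (γ : Gm) :
    (altS T).coeff γ = altS (fun i j k => (T i j k).coeff γ) := by
  unfold altS
  simp only [HahnSeries.coeff_add, HahnSeries.coeff_sub]

lemma xg_pow (a : Gm) (n : ℕ) : xg a ^ n = xg (n • a) := by
  induction n with
  | zero => simp [xg_zero]
  | succ n ih => rw [pow_succ, ih, xg_mul, succ_nsmul]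

lemma altS_congr {R : Type*} [Ring R] (T U : ℤ → ℤ → ℤ → R)
    (h : ∀ i j k, 0 ≤ i → 0 ≤ j → 0 ≤ k → T i j k = U i j k) : altS T = altS U := by
  unfold altS
  rw [h 0 0 0, h 0 0 1, h 0 1 0, h 0 1 2, h 0 2 1, h 0 2 2, h 1 0 0, h 1 0 1, h 1 2 0, h 1 2 3, h 1 3 1,
    h 1 3 3, h 2 1 0, h 2 1 2, h 2 2 0, h 2 2 3, h 2 4 2, h 2 4 3, h 3 2 1, h 3 2 2, h 3 3 1,
    h 3 3 3, h 3 4 2, h 3 4 3]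
  all_goals norm_num

def Am : Mon := ⟨0, 0, -1, 1, 0, 0⟩
def Bm : Mon := ⟨0, 0, 0, -1, 1, 0⟩
def Cm : Mon := ⟨0, 0, 0, 0, -1, 1⟩

lemma start_val : val xm Term.start =
    altS (fun i j k => xm Am ^ i.toNat * xm Bm ^ j.toNat * xm Cm ^ k.toNat * GS) := by
  have hds : (dpr xm Term.start.ds)⁻¹ = GS := by
    rw [dpr_start]; unfold GS; rw [Finset.prod_inv_distrib]
  have hx0 : xm Mon.zero = 1 := by
    have h1 := isX.add Mon.zero Mon.zero
    have h2 : Mon.zero.add Mon.zero = Mon.zero := rfl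
    rw [h2] at h1
    exact (mul_eq_left₀ (isX.ne _)).mp h1.symm
  have hns : dpr xm Term.start.ns = (1 - xm Am) * ((1 - xm Am * xm Bm) *
      ((1 - xm Am * xm Bm * xm Cm) * ((1 - xm Bm) * ((1 - xm Bm * xm Cm) * (1 - xm Cm))))) := by
    rw [← isX.add, ← isX.add, ← isX.add]
    change dpr xm [Am, Am.add Bm, (Am.add Bm).add Cm, Bm, Bm.add Cm, Cm] = _
    simp only [dpr_cons, dpr_nil, mul_one]
  unfold val
  rw [hds, hns, ← altS_expand]
  change ((1 : ℤ) : HF) * xm Mon.zero * _ * _ = _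
  rw [hx0]; simp

lemma PH_coeff (p q : ℤ) : PH.coeff (toLex ![p, q, 0, 0, 0, 0]) =
    altS (fun i j k => GS.coeff (gmu p q i j k)) := by
  unfold PH
  have h : ∀ k, lc k (toLex ![p, q, 0, 0, 0, 0]) = 0 := by
    intro k; fin_cases k <;> rfl
  rw [prj_coeff, if_pos (h 2), prj_coeff, if_pos (h 1), prj_coeff, if_pos (h 0), start_val,
    altS_coeff]
  apply altS_congr
  intro i j k hi hj hk
  obtain ⟨i, rfl⟩ := Int.eq_ofNat_of_zero_le hi
  obtain ⟨j, rfl⟩ := Int.eq_ofNat_of_zero_le hj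
  obtain ⟨k, rfl⟩ := Int.eq_ofNat_of_zero_le hk
  unfold xm
  rw [xg_pow, xg_pow, xg_pow, xg_mul, xg_mul, xg_mul_coeff]
  congr 1
  apply ofLex.injective
  funext u
  change (![p, q, 0, 0, 0, 0] : Fin 6 → ℤ) u - ((((i : ℤ).toNat) • ofLex Am.g) u +
    (((j : ℤ).toNat) • ofLex Bm.g) u + (((k : ℤ).toNat) • ofLex Cm.g) u) = _
  fin_cases u <;> simp [gmu, Mon.g, Am, Bm, Cm] <;> omega

lemma PH_coeff_neg (p q : ℤ) (h : p < 0 ∨ q < 0) : PH.coeff (toLex ![p, q, 0, 0, 0, 0]) = 0 := by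
  rw [PH_coeff]
  have : ∀ i j k, GS.coeff (gmu p q i j k) = 0 := fun i j k => GS_zero _ h
  simp [altS, this]

end PartCount

def i2 (p q : ℕ) : Fin 2 →₀ ℕ := Finsupp.single 0 p + Finsupp.single 1 q

lemma i2_0 (p q : ℕ) : i2 p q 0 = p := by simp [i2]
lemma i2_1 (p q : ℕ) : i2 p q 1 = q := by simp [i2]
lemma i2_eq (d : Fin 2 →₀ ℕ) : i2 (d 0) (d 1) = d := by
  ext i; fin_cases i
  · exact i2_0 _ _
  · exact i2_1 _ _

/-- coefficients with integer indices -/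
def cf (f : MvPowerSeries (Fin 2) ℚ) (p q : ℤ) : ℚ :=
  if 0 ≤ p ∧ 0 ≤ q then MvPowerSeries.coeff (i2 p.toNat q.toNat) f else 0

def PRel (f : MvPowerSeries (Fin 2) ℚ) (g : HF) : Prop :=
  ∀ p q : ℤ, g.coeff (toLex ![p, q, 0, 0, 0, 0]) = cf f p q

def Good (d : MvPowerSeries (Fin 2) ℚ) (e : HF) : Prop := ∀ f g, PRel f g → PRel (f * d) (g * e)

lemma Good.app {d : MvPowerSeries (Fin 2) ℚ} {e : HF} (h : Good d e) {f g} (hr : PRel f g) :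
    PRel (f * d) (g * e) := h f g hr

lemma cf_add (f g : MvPowerSeries (Fin 2) ℚ) (p q : ℤ) : cf (f + g) p q = cf f p q + cf g p q := by
  unfold cf; split_ifs <;> simp
lemma cf_sub (f g : MvPowerSeries (Fin 2) ℚ) (p q : ℤ) : cf (f - g) p q = cf f p q - cf g p q := by
  unfold cf; split_ifs <;> simp

lemma Good.add {d d' : MvPowerSeries (Fin 2) ℚ} {e e' : HF} (h : Good d e) (h' : Good d' e') :
    Good (d + d') (e + e') := by
  intro f g hr p q
  rw [mul_add, mul_add, HahnSeries.coeff_add, cf_add, h f g hr, h' f g hr]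
lemma Good.sub {d d' : MvPowerSeries (Fin 2) ℚ} {e e' : HF} (h : Good d e) (h' : Good d' e') :
    Good (d - d') (e - e') := by
  intro f g hr p q
  rw [mul_sub, mul_sub, HahnSeries.coeff_sub, cf_sub, h f g hr, h' f g hr]
lemma Good.mul {d d' : MvPowerSeries (Fin 2) ℚ} {e e' : HF} (h : Good d e) (h' : Good d' e') :
    Good (d * d') (e * e') := by
  intro f g hr
  rw [← mul_assoc, ← mul_assoc]
  exact h' _ _ (h _ _ hr)
lemma good_one : Good 1 1 := by
  intro f g hr; rwa [mul_one, mul_one]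
lemma good_two : Good 2 2 := by
  have := good_one.add good_one
  rwa [one_add_one_eq_two, one_add_one_eq_two] at this
lemma Good.pow {d : MvPowerSeries (Fin 2) ℚ} {e : HF} (h : Good d e) (n : ℕ) :
    Good (d ^ n) (e ^ n) := by
  induction n with
  | zero => simpa using good_one
  | succ n ih => rw [pow_succ, pow_succ]; exact ih.mul h

lemma xm_coeff (M : Mon) (g : HF) (γ : Gm) : (g * xm M).coeff γ = g.coeff (γ - M.g) := by
  rw [mul_comm]; exact xg_mul_coeff _ _ _

lemma good_s : Good ps (xm (mst 1 0)) := by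
  intro f g hr p q
  have e : (toLex ![p, q, 0, 0, 0, 0] : Gm) - (mst 1 0).g = toLex ![p - 1, q, 0, 0, 0, 0] := by
    apply ofLex.injective
    funext u
    change (![p, q, 0, 0, 0, 0] : Fin 6 → ℤ) u - ofLex (mst 1 0).g u = _
    fin_cases u <;> simp [Mon.g, mst]
  rw [xm_coeff, e, hr]
  unfold cf
  by_cases hp : 1 ≤ p ∧ 0 ≤ q
  · rw [if_pos (by omega), if_pos (by omega)]
    unfold ps
    have h2 : i2 p.toNat q.toNat = i2 (p - 1).toNat q.toNat + Finsupp.single 0 1 := by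
      unfold i2
      rw [add_right_comm, ← Finsupp.single_add]
      congr 2; omega
    rw [h2, MvPowerSeries.X, MvPowerSeries.coeff_add_mul_monomial, mul_one]
  · rw [if_neg (by omega)]
    split_ifs with h
    · unfold ps
      rw [MvPowerSeries.X, MvPowerSeries.coeff_mul_monomial, if_neg]
      rw [Finsupp.single_le_iff, i2_0]; omega
    · rfl

lemma good_t : Good pt (xm (mst 0 1)) := by
  intro f g hr p q
  have e : (toLex ![p, q, 0, 0, 0, 0] : Gm) - (mst 0 1).g = toLex ![p, q - 1, 0, 0, 0, 0] := by
    apply ofLex.injective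
    funext u
    change (![p, q, 0, 0, 0, 0] : Fin 6 → ℤ) u - ofLex (mst 0 1).g u = _
    fin_cases u <;> simp [Mon.g, mst]
  rw [xm_coeff, e, hr]
  unfold cf
  by_cases hp : 0 ≤ p ∧ 1 ≤ q
  · rw [if_pos (by omega), if_pos (by omega)]
    unfold pt
    have h2 : i2 p.toNat q.toNat = i2 p.toNat (q - 1).toNat + Finsupp.single 1 1 := by
      unfold i2
      rw [add_assoc, ← Finsupp.single_add]
      congr 2; omega
    rw [h2, MvPowerSeries.X, MvPowerSeries.coeff_add_mul_monomial, mul_one]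
  · rw [if_neg (by omega)]
    split_ifs with h
    · unfold pt
      rw [MvPowerSeries.X, MvPowerSeries.coeff_mul_monomial, if_neg]
      rw [Finsupp.single_le_iff, i2_1]; omega
    · rfl

lemma rel_one : PRel 1 1 := by
  intro p q
  rw [← xg_zero, xg_coeff]
  unfold cf
  by_cases h : p = 0 ∧ q = 0
  · obtain ⟨rfl, rfl⟩ := h
    rw [if_pos, if_pos (by simp)]
    · simp [i2]
    · apply ofLex.injective
      funext u
      fin_cases u <;> rfl
  · rw [if_neg]
    · split_ifs with h2
      · rw [MvPowerSeries.coeff_one, if_neg]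
        intro h3
        have h4 := congrArg (fun d : Fin 2 →₀ ℕ => d 0) h3
        have h5 := congrArg (fun d : Fin 2 →₀ ℕ => d 1) h3
        simp only [i2_0, i2_1, Finsupp.coe_zero, Pi.zero_apply] at h4 h5
        omega
      · rfl
    · intro h3
      apply h
      have h4 := congrArg (crd 0) h3
      have h5 := congrArg (crd 1) h3
      exact ⟨h4, h5⟩

lemma rel_unique {f f' : MvPowerSeries (Fin 2) ℚ} {g : HF} (h : PRel f g) (h' : PRel f' g) : f = f' := by
  ext d
  have h1 := h (d 0) (d 1)
  rw [h'] at h1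
  unfold cf at h1
  rw [if_pos (by omega), if_pos (by omega), Int.toNat_natCast, Int.toNat_natCast, i2_eq] at h1
  exact h1.symm

lemma rel_PH (K : Type*) [Field K] [CharZero K] : PRel (purePS2 K 4) PH := by
  intro p q
  unfold cf
  split_ifs with h
  · obtain ⟨p, rfl⟩ := Int.eq_ofNat_of_zero_le h.1
    obtain ⟨q, rfl⟩ := Int.eq_ofNat_of_zero_le h.2
    rw [PH_coeff]
    change _ = (pureDim K 4 (i2 (p : ℤ).toNat (q : ℤ).toNat 0) (i2 (p : ℤ).toNat (q : ℤ).toNat 1) : ℚ)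
    rw [i2_0, i2_1, Int.toNat_natCast, Int.toNat_natCast]
    have h1 := congrArg (Int.cast : ℤ → ℚ) (pureDim_eq K p q)
    rw [Int.cast_natCast] at h1
    rw [h1]
    simp only [GS_coeff]
    push_cast [altS]
    rfl
  · exact PH_coeff_neg p q (by omega)

/-- The bigraded Poincaré series of the pure trace algebra of two generic `4 × 4`
matrices equals `N / D`, with
`N = (1 − st + s²t²)(1 − st² − s²t + s²t³ + s³t² + s²t⁴ + 2s³t³ + s⁴t² + s³t⁴ + s⁴t³ − s⁴t⁵ − s⁵t⁴ + s⁶t⁶)`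
 and
`D = (1−s)(1−t)(1−s²)(1−st)²(1−t²)(1−s³)(1−s²t)²(1−st²)²(1−t³)(1−s⁴)(1−s³t)(1−s²t²)(1−st³)(1−t⁴)`. -/
theorem poincare_C42 (K : Type*) [Field K] [CharZero K] :
    purePS2 K 4 *
        ((1 - ps) * (1 - pt) *
          (1 - ps ^ 2) * (1 - ps * pt) ^ 2 * (1 - pt ^ 2) *
          (1 - ps ^ 3) * (1 - ps ^ 2 * pt) ^ 2 * (1 - ps * pt ^ 2) ^ 2 * (1 - pt ^ 3) *
          (1 - ps ^ 4) * (1 - ps ^ 3 * pt) * (1 - ps ^ 2 * pt ^ 2) * (1 - ps * pt ^ 3) *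
          (1 - pt ^ 4)) =
      (1 - ps * pt + ps ^ 2 * pt ^ 2) *
        (1 - ps * pt ^ 2 - ps ^ 2 * pt + ps ^ 2 * pt ^ 3 + ps ^ 3 * pt ^ 2 + ps ^ 2 * pt ^ 4 +
          2 * (ps ^ 3 * pt ^ 3) + ps ^ 4 * pt ^ 2 + ps ^ 3 * pt ^ 4 + ps ^ 4 * pt ^ 3 -
          ps ^ 4 * pt ^ 5 - ps ^ 5 * pt ^ 4 + ps ^ 6 * pt ^ 6) := by
  obtain ⟨s, hs0⟩ : ∃ s, s = xm (mst 1 0) := ⟨_, rfl⟩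
  obtain ⟨t, ht0⟩ : ∃ t, t = xm (mst 0 1) := ⟨_, rfl⟩
  have hPH := PH_eq s t hs0 ht0
  have hs : Good ps s := hs0 ▸ good_s
  have ht : Good pt t := ht0 ▸ good_t
  have h1 := good_one
  have h2 := good_two
  refine rel_unique (g := PH * ((1 - s) * (1 - t) *
          (1 - s ^ 2) * (1 - s * t) ^ 2 * (1 - t ^ 2) *
          (1 - s ^ 3) * (1 - s ^ 2 * t) ^ 2 * (1 - s * t ^ 2) ^ 2 * (1 - t ^ 3) *
          (1 - s ^ 4) * (1 - s ^ 3 * t) * (1 - s ^ 2 * t ^ 2) * (1 - s * t ^ 3) *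
          (1 - t ^ 4))) (Good.app ?_ (rel_PH K)) ?_
  · repeat' first
      | with_reducible exact hs
      | with_reducible exact ht
      | with_reducible exact h1
      | with_reducible apply Good.sub
      | with_reducible apply Good.add
      | with_reducible apply Good.mul
      | with_reducible apply Good.pow
  · rw [hPH]
    have key : Good ((1 - ps * pt + ps ^ 2 * pt ^ 2) *
        (1 - ps * pt ^ 2 - ps ^ 2 * pt + ps ^ 2 * pt ^ 3 + ps ^ 3 * pt ^ 2 + ps ^ 2 * pt ^ 4 +
          2 * (ps ^ 3 * pt ^ 3) + ps ^ 4 * pt ^ 2 + ps ^ 3 * pt ^ 4 + ps ^ 4 * pt ^ 3 -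
          ps ^ 4 * pt ^ 5 - ps ^ 5 * pt ^ 4 + ps ^ 6 * pt ^ 6)) ((1 - s * t + s ^ 2 * t ^ 2) *
        (1 - s * t ^ 2 - s ^ 2 * t + s ^ 2 * t ^ 3 + s ^ 3 * t ^ 2 + s ^ 2 * t ^ 4 +
          2 * (s ^ 3 * t ^ 3) + s ^ 4 * t ^ 2 + s ^ 3 * t ^ 4 + s ^ 4 * t ^ 3 -
          s ^ 4 * t ^ 5 - s ^ 5 * t ^ 4 + s ^ 6 * t ^ 6)) := by
      repeat' first
        | with_reducible exact hs
        | with_reducible exact ht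
        | with_reducible exact h1
        | with_reducible exact h2
        | with_reducible apply Good.sub
        | with_reducible apply Good.add
        | with_reducible apply Good.mul
        | with_reducible apply Good.pow
    have := key 1 1 rel_one
    rwa [one_mul, one_mul] at this
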